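/- Let T be a π-totally-convex set in a CAT(1) space M, and let N be the set of points at distance ≤ ρ from T, where ρ < π/2, equipped with its induced intrinsic (length) metric. Then N has injectivity radius at least π·cos ρ. -/

import Mathlib

open Set Metric Filter Topology
open scoped ENNReal NNReal

noncomputable section

/-- Inverse hyperbolic cosine. -/
def arcosh (x : ℝ) : ℝ := Real.log (x + Real.sqrt (x ^ 2 - 1))

/-- `g` restricted to `[a,b]` is a unit-speed geodesic, i.e. an isometric embedding
of the interval `[a,b]`. -/
def IsUnitGeodesicOn {X : Type*} [MetricSpace X] (g : ℝ → X) (a b : ℝ) : Prop :=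
  ∀ s ∈ Set.Icc a b, ∀ t ∈ Set.Icc a b, dist (g s) (g t) = |s - t|

/-- `x` and `y` are joined by a geodesic. -/
def JoinedByGeodesic {X : Type*} [MetricSpace X] (x y : X) : Prop :=
  ∃ g : ℝ → X, IsUnitGeodesicOn g 0 (dist x y) ∧ g 0 = x ∧ g (dist x y) = y

/-- Cosine of the angle of a triangle in the model surface `S_K` at the vertex between
sides of lengths `a` and `b`, with opposite side of length `c` (law of cosines in `S_K`). -/
def modelCosAngle (K a b c : ℝ) : ℝ :=
  if 0 < K then
    (Real.cos (Real.sqrt K * c) - Real.cos (Real.sqrt K * a) * Real.cos (Real.sqrt K * b)) /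
      (Real.sin (Real.sqrt K * a) * Real.sin (Real.sqrt K * b))
  else if K < 0 then
    (Real.cosh (Real.sqrt (-K) * a) * Real.cosh (Real.sqrt (-K) * b) -
        Real.cosh (Real.sqrt (-K) * c)) /
      (Real.sinh (Real.sqrt (-K) * a) * Real.sinh (Real.sqrt (-K) * b))
  else (a ^ 2 + b ^ 2 - c ^ 2) / (2 * a * b)

/-- Length of the side of a triangle in the model surface `S_K` opposite a vertex whose
angle has cosine `co`, the two adjacent sides having lengths `a`, `b`
(law of cosines in `S_K`). -/
def modelDistOfAngle (K a b co : ℝ) : ℝ :=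
  if 0 < K then
    Real.arccos (Real.cos (Real.sqrt K * a) * Real.cos (Real.sqrt K * b) +
      Real.sin (Real.sqrt K * a) * Real.sin (Real.sqrt K * b) * co) / Real.sqrt K
  else if K < 0 then
    arcosh (Real.cosh (Real.sqrt (-K) * a) * Real.cosh (Real.sqrt (-K) * b) -
      Real.sinh (Real.sqrt (-K) * a) * Real.sinh (Real.sqrt (-K) * b) * co) / Real.sqrt (-K)
  else Real.sqrt (a ^ 2 + b ^ 2 - 2 * a * b * co)

/-- Distance in `S_K` from the comparison point `p̃` to the point at arclength `t` along
the side `q̃ r̃` of the comparison triangle for a triangle with `d(p,q) = pq`,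
`d(p,r) = pr`, `d(q,r) = qr`. -/
def modelSideDist (K pq pr qr t : ℝ) : ℝ :=
  modelDistOfAngle K pq t (modelCosAngle K pq qr pr)

/-- Distance in the model surface `S_K` between the two points with Fermi coordinates
`z = (u₁, d₁)` and `w = (u₂, d₂)` (base parameter along a fixed geodesic, and distance
to that geodesic, both points on the same side). -/
def modelFermiDist (K : ℝ) (z w : ℝ × ℝ) : ℝ :=
  if 0 < K then
    Real.arccos (Real.cos (Real.sqrt K * z.2) * Real.cos (Real.sqrt K * w.2) *
        Real.cos (Real.sqrt K * (z.1 - w.1)) +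
      Real.sin (Real.sqrt K * z.2) * Real.sin (Real.sqrt K * w.2)) / Real.sqrt K
  else if K < 0 then
    arcosh (Real.cosh (Real.sqrt (-K) * z.2) * Real.cosh (Real.sqrt (-K) * w.2) *
        Real.cosh (Real.sqrt (-K) * (z.1 - w.1)) -
      Real.sinh (Real.sqrt (-K) * z.2) * Real.sinh (Real.sqrt (-K) * w.2)) / Real.sqrt (-K)
  else Real.sqrt ((z.1 - w.1) ^ 2 + (z.2 - w.2) ^ 2)

/-- `X` is a CAT(K) space: a complete metric space in which any two points at distance
`< π/√K` are joined by a geodesic (no restriction when `K ≤ 0`), and for every geodesic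
triangle of perimeter `< 2π/√K` the distance from a vertex to a point on the opposite
side is at most the corresponding distance in the comparison triangle in `S_K`
(the standard, equivalent, vertex–side form of the comparison). -/
def CatK (K : ℝ) (X : Type*) [MetricSpace X] : Prop :=
  CompleteSpace X ∧
    (∀ x y : X, (0 < K → dist x y < Real.pi / Real.sqrt K) → JoinedByGeodesic x y) ∧
    ∀ (p q r : X) (g : ℝ → X), IsUnitGeodesicOn g 0 (dist q r) → g 0 = q →
      g (dist q r) = r →
      (0 < K → dist p q + dist q r + dist r p < 2 * Real.pi / Real.sqrt K) →
      ∀ t ∈ Set.Icc 0 (dist q r),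
        dist p (g t) ≤ modelSideDist K (dist p q) (dist p r) (dist q r) t

/-- A set is (geodesically) convex if it contains every geodesic joining two of its
points. -/
def GeodesicConvex {X : Type*} [MetricSpace X] (S : Set X) : Prop :=
  ∀ x ∈ S, ∀ y ∈ S, ∀ g : ℝ → X, IsUnitGeodesicOn g 0 (dist x y) → g 0 = x →
    g (dist x y) = y → ∀ t ∈ Set.Icc 0 (dist x y), g t ∈ S

/-- `X` has curvature bounded above (CBA) by `K`: every point has a convex neighborhood
which (with the induced metric) is a CAT(K) space. -/
def CurvBoundedAbove (K : ℝ) (X : Type*) [MetricSpace X] : Prop :=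
  ∀ x : X, ∃ S : Set X, S ∈ nhds x ∧ GeodesicConvex S ∧ CatK K S

/-- `F` preserves the lengths of curves. -/
def LengthPreserving {N M : Type*} [MetricSpace N] [MetricSpace M] (F : N → M) : Prop :=
  ∀ (γ : ℝ → N) (s : Set ℝ), eVariationOn (F ∘ γ) s = eVariationOn γ s

/-- `X` is an intrinsic (length) metric space: the distance between two points is the
infimum of lengths of curves joining them. -/
def IsLengthSpace (X : Type*) [MetricSpace X] : Prop :=
  ∀ x y : X, edist x y =
    ⨅ (γ : ℝ → X) (_ : ContinuousOn γ (Set.Icc 0 1) ∧ γ 0 = x ∧ γ 1 = y),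
      eVariationOn γ (Set.Icc 0 1)

/-- `N` is a subspace of extrinsic curvature `≤ A` in `M`, via the length-preserving map
`F : N → M`:  `N` is a complete length space and the intrinsic distance `s = d_N` and the
extrinsic distance `r = d_M(F·,F·)` satisfy `s - r ≤ (A²/24) r³ + o(r³)`, uniformly over
all pairs of points with `s` sufficiently small. -/
def SubspaceExtCurvLE {N M : Type*} [MetricSpace N] [MetricSpace M] (A : ℝ)
    (F : N → M) : Prop :=
  CompleteSpace N ∧ IsLengthSpace N ∧ LengthPreserving F ∧
    ∀ ε > 0, ∃ δ > 0, ∀ x y : N, dist x y < δ →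
      dist x y - dist (F x) (F y) ≤
        A ^ 2 / 24 * dist (F x) (F y) ^ 3 + ε * dist (F x) (F y) ^ 3

/-- The induced intrinsic (pseudo)distance on a subset `S` of `M`: the infimum of lengths
of curves in `S` joining the two points. -/
def setIntrinsicEDist {X : Type*} [MetricSpace X] (S : Set X) (x y : X) : ℝ≥0∞ :=
  ⨅ (γ : ℝ → X) (_ : ContinuousOn γ (Set.Icc 0 1) ∧ Set.MapsTo γ (Set.Icc 0 1) S ∧
      γ 0 = x ∧ γ 1 = y),
    eVariationOn γ (Set.Icc 0 1)

/-- A subset `N` of `M` (with its induced intrinsic metric, assumed complete) has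
extrinsic curvature `≤ k` in `M`: the intrinsic distance `s` and extrinsic distance `r`
satisfy `s - r ≤ (k²/24) r³ + o(r³)`, uniformly over pairs with `s` sufficiently small. -/
def SetExtrinsicCurvLE {X : Type*} [MetricSpace X] (k : ℝ) (N : Set X) : Prop :=
  IsComplete N ∧
    ∀ ε > 0, ∃ δ > 0, ∀ x ∈ N, ∀ y ∈ N, setIntrinsicEDist N x y < ENNReal.ofReal δ →
      (setIntrinsicEDist N x y).toReal - dist x y ≤
        k ^ 2 / 24 * dist x y ^ 3 + ε * dist x y ^ 3

/-- `T` is `π`-totally-convex: it contains every geodesic of length `< π` joining pairs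
of its points. -/
def PiTotallyConvex {X : Type*} [MetricSpace X] (T : Set X) : Prop :=
  ∀ (g : ℝ → X) (L : ℝ), 0 ≤ L → L < Real.pi → IsUnitGeodesicOn g 0 L →
    g 0 ∈ T → g L ∈ T → ∀ t ∈ Set.Icc 0 L, g t ∈ T

/-- The defining property of the injectivity radius at `p`, for the radius `ρ`:
for every `ε > 0` there is `δ > 0` such that any two Lipschitz curves from `p` to a
common point `q ∈ B(p,ρ)`, parametrized proportionally to arclength by `[0,1]`, whose
lengths are within `δ` of `d(p,q)`, are `ε`-close in the uniform distance. -/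
def InjPropAt {X : Type*} [MetricSpace X] (p : X) (ρ : ℝ) : Prop :=
  ∀ ε > 0, ∃ δ > 0, ∀ q : X, dist p q < ρ →
    ∀ (γ₁ γ₂ : ℝ → X) (L₁ L₂ : ℝ≥0),
      HasConstantSpeedOnWith γ₁ (Set.Icc 0 1) L₁ → γ₁ 0 = p → γ₁ 1 = q →
        |(L₁ : ℝ) - dist p q| < δ →
      HasConstantSpeedOnWith γ₂ (Set.Icc 0 1) L₂ → γ₂ 0 = p → γ₂ 1 = q →
        |(L₂ : ℝ) - dist p q| < δ →
      ∀ t ∈ Set.Icc (0 : ℝ) 1, dist (γ₁ t) (γ₂ t) ≤ ε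

/-- The injectivity radius at `p`. -/
def injRadAt {X : Type*} [MetricSpace X] (p : X) : ℝ≥0∞ :=
  ⨆ (ρ : ℝ) (_ : InjPropAt p ρ), ENNReal.ofReal ρ

/-- The injectivity radius of `X`. -/
def injRad (X : Type*) [MetricSpace X] : ℝ≥0∞ := ⨅ p : X, injRadAt p

/-- `π/√K`, with the convention that it is `∞` for `K ≤ 0`. -/
def piOverSqrt (K : ℝ) : ℝ≥0∞ :=
  if 0 < K then ENNReal.ofReal (Real.pi / Real.sqrt K) else ⊤

/-- `c(A,K)`: the circumference of a circle of (constant geodesic) curvature `A` in the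
model surface `S_K`.  Such a circle exists iff `A² + K > 0`, in which case its
circumference is `2π/√(A² + K)`; otherwise (the complete `A`-curve being a line,
horocycle or equidistant) the value is `∞` by convention. -/
def modelCircumference (A K : ℝ) : ℝ≥0∞ :=
  if 0 < A ^ 2 + K then ENNReal.ofReal (2 * Real.pi / Real.sqrt (A ^ 2 + K)) else ⊤

/-- The Euclidean comparison angle at `p` subtended by `x`, `y`. -/
def comparisonAngle {X : Type*} [MetricSpace X] (p x y : X) : ℝ :=
  Real.arccos ((dist p x ^ 2 + dist p y ^ 2 - dist x y ^ 2) / (2 * dist p x * dist p y))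

/-- The Alexandrov upper angle between the curves `α` and `β` issuing from the common
point `α 0 = β 0`. -/
def upperAngle {X : Type*} [MetricSpace X] (α β : ℝ → X) : ℝ :=
  Filter.limsup (fun st : ℝ × ℝ => comparisonAngle (α 0) (α st.1) (β st.2))
    ((nhdsWithin (0 : ℝ) (Set.Ioi 0)) ×ˢ (nhdsWithin (0 : ℝ) (Set.Ioi 0)))

/-- A continuous function `f` on `s` is `K`-convex if `f'' ≥ -K f` in the barrier sense:
at every interior point and for every `ε > 0` there is a `C²` lower support function `g`
with `g'' (x) ≥ -K f(x) - ε`. -/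
def IsKConvexOn (K : ℝ) (s : Set ℝ) (f : ℝ → ℝ) : Prop :=
  ContinuousOn f s ∧
    ∀ x ∈ interior s, ∀ ε > 0, ∃ (g : ℝ → ℝ) (δ : ℝ), 0 < δ ∧
      Set.Ioo (x - δ) (x + δ) ⊆ s ∧
      ContDiffOn ℝ 2 g (Set.Ioo (x - δ) (x + δ)) ∧ g x = f x ∧
      (∀ y ∈ Set.Ioo (x - δ) (x + δ), g y ≤ f y) ∧
      -K * f x - ε ≤ deriv (deriv g) x

/-- `γ` is parametrized by arclength on `[a,b]`. -/
def IsArclengthParamOn {X : Type*} [MetricSpace X] (γ : ℝ → X) (a b : ℝ) : Prop :=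
  ∀ s t, a ≤ s → s ≤ t → t ≤ b → eVariationOn γ (Set.Icc s t) = ENNReal.ofReal (t - s)

/-- `γ` (parametrized by arclength on `[0,Λ]`) is a curve of extrinsic curvature `≤ k`:
for subarcs, arclength `s` and chordlength `r` satisfy `s - r ≤ (k²/24) s³ + o(s³)`. -/
def CurveExtCurvLE {X : Type*} [MetricSpace X] (γ : ℝ → X) (Λ k : ℝ) : Prop :=
  IsArclengthParamOn γ 0 Λ ∧
    ∀ ε > 0, ∃ δ > 0, ∀ s t, 0 ≤ s → s ≤ t → t ≤ Λ → t - s < δ →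
      (t - s) - dist (γ s) (γ t) ≤ k ^ 2 / 24 * (t - s) ^ 3 + ε * (t - s) ^ 3

/-- The quadrilateral region in `S_K` (in Fermi coordinates) with top vertices `zp`, `zq`
and bottom vertices their feet on the base geodesic: points over the base segment lying
on or below some geodesic joining `zp` to `zq`. -/
def fermiQuadRegion (K : ℝ) (zp zq : ℝ × ℝ) : Set (ℝ × ℝ) :=
  {z | min zp.1 zq.1 ≤ z.1 ∧ z.1 ≤ max zp.1 zq.1 ∧ 0 ≤ z.2 ∧
    ∃ d', z.2 ≤ d' ∧
      modelFermiDist K zp (z.1, d') + modelFermiDist K (z.1, d') zq =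
        modelFermiDist K zp zq}

section Helpers
open Real (cos sin arccos arctan)
set_option linter.unusedVariables false


theorem cat_geod {M : Type*} [MetricSpace M] (hM : CatK 1 M) {x y : M} (h : dist x y < Real.pi) :
    JoinedByGeodesic x y := by
  apply hM.2.1 x y
  intro _
  simpa using h

theorem cat_cos {M : Type*} [MetricSpace M] (hM : CatK 1 M) {p q r : M} {g : ℝ → M}
    (hg : IsUnitGeodesicOn g 0 (dist q r)) (h0 : g 0 = q) (h1 : g (dist q r) = r)
    (hper : dist p q + dist q r + dist r p < 2 * Real.pi) {t : ℝ}
    (ht : t ∈ Set.Icc 0 (dist q r)) :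
    sin (dist q r - t) * cos (dist p q) + sin t * cos (dist p r) ≤
      sin (dist q r) * cos (dist p (g t)) := by
  have hmain := hM.2.2 p q r g hg h0 h1 (by intro _; simpa using hper) t ht
  have t1 := dist_triangle q p r
  have t2 := dist_triangle p q r
  have t3 := dist_triangle p r q
  rw [dist_comm r p] at hper
  rw [dist_comm q p] at t1
  rw [dist_comm r q] at t3
  have hpq0 : 0 ≤ dist p q := dist_nonneg
  have hpr0 : 0 ≤ dist p r := dist_nonneg
  have hg0t : dist q (g t) = t := by
    have := hg 0 ⟨le_refl _, dist_nonneg⟩ t ht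
    rw [h0] at this
    rw [this, zero_sub, abs_neg, abs_of_nonneg ht.1]
  rcases (dist_nonneg (x := q) (y := r)).eq_or_lt with hD | hD
  · have : t = 0 := le_antisymm (by rw [hD]; exact ht.2) ht.1
    rw [← hD, this]; simp
  rcases hpq0.eq_or_lt with hpq | hpq
  · have hpq' : p = q := dist_eq_zero.mp hpq.symm
    subst hpq'
    rw [hg0t, dist_self, Real.cos_zero, Real.sin_sub]
    apply le_of_eq; ring
  set D := dist q r
  set A := dist p q
  set B := dist p r
  have hDpi : D < Real.pi := by linarith
  have hApi : A < Real.pi := by linarith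
  have sD : 0 < sin D := Real.sin_pos_of_pos_of_lt_pi hD hDpi
  have sA : 0 < sin A := Real.sin_pos_of_pos_of_lt_pi hpq hApi
  have st : 0 ≤ sin t := Real.sin_nonneg_of_nonneg_of_le_pi ht.1 (ht.2.trans hDpi.le)
  unfold modelSideDist modelDistOfAngle modelCosAngle at hmain
  simp only [Real.sqrt_one, zero_lt_one, if_true, one_mul, div_one] at hmain
  set v := (sin (D - t) * cos A + sin t * cos B) / sin D with hv
  have hin : cos A * cos t + sin A * sin t * ((cos B - cos A * cos D) / (sin A * sin D)) = v := by
    rw [hv, Real.sin_sub]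
    field_simp
    ring
  rw [hin] at hmain
  have hcB : cos B ≤ cos (A - D) := by
    rw [← Real.cos_abs (A - D)]
    apply Real.cos_le_cos_of_nonneg_of_le_pi (abs_nonneg _) (by linarith)
    rw [abs_le]; constructor <;> linarith
  have hv1 : v ≤ 1 := by
    have : v ≤ cos (A - t) := by
      rw [hv, div_le_iff₀ sD]
      have := mul_le_mul_of_nonneg_left hcB st
      calc sin (D - t) * cos A + sin t * cos B ≤ sin (D - t) * cos A + sin t * cos (A - D) := by
            linarith
        _ = cos (A - t) * sin D := by
            rw [Real.sin_sub, Real.cos_sub, Real.cos_sub]; ring_nf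
    exact this.trans (Real.cos_le_one _)
  have hfin : v ≤ cos (dist p (g t)) := by
    by_cases hv2 : -1 ≤ v
    · rw [← Real.cos_arccos hv2 hv1]
      exact Real.cos_le_cos_of_nonneg_of_le_pi dist_nonneg (Real.arccos_le_pi _) hmain
    · linarith [Real.neg_one_le_cos (dist p (g t))]
  rw [hv, div_le_iff₀ sD] at hfin
  linarith

/-- relation between the cone weights and the parameter on a segment of length `D`. -/
structure ZRel (w₁ w₂ D t R : ℝ) : Prop where
  t0 : 0 ≤ t
  tD : t ≤ D
  R0 : 0 < R
  hs : R * sin t = w₂ * sin D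
  hc : R * cos t = w₁ + w₂ * cos D

theorem ZRel.hs' {w₁ w₂ D t R : ℝ} (h : ZRel w₁ w₂ D t R) : R * sin (D - t) = w₁ * sin D := by
  rw [Real.sin_sub]
  linear_combination sin D * h.hc - cos D * h.hs

theorem ZRel.sq {w₁ w₂ D t R : ℝ} (h : ZRel w₁ w₂ D t R) :
    R ^ 2 = w₁ ^ 2 + w₂ ^ 2 + 2 * w₁ * w₂ * cos D := by
  have h1 := Real.sin_sq_add_cos_sq t
  have h2 := Real.sin_sq_add_cos_sq D
  have h3 := h.hs
  have h4 := h.hc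
  have : R ^ 2 = (R * sin t) ^ 2 + (R * cos t) ^ 2 := by linear_combination -R ^ 2 * h1
  rw [this, h3, h4]
  linear_combination w₂ ^ 2 * h2

theorem ZRel.exists {w₁ w₂ D : ℝ} (h1 : 0 ≤ w₁) (h2 : 0 ≤ w₂) (h : 0 < w₁ + w₂) (hD : 0 ≤ D)
    (hD' : D < Real.pi) : ∃ t R, ZRel w₁ w₂ D t R := by
  have hsc := Real.sin_sq_add_cos_sq D
  have hcD : -1 < cos D := by
    rw [← Real.cos_pi]; exact Real.cos_lt_cos_of_nonneg_of_le_pi hD le_rfl hD'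
  have hQ : 0 < w₁ ^ 2 + w₂ ^ 2 + 2 * w₁ * w₂ * cos D := by
    rcases h1.eq_or_lt with h1' | h1'
    · rw [← h1'] at h ⊢; simp at h ⊢; positivity
    rcases h2.eq_or_lt with h2' | h2'
    · rw [← h2'] at h ⊢; simp at h ⊢; positivity
    nlinarith [mul_pos h1' h2', sq_nonneg (w₁ - w₂)]
  set R := Real.sqrt (w₁ ^ 2 + w₂ ^ 2 + 2 * w₁ * w₂ * cos D) with hR
  have hR0 : 0 < R := Real.sqrt_pos.mpr hQ
  have hR2 : R ^ 2 = w₁ ^ 2 + w₂ ^ 2 + 2 * w₁ * w₂ * cos D := Real.sq_sqrt hQ.le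
  have sD : 0 ≤ sin D := Real.sin_nonneg_of_nonneg_of_le_pi hD hD'.le
  have habs : |w₁ + w₂ * cos D| ≤ R := by
    apply abs_le_of_sq_le_sq _ hR0.le
    rw [hR2]
    nlinarith [mul_nonneg h2 sD, sq_nonneg (w₂ * sin D)]
  set t := arccos ((w₁ + w₂ * cos D) / R) with ht
  have hct : cos t = (w₁ + w₂ * cos D) / R := by
    apply Real.cos_arccos
    · rw [le_div_iff₀ hR0]; linarith [(abs_le.mp habs).1]
    · rw [div_le_one hR0]; exact (abs_le.mp habs).2
  have hRc : R * cos t = w₁ + w₂ * cos D := by rw [hct]; field_simp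
  have ht0 : 0 ≤ t := Real.arccos_nonneg _
  have htpi : t ≤ Real.pi := Real.arccos_le_pi _
  have hst : 0 ≤ sin t := Real.sin_nonneg_of_nonneg_of_le_pi ht0 htpi
  have hRs : R * sin t = w₂ * sin D := by
    have : (R * sin t) ^ 2 = (w₂ * sin D) ^ 2 := by
      have h3 := Real.sin_sq_add_cos_sq t
      have : (R * sin t) ^ 2 = R ^ 2 - (R * cos t) ^ 2 := by linear_combination R ^ 2 * h3
      rw [this, hRc, hR2]; linear_combination -w₂ ^ 2 * hsc
    exact (pow_left_inj₀ (by positivity) (by positivity) (by norm_num)).mp this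
  refine ⟨t, R, ht0, ?_, hR0, hRs, hRc⟩
  have hs' : R * sin (D - t) = w₁ * sin D := by
    rw [Real.sin_sub]; linear_combination sin D * hRc - cos D * hRs
  by_contra hlt
  push Not at hlt
  have hneg : sin (t - D) ≤ 0 := by
    have : R * sin (t - D) ≤ 0 := by
      have e : sin (t - D) = - sin (D - t) := by rw [← Real.sin_neg]; ring_nf
      rw [e]; nlinarith [mul_nonneg h1 sD]
    by_contra hh; push Not at hh; nlinarith [mul_pos hR0 hh]
  by_cases htD : t - D < Real.pi
  · linarith [Real.sin_pos_of_pos_of_lt_pi (sub_pos.mpr hlt) htD]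
  · have hD0 : D = 0 := by linarith
    have htp : t = Real.pi := by linarith
    rw [htp, hD0, Real.cos_pi, Real.cos_zero] at hRc
    linarith

/-- the weighted comparison inequality. -/
theorem cat_weight {M : Type*} [MetricSpace M] (hM : CatK 1 M) {q r : M} {g : ℝ → M}
    (hg : IsUnitGeodesicOn g 0 (dist q r)) (h0 : g 0 = q) (h1 : g (dist q r) = r)
    {w₁ w₂ t R : ℝ} (hz : ZRel w₁ w₂ (dist q r) t R) {p : M}
    (hper : dist p q + dist q r + dist r p < 2 * Real.pi) :
    w₁ * cos (dist p q) + w₂ * cos (dist p r) ≤ R * cos (dist p (g t)) := by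
  rcases (dist_nonneg (x := q) (y := r)).eq_or_lt with hD | hD
  · have ht : t = 0 := le_antisymm (by rw [hD]; exact hz.tD) hz.t0
    have hc := hz.hc
    have hqr : q = r := dist_eq_zero.mp hD.symm
    rw [← hD, ht] at hc
    rw [ht, h0, ← hqr]
    simp at hc
    rw [hc]; apply le_of_eq; ring
  have hm := cat_cos hM hg h0 h1 hper ⟨hz.t0, hz.tD⟩
  have hDpi : dist q r < Real.pi := by
    have := dist_triangle q p r
    rw [dist_comm q p, dist_comm p r] at this
    linarith
  have sD : 0 < sin (dist q r) := Real.sin_pos_of_pos_of_lt_pi hD hDpi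
  have e1 := hz.hs'
  have e2 := hz.hs
  have := mul_le_mul_of_nonneg_left hm hz.R0.le
  have h3 : sin (dist q r) * (w₁ * cos (dist p q) + w₂ * cos (dist p r)) ≤
      sin (dist q r) * (R * cos (dist p (g t))) := by
    calc _ = R * (sin (dist q r - t) * cos (dist p q) + sin t * cos (dist p r)) := by
          linear_combination (-cos (dist p q)) * e1 - cos (dist p r) * e2
      _ ≤ _ := this
      _ = _ := by ring
  exact le_of_mul_le_mul_left h3 sD


theorem cos_anti {x y : ℝ} (h0 : 0 ≤ x) (hy : y ≤ Real.pi) (h : x ≤ y) : cos y ≤ cos x :=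
  Real.cos_le_cos_of_nonneg_of_le_pi h0 hy h

theorem sq_split (x y l : ℝ) (h0 : 0 < l) (h1 : l < 1) :
    l * (1 - l) * (x - y) ^ 2 ≤ (1 - l) * x ^ 2 + l * y ^ 2 := by
  nlinarith [sq_nonneg ((1 - l) * x + l * y)]

theorem cone_tri {s R u v w l : ℝ} (hs : 0 ≤ s) (hR : 0 ≤ R) (hu : 0 ≤ u) (hu' : u ≤ Real.pi)
    (hv : 0 ≤ v) (hv' : v ≤ Real.pi) (hw : 0 ≤ w) (hwuv : w ≤ u + v) (h0 : 0 < l) (h1 : l < 1) :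
    l * (1 - l) * (s ^ 2 + 1 - 2 * s * cos w) ≤
      (1 - l) * (s ^ 2 + R ^ 2 - 2 * s * R * cos u) + l * (1 + R ^ 2 - 2 * R * cos v) := by
  have key : ∀ v : ℝ, l * (1 - l) * (s ^ 2 + 1 - 2 * s * cos (u + v)) ≤
      (1 - l) * (s ^ 2 + R ^ 2 - 2 * s * R * cos u) + l * (1 + R ^ 2 - 2 * R * cos v) := by
    intro v
    have e1 := sq_split (s * cos u - R) (cos v - R) l h0 h1
    have e2 := sq_split (s * sin u) (- sin v) l h0 h1
    have i1 := Real.sin_sq_add_cos_sq u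
    have i2 := Real.sin_sq_add_cos_sq v
    rw [Real.cos_add]
    have E1 : s ^ 2 + 1 - 2 * s * (cos u * cos v - sin u * sin v) =
      (s * cos u - R - (cos v - R)) ^ 2 + (s * sin u - (- sin v)) ^ 2 := by
      linear_combination (-s ^ 2) * i1 - i2
    have E2 : s ^ 2 + R ^ 2 - 2 * s * R * cos u = (s * cos u - R) ^ 2 + (s * sin u) ^ 2 := by
      linear_combination (-s ^ 2) * i1
    have E3 : 1 + R ^ 2 - 2 * R * cos v = (cos v - R) ^ 2 + (- sin v) ^ 2 := by
      linear_combination - i2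
    rw [E1, E2, E3]
    nlinarith
  have hl : 0 < l * (1 - l) := mul_pos h0 (by linarith)
  by_cases h : u + v ≤ Real.pi
  · have := cos_anti hw h hwuv
    have k := key v
    nlinarith [mul_nonneg hl.le (mul_nonneg hs (sub_nonneg.mpr this))]
  · push Not at h
    have k := key (Real.pi - u)
    have : cos v ≤ cos (Real.pi - u) := cos_anti (by linarith) hv' (by linarith)
    have e : u + (Real.pi - u) = Real.pi := by ring
    rw [e, Real.cos_pi] at k
    have hw1 := Real.neg_one_le_cos w
    have a1 := mul_nonneg hl.le (mul_nonneg hs (by linarith : 0 ≤ cos w - (-1)))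
    have a2 := mul_nonneg h0.le (mul_nonneg hR (sub_nonneg.mpr this))
    nlinarith

theorem cs_of_forall {Q A B : ℝ} (hA : 0 ≤ A) (hB : 0 ≤ B)
    (h : ∀ l : ℝ, 0 < l → l < 1 → 2 * (l * (1 - l)) * Q ≤ (1 - l) ^ 2 * A + l ^ 2 * B) :
    Q ≤ Real.sqrt A * Real.sqrt B := by
  -- use `l = (√A + e)/(√A + √B + 2 e)`
  have hp : 0 ≤ Real.sqrt A := Real.sqrt_nonneg _
  have hq : 0 ≤ Real.sqrt B := Real.sqrt_nonneg _
  have hA2 := Real.sq_sqrt hA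
  have hB2 := Real.sq_sqrt hB
  set p := Real.sqrt A
  set q := Real.sqrt B
  have hmain : ∀ e : ℝ, 0 < e → Q ≤ (p + e) * (q + e) := by
    intro e he
    have hp' : 0 < p + e := by linarith
    have hq' : 0 < q + e := by linarith
    have hd : 0 < p + q + 2 * e := by linarith
    have k := h ((p + e) / (p + q + 2 * e)) (by positivity) (by rw [div_lt_one hd]; linarith)
    have e1 : 1 - (p + e) / (p + q + 2 * e) = (q + e) / (p + q + 2 * e) := by field_simp; ring
    rw [e1] at k
    have k2 : 2 * ((p + e) * (q + e)) * Q ≤ (q + e) ^ 2 * A + (p + e) ^ 2 * B := by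
      have := mul_le_mul_of_nonneg_right k (sq_nonneg (p + q + 2 * e))
      field_simp at this
      linarith
    have k3 : 2 * ((p + e) * (q + e)) * Q ≤ 2 * ((p + e) * (q + e)) * ((p + e) * (q + e)) := by
      have i1 : A ≤ (p + e) ^ 2 := by nlinarith
      have i2 : B ≤ (q + e) ^ 2 := by nlinarith
      have := mul_le_mul_of_nonneg_left i1 (sq_nonneg (q + e))
      have := mul_le_mul_of_nonneg_left i2 (sq_nonneg (p + e))
      nlinarith
    exact le_of_mul_le_mul_left k3 (by positivity)
  have hlim : Tendsto (fun e : ℝ => (p + e) * (q + e)) (𝓝[>] 0) (𝓝 (p * q)) := by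
    have : ContinuousAt (fun e : ℝ => (p + e) * (q + e)) 0 := by fun_prop
    have := this.tendsto
    simp only [add_zero] at this
    exact this.mono_left nhdsWithin_le_nhds
  exact ge_of_tendsto hlim (eventually_mem_nhdsWithin.mono fun e he => hmain e he)

theorem cat_CS {M : Type*} [MetricSpace M] (hM : CatK 1 M) {a b a' b' : M} {s s' : ℝ}
    (hs : 0 ≤ s) (hs' : 0 ≤ s')
    (h1 : dist b a + dist a b' + dist b' b < 2 * Real.pi)
    (h2 : dist a' a + dist a b' + dist b' a' < 2 * Real.pi) :
    cos (dist a a') - s' * cos (dist a b') - s * cos (dist b a') + s * s' * cos (dist b b') ≤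
      Real.sqrt (1 + s ^ 2 - 2 * s * cos (dist a b)) *
      Real.sqrt (1 + s' ^ 2 - 2 * s' * cos (dist a' b')) := by
  have hpi : dist a b' < Real.pi := by
    have := dist_triangle a b b'
    rw [dist_comm a b, dist_comm b b'] at this; linarith
  obtain ⟨g, hg, g0, g1⟩ := cat_geod hM hpi
  have gz : ∀ t, t ∈ Icc 0 (dist a b') → dist a (g t) = t ∧ dist (g t) b' = dist a b' - t := by
    intro t ht
    have e1 := hg 0 ⟨le_rfl, dist_nonneg⟩ t ht
    have e2 := hg t ht (dist a b') ⟨dist_nonneg, le_rfl⟩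
    rw [g0, zero_sub, abs_neg, abs_of_nonneg ht.1] at e1
    rw [g1, abs_sub_comm, abs_of_nonneg (by linarith [ht.2])] at e2
    exact ⟨e1, e2⟩
  apply cs_of_forall
  · nlinarith [Real.cos_le_one (dist a b), sq_nonneg (1 - s)]
  · nlinarith [Real.cos_le_one (dist a' b'), sq_nonneg (1 - s')]
  intro l l0 l1
  obtain ⟨t, R, hz⟩ := ZRel.exists (w₁ := 1 - l) (w₂ := l * s') (by linarith) (by positivity)
    (by nlinarith [mul_nonneg l0.le hs']) dist_nonneg hpi
  have c1 := cat_weight hM hg g0 g1 (p := b) hz h1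
  have c2 := cat_weight hM hg g0 g1 (p := a') hz h2
  obtain ⟨d1, d2⟩ := gz t ⟨hz.t0, hz.tD⟩
  have t1 := dist_triangle b a (g t)
  have t2 := dist_triangle b b' (g t)
  have t3 := dist_triangle a' a (g t)
  have t4 := dist_triangle a' b' (g t)
  rw [dist_comm b' (g t)] at t2 t4
  rw [dist_comm b' b] at h1
  rw [dist_comm b' a'] at h2
  have t5 := dist_triangle b (g t) a'
  rw [dist_comm (g t) a'] at t5
  have ct := cone_tri hs hz.R0.le (u := dist b (g t)) (v := dist a' (g t)) (w := dist b a')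
    dist_nonneg (by linarith) dist_nonneg (by linarith) dist_nonneg t5 l0 l1
  have hsq := hz.sq
  rw [dist_comm a' a] at c2
  rw [dist_comm b a] at c1
  have m1 := mul_le_mul_of_nonneg_left c1 (mul_nonneg hs (by linarith : 0 ≤ 1 - l))
  have m2 := mul_le_mul_of_nonneg_left c2 l0.le
  rw [hsq] at ct
  nlinarith


theorem geod_dists {M : Type*} [MetricSpace M] {g : ℝ → M} {L : ℝ} (hg : IsUnitGeodesicOn g 0 L)
    {t : ℝ} (ht : t ∈ Icc 0 L) : dist (g 0) (g t) = t ∧ dist (g t) (g L) = L - t := by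
  have hL : 0 ≤ L := ht.1.trans ht.2
  have e1 := hg 0 ⟨le_rfl, hL⟩ t ht
  have e2 := hg t ht L ⟨hL, le_rfl⟩
  rw [zero_sub, abs_neg, abs_of_nonneg ht.1] at e1
  rw [abs_sub_comm, abs_of_nonneg (by linarith [ht.2])] at e2
  exact ⟨e1, e2⟩

theorem ZRel.mid {D : ℝ} (h0 : 0 ≤ D) (h : D < Real.pi) : ZRel 1 1 D (D / 2) (2 * cos (D / 2)) := by
  have e : cos D = 2 * cos (D / 2) ^ 2 - 1 := by rw [← Real.cos_two_mul]; ring_nf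
  have e' : sin D = 2 * sin (D / 2) * cos (D / 2) := by rw [← Real.sin_two_mul]; ring_nf
  refine ⟨by linarith, by linarith, ?_, ?_, ?_⟩
  · have := Real.cos_pos_of_mem_Ioo (x := D / 2) ⟨by linarith, by linarith⟩
    linarith
  · rw [e']; ring
  · rw [e]; ring

/-- closed nonempty totally convex sets -/
structure GoodT {M : Type*} [MetricSpace M] (T : Set M) : Prop where
  cat : CatK 1 M
  closed : IsClosed T
  ne : T.Nonempty
  conv : PiTotallyConvex T

theorem GoodT.seg_mem {M : Type*} [MetricSpace M] {T : Set M} (hT : GoodT T) {x y : M}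
    (hx : x ∈ T) (hy : y ∈ T) {g : ℝ → M} (hg : IsUnitGeodesicOn g 0 (dist x y)) (h0 : g 0 = x)
    (h1 : g (dist x y) = y) (hd : dist x y < Real.pi) {t : ℝ} (ht : t ∈ Icc 0 (dist x y)) :
    g t ∈ T :=
  hT.conv g _ dist_nonneg hd hg (by rwa [h0]) (by rwa [h1]) t ht

theorem right_angle {M : Type*} [MetricSpace M] {T : Set M} (hT : GoodT T) {m e z : M}
    (he : e ∈ T) (hme : dist m e = infDist m T) (hm : infDist m T < Real.pi / 2) (hz : z ∈ T)
    (hez : dist e z < Real.pi) (hmz : dist m z ≤ Real.pi) :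
    cos (dist m z) ≤ cos (infDist m T) * cos (dist e z) := by
  have hpi := Real.pi_pos
  have hh0 : 0 ≤ infDist m T := infDist_nonneg
  rcases (dist_nonneg (x := e) (y := z)).eq_or_lt with hD | hD
  · have : e = z := dist_eq_zero.mp hD.symm
    rw [← this, hme]; simp
  by_cases hper : dist m e + dist e z + dist z m < 2 * Real.pi
  · obtain ⟨g, hg, g0, g1⟩ := cat_geod hT.cat hez
    set D := dist e z with hDdef
    set h := infDist m T with hh
    let F : ℝ → ℝ := fun s => cos h * (sin D - sin (D - s)) - sin s * cos (dist m z)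
    have hF : ∀ s, 0 < s → s < D → 0 ≤ F s := by
      intro s s0 s1
      have hs : s ∈ Icc 0 (dist e z) := ⟨s0.le, s1.le⟩
      have c := cat_cos hT.cat hg g0 g1 hper hs
      have hin := hT.seg_mem he hz hg g0 g1 hez hs
      have h1 : h ≤ dist m (g s) := infDist_le_dist_of_mem hin
      obtain ⟨d1, d2⟩ := geod_dists hg hs
      rw [g0] at d1
      rw [g1] at d2
      have t1 := dist_triangle m e (g s)
      have t2 := dist_triangle m z (g s)
      rw [dist_comm z (g s)] at t2
      rw [dist_comm z m] at hper
      have h2 : cos (dist m (g s)) ≤ cos h := cos_anti hh0 (by linarith) h1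
      have sD : 0 < sin D := Real.sin_pos_of_pos_of_lt_pi hD hez
      have := mul_le_mul_of_nonneg_left h2 sD.le
      rw [hme] at c
      simp only [F]
      linarith
    have hder : HasDerivAt F (cos h * cos D - cos (dist m z)) 0 := by
      have d1 : HasDerivAt (fun s : ℝ => sin (D - s)) (cos (D - 0) * (-1)) 0 := by
        apply HasDerivAt.sin
        simpa using (hasDerivAt_id (0 : ℝ)).const_sub D
      have d2 := ((d1.const_sub (sin D)).const_mul (cos h)).sub
        ((Real.hasDerivAt_sin 0).mul_const (cos (dist m z)))
      exact HasDerivAt.congr_deriv (f := F) d2 (by rw [Real.cos_zero]; ring_nf)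
    have hsl := hder.tendsto_slope_zero_right
    have hF0 : F 0 = 0 := by simp [F]
    have : 0 ≤ cos h * cos D - cos (dist m z) := by
      apply ge_of_tendsto hsl
      have hmem : Ioo (0 : ℝ) D ∈ 𝓝[>] (0 : ℝ) := Ioo_mem_nhdsGT hD
      filter_upwards [hmem] with s hs
      rw [zero_add, hF0, sub_zero, smul_eq_mul]
      exact mul_nonneg (inv_nonneg.mpr hs.1.le) (hF s hs.1 hs.2)
    linarith
  · push Not at hper
    rw [dist_comm z m, hme] at hper
    have h1 : cos (dist m z) ≤ cos (infDist m T + dist e z) := by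
      rw [← Real.cos_two_pi_sub (infDist m T + dist e z)]
      exact cos_anti (by linarith) hmz (by linarith)
    rw [Real.cos_add] at h1
    have s1 := Real.sin_nonneg_of_nonneg_of_le_pi hh0 (by linarith)
    have s2 := Real.sin_nonneg_of_nonneg_of_le_pi hD.le hez.le
    nlinarith [mul_nonneg s1 s2]

theorem mid_bound {M : Type*} [MetricSpace M] {T : Set M} (hT : GoodT T) {m e e' : M} {c : ℝ}
    (he : e ∈ T) (he' : e' ∈ T) (h1 : dist m e ≤ c) (h2 : dist m e' ≤ c) (hc : c < Real.pi / 2) :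
    cos c ≤ cos (dist e e' / 2) * cos (infDist m T) := by
  have hpi := Real.pi_pos
  have t0 := dist_triangle e m e'
  rw [dist_comm e m] at t0
  have hd : dist e e' < Real.pi := by linarith
  obtain ⟨g, hg, g0, g1⟩ := cat_geod hT.cat hd
  have hz := ZRel.mid (dist_nonneg (x := e) (y := e')) hd
  have c1 := cat_weight hT.cat hg g0 g1 (p := m) hz (by rw [dist_comm e' m]; linarith)
  have hin := hT.seg_mem he he' hg g0 g1 hd ⟨hz.t0, hz.tD⟩
  have h3 : infDist m T ≤ dist m (g (dist e e' / 2)) := infDist_le_dist_of_mem hin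
  obtain ⟨d1, d2⟩ := geod_dists hg ⟨hz.t0, hz.tD⟩
  rw [g0] at d1
  have t1 := dist_triangle m e (g (dist e e' / 2))
  have h4 := cos_anti infDist_nonneg (by linarith) h3
  have k1 := cos_anti dist_nonneg (by linarith) h1
  have k2 := cos_anti dist_nonneg (by linarith) h2
  have := mul_le_mul_of_nonneg_left h4 hz.R0.le
  nlinarith

theorem foot {M : Type*} [MetricSpace M] {T : Set M} (hT : GoodT T) {m : M}
    (hm : infDist m T < Real.pi / 2) : ∃ e ∈ T, dist m e = infDist m T := by
  have hpi := Real.pi_pos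
  have hh0 : 0 ≤ infDist m T := infDist_nonneg
  set h := infDist m T with hh
  have hex : ∀ n : ℕ, ∃ e ∈ T, dist m e < h + 1 / ((n : ℝ) + 1) := by
    intro n
    exact (infDist_lt_iff hT.ne).mp (by have : (0:ℝ) < 1 / ((n : ℝ) + 1) := by positivity
                                        linarith)
  choose e heT he using hex
  have hcauchy : CauchySeq e := by
    rw [Metric.cauchySeq_iff]
    intro δ hδ
    set d := min δ Real.pi with hd
    have hd0 : 0 < d := lt_min hδ hpi
    have hcd : cos (d / 2) < 1 := by
      rw [← Real.cos_zero]
      exact Real.cos_lt_cos_of_nonneg_of_le_pi le_rfl (by linarith [min_le_right δ Real.pi])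
        (by linarith)
    have hch : 0 < cos h := Real.cos_pos_of_mem_Ioo ⟨by linarith, hm⟩
    have hev : ∀ᶠ c in 𝓝 h, cos (d / 2) * cos h < cos c ∧ c < Real.pi / 2 := by
      apply Filter.Eventually.and
      · apply (Real.continuous_cos.tendsto h).eventually_const_lt
        nlinarith
      · exact eventually_lt_nhds hm
    obtain ⟨ε, hε, hball⟩ := Metric.eventually_nhds_iff.mp hev
    obtain ⟨N, hN⟩ := exists_nat_one_div_lt hε
    refine ⟨N, fun i hi j hj => ?_⟩
    have hle : ∀ i, N ≤ i → dist m (e i) ≤ h + 1 / ((N : ℝ) + 1) := by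
      intro i hi
      refine (he i).le.trans ?_
      have : (N : ℝ) ≤ i := by exact_mod_cast hi
      gcongr
    have hb := @hball (h + 1 / ((N : ℝ) + 1)) (by
      rw [Real.dist_eq, add_sub_cancel_left, abs_of_pos (by positivity)]; exact hN)
    have hmb := mid_bound hT (heT i) (heT j) (hle i hi) (hle j hj) hb.2
    rw [← hh] at hmb
    by_contra hcon
    push Not at hcon
    have t0 := dist_triangle (e i) m (e j)
    rw [dist_comm (e i) m] at t0
    have := hle i hi
    have := hle j hj
    have hdd : d ≤ dist (e i) (e j) := (min_le_left _ _).trans hcon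
    have : cos (dist (e i) (e j) / 2) ≤ cos (d / 2) :=
      cos_anti (by linarith) (by linarith [hb.2]) (by linarith)
    nlinarith [hb.1]
  have := hT.cat.1
  obtain ⟨x, hx⟩ := cauchySeq_tendsto_of_complete hcauchy
  have hxT : x ∈ T := hT.closed.mem_of_tendsto hx (Eventually.of_forall heT)
  refine ⟨x, hxT, le_antisymm ?_ (infDist_le_dist_of_mem hxT)⟩
  have l1 : Tendsto (fun n => dist m (e n)) atTop (𝓝 (dist m x)) := tendsto_const_nhds.dist hx
  have l2 : Tendsto (fun n : ℕ => h + 1 / ((n : ℝ) + 1)) atTop (𝓝 (h + 0)) :=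
    tendsto_const_nhds.add tendsto_one_div_add_atTop_nhds_zero_nat
  rw [add_zero] at l2
  exact le_of_tendsto_of_tendsto' l1 l2 (fun n => (he n).le)

theorem local_conv {M : Type*} [MetricSpace M] {T : Set M} (hT : GoodT T) {g : ℝ → M} {L : ℝ}
    (hL0 : 0 ≤ L) (hg : IsUnitGeodesicOn g 0 L)
    (hx : infDist (g 0) T < Real.pi / 2) (hy : infDist (g L) T < Real.pi / 2)
    (hm : infDist (g (L / 2)) T + L / 2 < Real.pi / 2) :
    2 * cos (L / 2) * sin (infDist (g (L / 2)) T) ≤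
      sin (infDist (g 0) T) + sin (infDist (g L) T) := by
  have hpi := Real.pi_pos
  have hmem : L / 2 ∈ Icc 0 L := ⟨by linarith, by linarith⟩
  obtain ⟨dx, dy⟩ := geod_dists hg hmem
  obtain ⟨dL, -⟩ := geod_dists hg (t := L) ⟨hL0, le_rfl⟩
  have x0 : 0 ≤ infDist (g 0) T := infDist_nonneg
  have y0 : 0 ≤ infDist (g L) T := infDist_nonneg
  have m0 : 0 ≤ infDist (g (L / 2)) T := infDist_nonneg
  obtain ⟨e, heT, he⟩ := foot hT (m := g (L / 2)) (by linarith)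
  have main : ∀ x : M, dist x (g (L / 2)) = L / 2 → infDist x T < Real.pi / 2 →
      cos (L / 2) - cos (infDist (g (L / 2)) T) * cos (dist x e) ≤
        sin (infDist x T) * sin (infDist (g (L / 2)) T) := by
    intro x hxm hxh
    have x0 : 0 ≤ infDist x T := infDist_nonneg
    obtain ⟨x', hxT, hx'⟩ := foot hT hxh
    set m := g (L / 2)
    set h := infDist m T
    have c1 : 0 ≤ cos (infDist x T) := Real.cos_nonneg_of_mem_Icc ⟨by linarith, by linarith⟩
    have c2 : 0 ≤ cos h := Real.cos_nonneg_of_mem_Icc ⟨by linarith, by linarith⟩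
    have t1 := dist_triangle x m e
    have t2 := dist_triangle e x x'
    have t3 := dist_triangle m x x'
    rw [dist_comm e x] at t2
    rw [dist_comm m x] at t3
    have cs := cat_CS hT.cat (a := x) (b := x') (a' := m) (b' := e) c1 c2
      (by rw [dist_comm x' x]; linarith) (by rw [dist_comm m x, dist_comm e m]; linarith)
    have ra := right_angle hT heT he (by linarith) hxT (by linarith) (by linarith)
    rw [hx', he] at cs
    have e1 : Real.sqrt (1 + cos (infDist x T) ^ 2 - 2 * cos (infDist x T) * cos (infDist x T)) =
        sin (infDist x T) := by
      rw [← Real.sqrt_sq (Real.sin_nonneg_of_nonneg_of_le_pi x0 (by linarith)), Real.sin_sq]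
      ring_nf
    have e2 : Real.sqrt (1 + cos h ^ 2 - 2 * cos h * cos h) = sin h := by
      rw [← Real.sqrt_sq (Real.sin_nonneg_of_nonneg_of_le_pi m0 (by linarith)), Real.sin_sq]
      ring_nf
    rw [e1, e2, hxm, dist_comm x' m, dist_comm x' e] at cs
    have := mul_le_mul_of_nonneg_left ra c1
    linarith
  have mx := main (g 0) dx hx
  have my := main (g L) (by rw [dist_comm, dy]; ring) hy
  have hLpi : dist (g 0) (g L) < Real.pi := by rw [dL]; linarith
  have t1 := dist_triangle (g 0) (g (L / 2)) e
  have t2 := dist_triangle (g L) (g (L / 2)) e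
  rw [dist_comm (g L) (g (L / 2))] at t2
  have hzz := ZRel.mid dist_nonneg hLpi
  have cw := cat_weight hT.cat (q := g 0) (r := g L) (p := e) (by rw [dL]; exact hg) rfl
    (by rw [dL]) hzz
    (by rw [dist_comm e (g 0)]; linarith)
  rw [dL, dist_comm e (g (L / 2)), he, dist_comm e, dist_comm e] at cw
  set h := infDist (g (L / 2)) T with hh
  rcases m0.eq_or_lt with h00 | h00
  · rw [← h00, Real.sin_zero, mul_zero]
    exact add_nonneg (Real.sin_nonneg_of_nonneg_of_le_pi x0 (by linarith))
      (Real.sin_nonneg_of_nonneg_of_le_pi y0 (by linarith))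
  · have sp : 0 < sin h := Real.sin_pos_of_pos_of_lt_pi h00 (by linarith)
    have c2 : 0 ≤ cos h := Real.cos_nonneg_of_mem_Icc ⟨by linarith, by linarith⟩
    have := mul_le_mul_of_nonneg_left cw c2
    have isc := Real.sin_sq_add_cos_sq h
    have k : sin h * (2 * cos (L / 2) * sin h) ≤
      sin h * (sin (infDist (g 0) T) + sin (infDist (g L) T)) := by
      have : sin h * (2 * cos (L / 2) * sin h) = 2 * cos (L / 2)
          - cos h * (2 * cos (L / 2) * cos h) := by
        linear_combination 2 * cos (L / 2) * isc
      rw [this]; linarith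
    exact le_of_mul_le_mul_left k sp

theorem max_princ {M : Type*} [MetricSpace M] {T : Set M} (hT : GoodT T) {g : ℝ → M} {L ρ : ℝ}
    (hL0 : 0 ≤ L) (hLpi : L < Real.pi) (hg : IsUnitGeodesicOn g 0 L) (hρ : ρ < Real.pi / 2)
    (hx : infDist (g 0) T ≤ ρ) (hy : infDist (g L) T ≤ ρ)
    (hall : ∀ t ∈ Icc 0 L, infDist (g t) T < Real.pi / 2) {t : ℝ} (ht : t ∈ Icc 0 L) :
    sin (infDist (g t) T) * cos (L / 2) ≤ sin ρ * cos (t - L / 2) := by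
  have hpi := Real.pi_pos
  have hgc : ContinuousOn g (Icc 0 L) := by
    have : LipschitzOnWith 1 g (Icc 0 L) := LipschitzOnWith.of_dist_le_mul (by
      intro x hx y hy; rw [hg x hx y hy, Real.dist_eq]; simp)
    exact this.continuousOn
  have hcpos : ∀ t ∈ Icc 0 L, 0 < cos (t - L / 2) := by
    intro t ht
    exact Real.cos_pos_of_mem_Ioo ⟨by linarith [ht.1], by linarith [ht.2]⟩
  set φ : ℝ → ℝ := fun t => sin (infDist (g t) T) / cos (t - L / 2) with hφ
  have hφc : ContinuousOn φ (Icc 0 L) := by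
    apply ContinuousOn.div
    · exact Real.continuous_sin.comp_continuousOn
        ((continuous_infDist_pt T).comp_continuousOn hgc)
    · fun_prop
    · intro t ht; exact (hcpos t ht).ne'
  obtain ⟨c0, hc0, hmax⟩ := isCompact_Icc.exists_isMaxOn (nonempty_Icc.mpr hL0) hφc
  set c := φ c0 with hc
  have hmax' : ∀ t ∈ Icc 0 L, φ t ≤ c := fun t ht => hmax ht
  have hScl : IsCompact (Icc 0 L ∩ φ ⁻¹' {c}) :=
    isCompact_Icc.of_isClosed_subset
      (hφc.preimage_isClosed_of_isClosed isClosed_Icc isClosed_singleton) inter_subset_left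
  obtain ⟨t0, ht0, hleast⟩ := hScl.exists_isLeast ⟨c0, hc0, rfl⟩
  have hφt0 : φ t0 = c := ht0.2
  have ht0I : t0 ∈ Icc 0 L := ht0.1
  have hcL : 0 < cos (L / 2) := Real.cos_pos_of_mem_Ioo ⟨by linarith, by linarith⟩
  have hsm : ∀ x : M, infDist x T ≤ ρ → sin (infDist x T) ≤ sin ρ := by
    intro x hx
    have : 0 ≤ infDist x T := infDist_nonneg
    exact Real.sin_le_sin_of_le_of_le_pi_div_two (by linarith) (by linarith) hx
  have hcle : c * cos (L / 2) ≤ sin ρ := by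
    rcases ht0I.1.eq_or_lt with hz | hz
    · have : c * cos (L / 2) = sin (infDist (g 0) T) := by
        rw [← hφt0, hφ]; simp only [← hz, zero_sub, Real.cos_neg]; field_simp
      rw [this]; exact hsm _ hx
    rcases ht0I.2.eq_or_lt with hz' | hz'
    · have : c * cos (L / 2) = sin (infDist (g L) T) := by
        rw [← hφt0, hφ]
        have e : L - L / 2 = L / 2 := by ring
        simp only [hz', e]; field_simp
      rw [this]; exact hsm _ hy
    exfalso
    set s := min (min t0 (L - t0)) ((Real.pi / 2 - infDist (g t0) T) / 2) with hs
    have hs0 : 0 < s := by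
      have := hall t0 ht0I
      refine lt_min (lt_min hz (by linarith)) (by linarith)
    have s1 : s ≤ t0 := (min_le_left _ _).trans (min_le_left _ _)
    have s2 : s ≤ L - t0 := (min_le_left _ _).trans (min_le_right _ _)
    have s3 : s ≤ (Real.pi / 2 - infDist (g t0) T) / 2 := min_le_right _ _
    have mA : t0 - s ∈ Icc 0 L := ⟨by linarith, by linarith⟩
    have mB : t0 + s ∈ Icc 0 L := ⟨by linarith, by linarith⟩
    have hlc := local_conv hT (g := fun u => g (t0 - s + u)) (L := 2 * s) (by linarith)
      (by
        intro u hu v hv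
        have := hg (t0 - s + u) ⟨by linarith [hu.1], by linarith [hu.2]⟩ (t0 - s + v)
          ⟨by linarith [hv.1], by linarith [hv.2]⟩
        rw [this]; ring_nf)
    have e1 : t0 - s + 2 * s / 2 = t0 := by ring
    have e2 : t0 - s + 2 * s = t0 + s := by ring
    have e3 : 2 * s / 2 = s := by ring
    have e4 : t0 - s + s = t0 := by ring
    simp only [e1, e2, e3, e4, add_zero] at hlc
    have hlc := hlc (hall _ mA) (hall _ mB) (by have := hall t0 ht0I; linarith)
    have hf : ∀ t ∈ Icc 0 L, sin (infDist (g t) T) = φ t * cos (t - L / 2) := by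
      intro t ht
      exact (div_mul_cancel₀ _ (hcpos t ht).ne').symm
    rw [hf _ mA, hf _ mB, hf _ ht0I, hφt0] at hlc
    have hlt : φ (t0 - s) < c := by
      apply lt_of_le_of_ne (hmax' _ mA)
      intro heq
      have := hleast ⟨mA, heq⟩
      linarith
    have k1 := mul_lt_mul_of_pos_right hlt (hcpos _ mA)
    have k2 := mul_le_mul_of_nonneg_right (hmax' _ mB) (hcpos _ mB).le
    have e5 : cos (t0 - s - L / 2) + cos (t0 + s - L / 2) = 2 * cos s * cos (t0 - L / 2) := by
      have a1 : t0 - s - L / 2 = (t0 - L / 2) - s := by ring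
      have a2 : t0 + s - L / 2 = (t0 - L / 2) + s := by ring
      rw [a1, a2, Real.cos_sub, Real.cos_add]; ring
    have e6 : c * cos (t0 - s - L / 2) + c * cos (t0 + s - L / 2) =
      2 * cos s * (c * cos (t0 - L / 2)) := by linear_combination c * e5
    linarith
  have h1 := hmax' t ht
  have h2 := hcpos t ht
  have h3 : sin (infDist (g t) T) = φ t * cos (t - L / 2) :=
    (div_mul_cancel₀ _ h2.ne').symm
  rw [h3]
  have k1 := mul_le_mul_of_nonneg_right h1 h2.le
  have k2 := mul_le_mul_of_nonneg_right k1 hcL.le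
  have k3 := mul_le_mul_of_nonneg_right hcle h2.le
  linarith


/-- the `s` coordinate -/
def sc (κ l : ℝ) : ℝ := 2 * Real.sqrt (κ * (1 - κ)) * sin (l / 2)

theorem sc_nonneg {κ l : ℝ} (h0 : 0 ≤ l) (h1 : l ≤ 2 * Real.pi) : 0 ≤ sc κ l := by
  have := Real.sin_nonneg_of_nonneg_of_le_pi (x := l / 2) (by linarith) (by linarith)
  unfold sc; positivity

theorem sc_mul {κ l l' : ℝ} (h0 : 0 ≤ κ) (h1 : κ ≤ 1) :
    sc κ l * sc κ l' = 4 * (κ * (1 - κ)) * (sin (l / 2) * sin (l' / 2)) := by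
  have := Real.mul_self_sqrt (x := κ * (1 - κ)) (mul_nonneg h0 (by linarith))
  unfold sc
  linear_combination 4 * sin (l / 2) * sin (l' / 2) * this

theorem ZRel.sq_sc {κ l t R : ℝ} (h0 : 0 ≤ κ) (h1 : κ ≤ 1) (hz : ZRel (1 - κ) κ l t R) :
    R ^ 2 + sc κ l ^ 2 = 1 := by
  have e : cos l = 1 - 2 * sin (l / 2) ^ 2 := by
    have := Real.cos_two_mul' (l / 2)
    have i := Real.sin_sq_add_cos_sq (l / 2)
    have e2 : 2 * (l / 2) = l := by ring
    rw [e2] at this; linear_combination this + i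
  have := sc_mul (l := l) (l' := l) h0 h1
  rw [hz.sq, e]
  linear_combination this

theorem ZRel.R_cos {κ l t R : ℝ} (hz : ZRel (1 - κ) κ l t R) : R * cos (t - l / 2) = cos (l / 2) := by
  have e : cos l = 2 * cos (l / 2) ^ 2 - 1 := by rw [← Real.cos_two_mul]; ring_nf
  have e' : sin l = 2 * sin (l / 2) * cos (l / 2) := by rw [← Real.sin_two_mul]; ring_nf
  have i := Real.sin_sq_add_cos_sq (l / 2)
  have h1 := hz.hs
  have h2 := hz.hc
  rw [e'] at h1
  rw [e] at h2
  rw [Real.cos_sub]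
  linear_combination cos (l / 2) * h2 + sin (l / 2) * h1 + 2 * κ * cos (l / 2) * i

theorem sqrt_chord {l : ℝ} (h0 : 0 ≤ l) (h1 : l ≤ 2 * Real.pi) :
    Real.sqrt (1 + 1 ^ 2 - 2 * 1 * cos l) = 2 * sin (l / 2) := by
  have hs := Real.sin_nonneg_of_nonneg_of_le_pi (x := l / 2) (by linarith) (by linarith)
  have e : cos l = 1 - 2 * sin (l / 2) ^ 2 := by
    have := Real.cos_two_mul' (l / 2)
    have i := Real.sin_sq_add_cos_sq (l / 2)
    have e2 : 2 * (l / 2) = l := by ring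
    rw [e2] at this; linear_combination this + i
  rw [e, ← Real.sqrt_sq (by linarith : 0 ≤ 2 * sin (l / 2))]
  ring_nf

theorem ladder_step {M : Type*} [MetricSpace M] (hM : CatK 1 M) {x y x' y' : M} {g g' : ℝ → M}
    (hg : IsUnitGeodesicOn g 0 (dist x y)) (h0 : g 0 = x) (h1 : g (dist x y) = y)
    (hg' : IsUnitGeodesicOn g' 0 (dist x' y')) (h0' : g' 0 = x') (h1' : g' (dist x' y') = y')
    {a κ t R t' R' : ℝ} (hx : dist x x' ≤ a) (hy : dist y y' ≤ a)
    (hl : dist x y + a < Real.pi) (hl' : dist x' y' + a < Real.pi)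
    (hκ0 : 0 ≤ κ) (hκ1 : κ ≤ 1) (hz : ZRel (1 - κ) κ (dist x y) t R)
    (hz' : ZRel (1 - κ) κ (dist x' y') t' R') :
    cos a ≤ R * R' * cos (dist (g t) (g' t')) + sc κ (dist x y) * sc κ (dist x' y') := by
  have hpi := Real.pi_pos
  obtain ⟨d1, d2⟩ := geod_dists hg ⟨hz.t0, hz.tD⟩
  obtain ⟨d1', d2'⟩ := geod_dists hg' ⟨hz'.t0, hz'.tD⟩
  rw [h0] at d1; rw [h1] at d2; rw [h0'] at d1'; rw [h1'] at d2'
  set z := g t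
  set z' := g' t'
  have l0 : 0 ≤ dist x y := dist_nonneg
  have l0' : 0 ≤ dist x' y' := dist_nonneg
  have a0 : 0 ≤ a := dist_nonneg.trans hx
  have t1 := dist_triangle x y y'
  have t1' := dist_triangle x x' y'
  have t2 := dist_triangle y x x'
  have t3 := dist_triangle z x x'
  have t4 := dist_triangle z y y'
  rw [dist_comm y x] at t2
  rw [dist_comm z x] at t3
  have cs := cat_CS hM (a := x) (b := y) (a' := x') (b' := y') zero_le_one zero_le_one
    (by rw [dist_comm y x, dist_comm y' y]; linarith)
    (by rw [dist_comm x' x, dist_comm y' x']; linarith)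
  rw [sqrt_chord l0 (by linarith), sqrt_chord l0' (by linarith)] at cs
  have w1 := cat_weight hM hg' h0' h1' (p := z) hz' (by rw [dist_comm y' z]; linarith)
  have w2 := cat_weight hM hg h0 h1 (p := x') hz (by rw [dist_comm x' x]; linarith)
  have w3 := cat_weight hM hg h0 h1 (p := y') hz
    (by rw [dist_comm y' x, dist_comm y y']; rw [dist_comm y y'] at t1 hy; linarith)
  rw [dist_comm x' z, dist_comm x' x, dist_comm x' y] at w2
  rw [dist_comm y' z, dist_comm y' x, dist_comm y' y] at w3
  have cx : cos a ≤ cos (dist x x') := cos_anti dist_nonneg (by linarith) hx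
  have cy : cos a ≤ cos (dist y y') := cos_anti dist_nonneg (by linarith) hy
  rw [sc_mul hκ0 hκ1]
  have m1 := mul_le_mul_of_nonneg_left w1 hz.R0.le
  have m2 := mul_le_mul_of_nonneg_left w2 (by linarith : 0 ≤ 1 - κ)
  have m3 := mul_le_mul_of_nonneg_left w3 hκ0
  have kk : 0 ≤ κ * (1 - κ) := mul_nonneg hκ0 (by linarith)
  have m4 := mul_le_mul_of_nonneg_left cs kk
  have m5 := mul_le_mul_of_nonneg_left cx (by linarith : 0 ≤ 1 - κ)
  have m6 := mul_le_mul_of_nonneg_left cy hκ0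
  nlinarith

theorem ZRel.unit {h η : ℝ} (h0 : 0 ≤ η) (h1 : η ≤ h) (hpi : h < Real.pi) :
    ∃ w₁ w₂, 0 ≤ w₁ ∧ 0 ≤ w₂ ∧ ZRel w₁ w₂ h η 1 := by
  rcases (h0.trans h1).eq_or_lt with hh | hh
  · refine ⟨1, 0, by norm_num, le_rfl, h0, h1, one_pos, ?_, ?_⟩
    · have : η = 0 := by linarith
      rw [this]; simp
    · have : η = 0 := by linarith
      rw [this]; simp
  · have sp := Real.sin_pos_of_pos_of_lt_pi hh hpi
    have s1 := Real.sin_nonneg_of_nonneg_of_le_pi h0 (by linarith)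
    have s2 := Real.sin_nonneg_of_nonneg_of_le_pi (sub_nonneg.mpr h1) (by linarith)
    refine ⟨sin (h - η) / sin h, sin η / sin h, by positivity, by positivity, h0, h1, one_pos, ?_, ?_⟩
    · field_simp
    · rw [Real.sin_sub]; field_simp; ring

/-- `p` is the retraction of `m` on the tube of radius `ρ`. -/
def IsRet {M : Type*} [MetricSpace M] (T : Set M) (ρ : ℝ) (m p : M) : Prop :=
  ∃ e ∈ T, dist e m = infDist m T ∧ ∃ g : ℝ → M, IsUnitGeodesicOn g 0 (dist e m) ∧ g 0 = e ∧
    g (dist e m) = m ∧ p = g (min (infDist m T) ρ)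

theorem IsRet.exists {M : Type*} [MetricSpace M] {T : Set M} (hT : GoodT T) (ρ : ℝ) {m : M}
    (hm : infDist m T < Real.pi / 2) : ∃ p, IsRet T ρ m p := by
  obtain ⟨e, he, hme⟩ := foot hT hm
  rw [dist_comm] at hme
  obtain ⟨g, hg, g0, g1⟩ := cat_geod hT.cat (x := e) (y := m) (by linarith [Real.pi_pos])
  exact ⟨_, e, he, hme, g, hg, g0, g1, rfl⟩

theorem IsRet.le {M : Type*} [MetricSpace M] {T : Set M} {ρ : ℝ} (hρ : 0 ≤ ρ) {m p : M}
    (h : IsRet T ρ m p) : infDist p T ≤ ρ := by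
  obtain ⟨e, he, hme, g, hg, g0, g1, rfl⟩ := h
  have hmem : min (infDist m T) ρ ∈ Icc 0 (dist e m) :=
    ⟨le_min infDist_nonneg hρ, by rw [hme]; exact min_le_left _ _⟩
  have := (geod_dists hg hmem).1
  rw [g0] at this
  refine (infDist_le_dist_of_mem he).trans ?_
  rw [dist_comm, this]; exact min_le_right _ _

theorem IsRet.eq {M : Type*} [MetricSpace M] {T : Set M} {ρ : ℝ} {m p : M}
    (h : IsRet T ρ m p) (hm : infDist m T ≤ ρ) : p = m := by
  obtain ⟨e, he, hme, g, hg, g0, g1, rfl⟩ := h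
  rw [min_eq_left hm, ← hme, g1]

theorem ret_alg {w1 w2 w1' w2' c c' Y X cme cem P v1 v2 : ℝ} (c1 : 0 < c) (c2 : 0 < c')
    (p1 : 0 ≤ w1) (p2 : 0 ≤ w2) (p1' : 0 ≤ w1') (p2' : 0 ≤ w2')
    {s s' : ℝ} (cs : c * c' * X + s * s' - c' * cme - c * cem + c * c' * Y ≤ s * s')
    (ra : cme ≤ c * Y) (rb : cem ≤ c' * Y) (cw1 : w1 * v1 + w2 * v2 ≤ 1 * P)
    (m1 : w1 * (w1' * Y + w2' * cem) ≤ w1 * (1 * v1))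
    (m2 : w2 * (w1' * cme + w2' * (c * c' * X + s * s')) ≤ w2 * (1 * v2)) :
    (w1 + w2 * c) * (w1' + w2' * c') * X + w2 * s * (w2' * s') ≤ P := by
  obtain ⟨A, hA⟩ : ∃ A, A = c * Y - cme := ⟨_, rfl⟩
  obtain ⟨B, hB⟩ : ∃ B, B = c' * Y - cem := ⟨_, rfl⟩
  have A0 : 0 ≤ A := by linarith
  have B0 : 0 ≤ B := by linarith
  have eA : cme = c * Y - A := by rw [hA]; ring
  have eB : cem = c' * Y - B := by rw [hB]; ring
  subst eA eB
  have hBc := mul_nonneg c1.le B0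
  have hAc := mul_nonneg c2.le A0
  have cs2 : c' * A + c * B ≤ c * c' * (Y - X) := by linarith
  have cc := mul_pos c1 c2
  have YX : 0 ≤ Y - X := by
    by_contra hcon
    push Not at hcon
    have := mul_neg_of_pos_of_neg cc hcon
    linarith
  have A1 : A ≤ c * (Y - X) := by
    have : c' * A ≤ c' * (c * (Y - X)) := by linarith
    exact le_of_mul_le_mul_left this c2
  have B1 : B ≤ c' * (Y - X) := by
    have : c * B ≤ c * (c' * (Y - X)) := by linarith
    exact le_of_mul_le_mul_left this c1
  have n1 := mul_le_mul_of_nonneg_left A1 (mul_nonneg p2 p1')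
  have n2 := mul_le_mul_of_nonneg_left B1 (mul_nonneg p1 p2')
  have n3 := mul_nonneg (mul_nonneg p1 p1') YX
  linarith

theorem ret_step {M : Type*} [MetricSpace M] {T : Set M} (hT : GoodT T) {ρ : ℝ} (hρ : 0 ≤ ρ)
    {m p m' p' : M} (h : IsRet T ρ m p) (h' : IsRet T ρ m' p')
    (hm : infDist m T < Real.pi / 2) (hm' : infDist m' T < Real.pi / 2)
    (hs : infDist m T + infDist m' T + dist m m' < Real.pi) {X : ℝ}
    (hX : cos (dist m m') = cos (infDist m T) * cos (infDist m' T) * X +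
      sin (infDist m T) * sin (infDist m' T)) :
    cos (min (infDist m T) ρ) * cos (min (infDist m' T) ρ) * X +
      sin (min (infDist m T) ρ) * sin (min (infDist m' T) ρ) ≤ cos (dist p p') := by
  obtain ⟨e, he, hme, g, hg, g0, g1, hp⟩ := h
  obtain ⟨e', he', hme', g', hg', g0', g1', hp'⟩ := h'
  have k0 : 0 ≤ infDist m T := infDist_nonneg
  have k0' : 0 ≤ infDist m' T := infDist_nonneg
  set h := infDist m T with hh
  set h' := infDist m' T with hh'
  set η := min h ρ
  set η' := min h' ρ
  have η0 : 0 ≤ η := le_min k0 hρ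
  have η0' : 0 ≤ η' := le_min k0' hρ
  have η1 : η ≤ h := min_le_left _ _
  have η1' : η' ≤ h' := min_le_left _ _
  obtain ⟨w1, w2, p1, p2, hz⟩ := ZRel.unit η0 η1 (by linarith)
  obtain ⟨w1', w2', p1', p2', hz'⟩ := ZRel.unit η0' η1' (by linarith)
  obtain ⟨d1, d2⟩ := geod_dists hg (t := η) ⟨η0, by rw [hme]; exact η1⟩
  obtain ⟨d1', d2'⟩ := geod_dists hg' (t := η') ⟨η0', by rw [hme']; exact η1'⟩
  rw [g0] at d1; rw [g1] at d2; rw [g0'] at d1'; rw [g1'] at d2'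
  rw [← hp] at d1 d2
  rw [← hp'] at d1' d2'
  have t1 := dist_triangle e m m'
  have t2 := dist_triangle m m' e'
  have t3 := dist_triangle e m e'
  have t4 := dist_triangle m m' p'
  have t5 := dist_triangle e m p'
  rw [dist_comm m' e'] at t2
  rw [dist_comm m' p'] at t4
  have ra := right_angle hT he (by rw [dist_comm]; exact hme) hm he' (by linarith) (by linarith)
  have rb := right_angle hT he' (m := m') (by rw [dist_comm]; exact hme') hm' he
    (by rw [dist_comm]; linarith) (by rw [dist_comm]; linarith)
  have c1 : 0 < cos h := Real.cos_pos_of_mem_Ioo ⟨by linarith [Real.pi_pos], by linarith⟩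
  have c2 : 0 < cos h' := Real.cos_pos_of_mem_Ioo ⟨by linarith [Real.pi_pos], by linarith⟩
  have cs := cat_CS hT.cat (a := m) (b := e) (a' := m') (b' := e') c1.le c2.le
    (by rw [dist_comm e' e]; linarith) (by rw [dist_comm m' m]; linarith)
  have sq : ∀ u : ℝ, 0 ≤ u → u < Real.pi / 2 →
      Real.sqrt (1 + cos u ^ 2 - 2 * cos u * cos u) = sin u := by
    intro u u0 u1
    rw [← Real.sqrt_sq (Real.sin_nonneg_of_nonneg_of_le_pi u0 (by linarith)), Real.sin_sq]
    ring_nf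
  rw [dist_comm m e, dist_comm m' e', hme, hme', sq h k0 hm, sq h' k0' hm', hX] at cs
  have cw1 := cat_weight hT.cat hg g0 g1 (p := p') (by rw [hme]; exact hz)
    (by rw [dist_comm p' e, hme]; linarith)
  have cw2 := cat_weight hT.cat hg' g0' g1' (p := e) (by rw [hme']; exact hz')
    (by rw [dist_comm m' e, hme']; linarith)
  have cw3 := cat_weight hT.cat hg' g0' g1' (p := m) (by rw [hme']; exact hz')
    (by rw [dist_comm m' m, hme']; linarith)
  rw [← hp] at cw1
  rw [← hp'] at cw2 cw3
  rw [dist_comm p' e, dist_comm p' m, dist_comm p' p] at cw1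
  rw [hX] at cw3
  rw [dist_comm m' e, dist_comm e' e] at rb
  have m1 := mul_le_mul_of_nonneg_left cw2 p1
  have m2 := mul_le_mul_of_nonneg_left cw3 p2
  have e1 := hz.hs
  have e2 := hz.hc
  have e3 := hz'.hs
  have e4 := hz'.hc
  rw [one_mul] at e1 e2 e3 e4
  rw [e1, e2, e3, e4]
  exact ret_alg c1 c2 p1 p2 p1' p2' cs ra rb cw1 m1 m2


/-- the angular coordinate -/
def al (R s H : ℝ) : ℝ := arctan (s / (R * cos H))

theorem al_rel {R s H ρ : ℝ} (hR : 0 < R) (hs : 0 ≤ s) (hRs : R ^ 2 + s ^ 2 = 1)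
    (hH0 : 0 ≤ H) (hH : H < Real.pi / 2) (hρ0 : 0 ≤ ρ) (hρ : ρ < Real.pi / 2)
    (hsin : R * sin H ≤ sin ρ) :
    ∃ q, cos ρ ≤ q ∧ 0 < q ∧ q ^ 2 + (R * sin H) ^ 2 = 1 ∧ q * cos (al R s H) = R * cos H ∧
      q * sin (al R s H) = s := by
  have hpi := Real.pi_pos
  have cH : 0 < cos H := Real.cos_pos_of_mem_Ioo ⟨by linarith, hH⟩
  have sH : 0 ≤ sin H := Real.sin_nonneg_of_nonneg_of_le_pi hH0 (by linarith)
  have cρ : 0 < cos ρ := Real.cos_pos_of_mem_Ioo ⟨by linarith, hρ⟩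
  have i1 := Real.sin_sq_add_cos_sq H
  have i2 := Real.sin_sq_add_cos_sq ρ
  have hb : 0 < R * cos H := mul_pos hR cH
  have hq2 : (R * cos H) ^ 2 + s ^ 2 = 1 - (R * sin H) ^ 2 := by
    linear_combination hRs - R ^ 2 * (-i1)
  have hqq : cos ρ ^ 2 ≤ (R * cos H) ^ 2 + s ^ 2 := by
    rw [hq2]
    have : (R * sin H) ^ 2 ≤ sin ρ ^ 2 := by
      apply pow_le_pow_left₀ (by positivity) hsin
    linarith
  have hpos : 0 < (R * cos H) ^ 2 + s ^ 2 := by positivity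
  refine ⟨Real.sqrt ((R * cos H) ^ 2 + s ^ 2), Real.le_sqrt_of_sq_le hqq, Real.sqrt_pos.mpr hpos,
    ?_, ?_, ?_⟩
  · rw [Real.sq_sqrt hpos.le]; linarith
  all_goals
    have e : Real.sqrt (1 + (s / (R * cos H)) ^ 2) =
        Real.sqrt ((R * cos H) ^ 2 + s ^ 2) / (R * cos H) := by
      have : 1 + (s / (R * cos H)) ^ 2 = ((R * cos H) ^ 2 + s ^ 2) / (R * cos H) ^ 2 := by
        field_simp
      rw [this, Real.sqrt_div hpos.le, Real.sqrt_sq hb.le]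
    have hq := Real.sqrt_pos.mpr hpos
  · unfold al
    rw [Real.cos_arctan, e]
    field_simp
  · unfold al
    rw [Real.sin_arctan, e]
    field_simp

theorem al_mem {R s H : ℝ} (hR : 0 < R) (hs : 0 ≤ s) (hH0 : 0 ≤ H) (hH : H < Real.pi / 2) :
    0 ≤ al R s H ∧ al R s H < Real.pi / 2 := by
  have hpi := Real.pi_pos
  have cH : 0 < cos H := Real.cos_pos_of_mem_Ioo ⟨by linarith, hH⟩
  refine ⟨?_, Real.arctan_lt_pi_div_two _⟩
  unfold al
  rw [Real.arctan_nonneg]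
  positivity

theorem cos_diff_ge {A B : ℝ} (hA : 0 ≤ A) (hB : 0 ≤ B) (h : A + B ≤ Real.pi) :
    1 - cos B ≤ cos A - cos (A + B) := by
  have e1 : cos A - cos (A + B) = 2 * sin (A + B / 2) * sin (B / 2) := by
    rw [Real.cos_sub_cos]
    have a1 : (A + (A + B)) / 2 = A + B / 2 := by ring
    have a2 : (A - (A + B)) / 2 = -(B / 2) := by ring
    rw [a1, a2, Real.sin_neg]; ring
  have e2 : 1 - cos B = 2 * sin (B / 2) * sin (B / 2) := by
    have := Real.cos_two_mul' (B / 2)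
    have i := Real.sin_sq_add_cos_sq (B / 2)
    have e2 : 2 * (B / 2) = B := by ring
    rw [e2] at this; linear_combination -i - this
  rw [e1, e2]
  have s0 : 0 ≤ sin (B / 2) := Real.sin_nonneg_of_nonneg_of_le_pi (by linarith) (by linarith)
  have : sin (B / 2) ≤ sin (A + B / 2) := by
    by_cases hc : A + B / 2 ≤ Real.pi / 2
    · exact Real.sin_le_sin_of_le_of_le_pi_div_two (by linarith) hc (by linarith)
    · push Not at hc
      rw [← Real.sin_pi_sub (A + B / 2)]
      exact Real.sin_le_sin_of_le_of_le_pi_div_two (by linarith) (by linarith) (by linarith)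
  nlinarith

theorem cos_diff_ge' {h h' ρ : ℝ} (h0 : 0 ≤ h) (h0' : 0 ≤ h') (h1 : h < Real.pi / 2)
    (h1' : h' < Real.pi / 2) :
    1 - cos (min h ρ - min h' ρ) ≤ cos (max h ρ - max h' ρ) - cos (h - h') := by
  wlog hle : h' ≤ h with H
  · have := H (ρ := ρ) h0' h0 h1' h1 (by linarith)
    rw [← Real.cos_neg (min h ρ - min h' ρ), ← Real.cos_neg (max h ρ - max h' ρ),
      ← Real.cos_neg (h - h')]
    convert this using 3 <;> ring_nf
  have a := min_add_max h ρ
  have a' := min_add_max h' ρ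
  have m1 : min h' ρ ≤ min h ρ := min_le_min hle le_rfl
  have m2 : max h' ρ ≤ max h ρ := max_le_max hle le_rfl
  have e : h - h' = (max h ρ - max h' ρ) + (min h ρ - min h' ρ) := by linarith
  rw [e]
  exact cos_diff_ge (by linarith) (by linarith) (by linarith)

/-- package of data at one point of the ladder -/
structure Pt (ρ R s h : ℝ) : Prop where
  R0 : 0 < R
  s0 : 0 ≤ s
  Rs : R ^ 2 + s ^ 2 = 1
  h0 : 0 ≤ h
  h1 : h < Real.pi / 2
  hsin : R * sin h ≤ sin ρ

theorem Pt.R1 {ρ R s h : ℝ} (p : Pt ρ R s h) : R ≤ 1 := by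
  nlinarith [p.Rs, sq_nonneg s, p.R0]

theorem Pt.max_mem {ρ R s h : ℝ} (p : Pt ρ R s h) (hρ0 : 0 ≤ ρ) (hρ : ρ < Real.pi / 2) :
    0 ≤ max h ρ ∧ max h ρ < Real.pi / 2 ∧ R * sin (max h ρ) ≤ sin ρ := by
  refine ⟨le_max_of_le_right hρ0, max_lt p.h1 hρ, ?_⟩
  rcases le_total h ρ with hh | hh
  · rw [max_eq_right hh]
    have := Real.sin_nonneg_of_nonneg_of_le_pi hρ0 (by linarith [Real.pi_pos])
    nlinarith [p.R1]
  · rw [max_eq_left hh]; exact p.hsin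

/-- angular coordinate of a ladder point -/
def alp (ρ R s h : ℝ) : ℝ := al R s (max h ρ)

theorem Pt.alp_mem {ρ R s h : ℝ} (p : Pt ρ R s h) (hρ0 : 0 ≤ ρ) (hρ : ρ < Real.pi / 2) :
    0 ≤ alp ρ R s h ∧ alp ρ R s h < Real.pi / 2 := by
  obtain ⟨a, b, c⟩ := p.max_mem hρ0 hρ
  exact al_mem p.R0 p.s0 a b

theorem Pt.rel {ρ R s h : ℝ} (p : Pt ρ R s h) (hρ0 : 0 ≤ ρ) (hρ : ρ < Real.pi / 2) :
    ∃ q, cos ρ ≤ q ∧ 0 < q ∧ q ^ 2 + (R * sin (max h ρ)) ^ 2 = 1 ∧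
      q * cos (alp ρ R s h) = R * cos (max h ρ) ∧ q * sin (alp ρ R s h) = s ∧
      cos (alp ρ R s h) ≤ R ∧ cos (alp ρ R s h) * cos (min h ρ) ≤ R * cos h := by
  have hpi := Real.pi_pos
  obtain ⟨a, b, c⟩ := p.max_mem hρ0 hρ
  obtain ⟨q, h1, h2, h3, h4, h5⟩ := al_rel p.R0 p.s0 p.Rs a b hρ0 hρ c
  obtain ⟨m1, m2⟩ := p.alp_mem hρ0 hρ
  have ca : 0 < cos (alp ρ R s h) := Real.cos_pos_of_mem_Ioo ⟨by linarith, m2⟩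
  have cρ : 0 < cos ρ := Real.cos_pos_of_mem_Ioo ⟨by linarith, hρ⟩
  have hR := p.R0
  have ch : 0 < cos h := Real.cos_pos_of_mem_Ioo ⟨by linarith [p.h0], p.h1⟩
  have h4' : q * cos (alp ρ R s h) = R * cos (max h ρ) := h4
  have k1 : cos (alp ρ R s h) ≤ R := by
    have e1 : cos (max h ρ) ≤ cos ρ := cos_anti hρ0 (by linarith) (le_max_right _ _)
    have : cos ρ * cos (alp ρ R s h) ≤ cos ρ * R := by nlinarith
    exact le_of_mul_le_mul_left this cρ
  refine ⟨q, h1, h2, h3, h4, h5, k1, ?_⟩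
  rcases le_total h ρ with hh | hh
  · rw [min_eq_left hh]; nlinarith
  · rw [min_eq_right hh]
    rw [max_eq_left hh] at h4'
    rw [← h4']; nlinarith

theorem Pt.step {ρ R s h R' s' h' : ℝ} (p : Pt ρ R s h) (p' : Pt ρ R' s' h') (hρ0 : 0 ≤ ρ)
    (hρ : ρ < Real.pi / 2) {X P a : ℝ} (hX : X ≤ 1)
    (hcos : cos a ≤ R * R' * (cos h * cos h' * X + sin h * sin h') + s * s')
    (hP : cos (min h ρ) * cos (min h' ρ) * X + sin (min h ρ) * sin (min h' ρ) ≤ P) :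
    cos ρ ^ 2 * (1 - cos (alp ρ R s h - alp ρ R' s' h')) +
      cos (alp ρ R s h) * cos (alp ρ R' s' h') * (1 - P) ≤ 1 - cos a := by
  have hpi := Real.pi_pos
  obtain ⟨q, h1, h2, h3, h4, h5, h6, h7⟩ := p.rel hρ0 hρ
  obtain ⟨q', h1', h2', h3', h4', h5', h6', h7'⟩ := p'.rel hρ0 hρ
  obtain ⟨m1, m2⟩ := p.alp_mem hρ0 hρ
  obtain ⟨m1', m2'⟩ := p'.alp_mem hρ0 hρ
  set α := alp ρ R s h
  set α' := alp ρ R' s' h'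
  set H := max h ρ with hH
  set H' := max h' ρ with hH'
  set η := min h ρ with hη
  set η' := min h' ρ with hη'
  have cα : 0 < cos α := Real.cos_pos_of_mem_Ioo ⟨by linarith, m2⟩
  have cα' : 0 < cos α' := Real.cos_pos_of_mem_Ioo ⟨by linarith, m2'⟩
  have cρ : 0 < cos ρ := Real.cos_pos_of_mem_Ioo ⟨by linarith, hρ⟩
  have cη : 0 ≤ cos η := Real.cos_nonneg_of_mem_Icc ⟨by linarith [le_min p.h0 hρ0],
    by linarith [min_le_right h ρ]⟩
  have cη' : 0 ≤ cos η' := Real.cos_nonneg_of_mem_Icc ⟨by linarith [le_min p'.h0 hρ0],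
    by linarith [min_le_right h' ρ]⟩
  have ch : 0 < cos h := Real.cos_pos_of_mem_Ioo ⟨by linarith [p.h0], p.h1⟩
  have hC : 0 < cos α * cos α' := mul_pos cα cα'
  have H1 : cos ρ ^ 2 * (1 - cos (α - α')) ≤ 1 - R * R' * cos (H - H') - s * s' := by
    have e : R * R' * cos (H - H') + s * s' =
        q * q' * cos (α - α') + (R * sin H) * (R' * sin H') := by
      rw [Real.cos_sub, Real.cos_sub, ← h5, ← h5']
      linear_combination (-(R' * cos H')) * h4 - q * cos α * h4'
    have k1 : q * q' + (R * sin H) * (R' * sin H') ≤ 1 := by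
      have a1 := sq_nonneg (q - q')
      have a2 := sq_nonneg (R * sin H - R' * sin H')
      linarith
    have k2 : cos ρ ^ 2 ≤ q * q' := by
      rw [sq]; exact mul_le_mul h1 h1' cρ.le h2.le
    have k3 : 0 ≤ 1 - cos (α - α') := by linarith [Real.cos_le_one (α - α')]
    have := mul_le_mul_of_nonneg_right k2 k3
    linarith
  have H2 := cos_diff_ge' (ρ := ρ) p.h0 p'.h0 p.h1 p'.h1
  have RR : cos α * cos α' ≤ R * R' := mul_le_mul h6 h6' cα'.le p.R0.le
  have k4 : cos α * cos α' * (1 - cos (η - η')) ≤ R * R' * (cos (H - H') - cos (h - h')) := by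
    have k3 : 0 ≤ 1 - cos (η - η') := by linarith [Real.cos_le_one (η - η')]
    have := mul_le_mul_of_nonneg_right RR k3
    have := mul_le_mul_of_nonneg_left H2 (mul_nonneg p.R0.le p'.R0.le)
    linarith
  have k5 : (cos α * cos η) * (cos α' * cos η') ≤ (R * cos h) * (R' * cos h') :=
    mul_le_mul h7 h7' (mul_nonneg cα'.le cη') (mul_nonneg p.R0.le ch.le)
  have k6 := mul_le_mul_of_nonneg_right k5 (by linarith : 0 ≤ 1 - X)
  have k7 := mul_le_mul_of_nonneg_left hP hC.le
  rw [Real.cos_sub η, Real.cos_sub h] at k4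
  linarith

theorem lemI {K η : ℝ} (hK : 0 < K) (hη : 0 < η) :
    ∃ a0 > 0, (1 + η) * K * a0 ≤ 1 ∧ ∀ a, 0 ≤ a → a ≤ a0 →
      K ^ 2 * (1 - cos a) ≤ 1 - cos ((1 + η) * K * a) := by
  set b0 := min 1 (η / (1 + η)) with hb0
  have hb : 0 < b0 := lt_min one_pos (by positivity)
  have hb1 : b0 ≤ 1 := min_le_left _ _
  have hb2 : (1 + η) * b0 ≤ η := by
    have : b0 ≤ η / (1 + η) := min_le_right _ _
    rw [le_div_iff₀ (by linarith)] at this; linarith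
  have hc : 0 < (1 + η) * K := by positivity
  refine ⟨b0 / ((1 + η) * K), by positivity, ?_, ?_⟩
  · rw [mul_div_cancel₀ _ hc.ne']; exact hb1
  intro a a0 a1
  rw [le_div_iff₀ hc] at a1
  set b := (1 + η) * K * a with hbdef
  have b_nonneg : 0 ≤ b := by positivity
  have hbb : b ≤ b0 := by linarith
  have c1 := Real.one_sub_sq_div_two_le_cos (x := a)
  have c2 := Real.cos_bound (x := b) (by rw [abs_of_nonneg b_nonneg]; linarith)
  have c3 := (abs_le.mp c2).2
  rw [abs_of_nonneg b_nonneg] at c3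
  have c4 : K ^ 2 * (1 - cos a) ≤ (K * a) ^ 2 / 2 := by nlinarith [sq_nonneg K]
  have hb' : (1 + η) * b ≤ η := by nlinarith
  have e : b = (1 + η) * (K * a) := by rw [hbdef]; ring
  set y := K * a
  have y0 : 0 ≤ y := by positivity
  -- need y^2/2 ≤ b^2/2 - 5/96 b^4
  have k : (1 + η) ^ 2 * b ^ 2 ≤ η ^ 2 := by
    have := pow_le_pow_left₀ (by positivity) hb' 2
    nlinarith
  have : y ^ 2 / 2 ≤ b ^ 2 / 2 - b ^ 4 * (5 / 96) := by
    have e4 : b ^ 4 = y ^ 2 * ((1 + η) ^ 2 * b ^ 2) := by rw [e]; ring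
    have e2 : b ^ 2 = y ^ 2 * (1 + 2 * η + η ^ 2) := by rw [e]; ring
    rw [e4]
    have := mul_le_mul_of_nonneg_left k (sq_nonneg y)
    rw [e2] at this ⊢
    nlinarith [mul_nonneg (sq_nonneg y) hη.le, mul_nonneg (sq_nonneg y) (sq_nonneg η)]
  linarith

theorem sin_scale {c y : ℝ} (c0 : 0 < c) (c1 : c ≤ 1) (y0 : 0 ≤ y) (hy : c * y ≤ Real.pi / 2) :
    (c * sin y) ^ 2 ≤ sin (c * y) ^ 2 := by
  have hpi := Real.pi_pos
  have hcy : 0 ≤ c * y := by positivity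
  by_cases h : y ≤ Real.pi
  · have hcc := strictConcaveOn_sin_Icc.concaveOn.2 (⟨le_rfl, hpi.le⟩ : (0:ℝ) ∈ Icc 0 Real.pi)
      (⟨y0, h⟩ : y ∈ Icc 0 Real.pi) (by linarith : (0:ℝ) ≤ 1 - c) c0.le (by ring)
    simp at hcc
    exact pow_le_pow_left₀ (mul_nonneg c0.le (Real.sin_nonneg_of_nonneg_of_le_pi y0 h)) hcc 2
  · push Not at h
    have h1 := Real.mul_le_sin hcy hy
    have h2 : c ≤ sin (c * y) := by
      refine le_trans ?_ h1
      have : 2 / Real.pi * (c * y) = c * (2 * (y / Real.pi)) := by field_simp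
      rw [this]
      have : 1 ≤ y / Real.pi := by rw [le_div_iff₀ hpi]; linarith
      nlinarith
    have h3 : c ^ 2 ≤ sin (c * y) ^ 2 := pow_le_pow_left₀ c0.le h2 2
    have := Real.sin_sq_le_one y
    nlinarith [sq_nonneg c]

theorem cos_scale {c x : ℝ} (c0 : 0 < c) (c1 : c ≤ 1) (x0 : 0 ≤ x) (hx : x ≤ Real.pi) :
    c ^ 2 * (1 - cos (x / c)) ≤ 1 - cos x := by
  have hh : ∀ u : ℝ, 1 - cos u = 2 * sin (u / 2) ^ 2 := by
    intro u
    have := Real.cos_two_mul' (u / 2)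
    have i := Real.sin_sq_add_cos_sq (u / 2)
    have e2 : 2 * (u / 2) = u := by ring
    rw [e2] at this; linear_combination -i - this
  have e : c * (x / c / 2) = x / 2 := by field_simp
  have := sin_scale (y := x / c / 2) c0 c1 (by positivity) (by rw [e]; linarith)
  rw [e] at this
  rw [hh, hh]; nlinarith


theorem zrel_of_t {l t : ℝ} (hl : l < Real.pi) (ht : t ∈ Icc 0 l) :
    ∃ κ R, 0 ≤ κ ∧ κ ≤ 1 ∧ ZRel (1 - κ) κ l t R := by
  obtain ⟨t0, t1⟩ := ht
  have hpi := Real.pi_pos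
  rcases (t0.trans t1).eq_or_lt with h | h
  · have : t = 0 := by linarith
    subst this
    refine ⟨0, 1, le_rfl, zero_le_one, ⟨le_rfl, t1, by norm_num, ?_, ?_⟩⟩ <;> simp
  have sl : 0 < sin l := Real.sin_pos_of_pos_of_lt_pi h hl
  have s1 : 0 ≤ sin t := Real.sin_nonneg_of_nonneg_of_le_pi t0 (by linarith)
  have s2 : 0 ≤ sin (l - t) := Real.sin_nonneg_of_nonneg_of_le_pi (by linarith) (by linarith)
  have e : sin l * cos t = sin (l - t) + sin t * cos l := by rw [Real.sin_sub]; ring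
  have S : 0 < sin (l - t) + sin t := by
    rcases s1.eq_or_lt with h0 | h0
    · rcases s2.eq_or_lt with h1 | h1
      · exfalso
        rw [← h0, ← h1] at e
        have : cos t = 0 := by
          have : sin l * cos t = 0 := by rw [e]; ring
          rcases mul_eq_zero.mp this with h | h
          · exact absurd h sl.ne'
          · exact h
        have i := Real.sin_sq_add_cos_sq t
        rw [this, ← h0] at i; norm_num at i
      · linarith
    · linarith
  refine ⟨sin t / (sin (l - t) + sin t), sin l / (sin (l - t) + sin t), by positivity, ?_,
    ⟨t0, t1, by positivity, ?_, ?_⟩⟩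
  · rw [div_le_one S]; linarith
  · field_simp
  · field_simp
    linarith

theorem zrel_R_ge {κ l t R ℓ : ℝ} (hl0 : 0 ≤ l) (hl : l ≤ ℓ) (hℓ : ℓ < Real.pi)
    (hz : ZRel (1 - κ) κ l t R) : cos (ℓ / 2) ≤ R ∧ 0 < cos (ℓ / 2) := by
  have hpi := Real.pi_pos
  have h1 := hz.R_cos
  have h2 : cos (ℓ / 2) ≤ cos (l / 2) := cos_anti (by linarith) (by linarith) (by linarith)
  have h3 : 0 < cos (ℓ / 2) := Real.cos_pos_of_mem_Ioo ⟨by linarith, by linarith⟩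
  have h4 := Real.cos_le_one (t - l / 2)
  have h5 := hz.R0
  refine ⟨?_, h3⟩
  nlinarith

section
variable {M : Type*} [MetricSpace M]

theorem rung_pt {T : Set M} (hT : GoodT T) {ρ : ℝ} (hρ : ρ < Real.pi / 2) {x y : M}
    {g : ℝ → M} (hg : IsUnitGeodesicOn g 0 (dist x y)) (h0 : g 0 = x) (h1 : g (dist x y) = y)
    (hx : infDist x T ≤ ρ) (hy : infDist y T ≤ ρ) (hl : dist x y < Real.pi)
    (hall : ∀ t ∈ Icc 0 (dist x y), infDist (g t) T < Real.pi / 2) {κ t R : ℝ}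
    (hκ0 : 0 ≤ κ) (hκ1 : κ ≤ 1) (hz : ZRel (1 - κ) κ (dist x y) t R) :
    Pt ρ R (sc κ (dist x y)) (infDist (g t) T) := by
  have hpi := Real.pi_pos
  have d0 : 0 ≤ dist x y := dist_nonneg
  obtain ⟨c1, c2⟩ := zrel_R_ge d0 le_rfl hl hz
  have ht : t ∈ Icc 0 (dist x y) := ⟨hz.t0, hz.tD⟩
  refine ⟨by linarith, sc_nonneg d0 (by linarith), hz.sq_sc hκ0 hκ1, infDist_nonneg, hall t ht, ?_⟩
  have m := max_princ hT d0 hl hg hρ (by rw [h0]; exact hx) (by rw [h1]; exact hy) hall ht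
  have h := hz.R_cos
  have : (R * sin (infDist (g t) T)) * cos (dist x y / 2) ≤ sin ρ * cos (dist x y / 2) := by
    have := mul_le_mul_of_nonneg_left m hz.R0.le
    calc _ = R * (sin (infDist (g t) T) * cos (dist x y / 2)) := by ring
      _ ≤ R * (sin ρ * cos (t - dist x y / 2)) := this
      _ = sin ρ * (R * cos (t - dist x y / 2)) := by ring
      _ = _ := by rw [h]
  exact le_of_mul_le_mul_right this c2

theorem X_le_one {T : Set M} {m m' : M} (hd : dist m m' ≤ Real.pi)
    (h : infDist m T < Real.pi / 2) (h' : infDist m' T < Real.pi / 2) :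
    ∃ X ≤ 1, cos (dist m m') = cos (infDist m T) * cos (infDist m' T) * X +
      sin (infDist m T) * sin (infDist m' T) := by
  have hpi := Real.pi_pos
  have n := infDist_nonneg (x := m) (s := T)
  have n' := infDist_nonneg (x := m') (s := T)
  have c : 0 < cos (infDist m T) := Real.cos_pos_of_mem_Ioo ⟨by linarith, h⟩
  have c' : 0 < cos (infDist m' T) := Real.cos_pos_of_mem_Ioo ⟨by linarith, h'⟩
  have cc := mul_pos c c'
  refine ⟨(cos (dist m m') - sin (infDist m T) * sin (infDist m' T)) /
    (cos (infDist m T) * cos (infDist m' T)), ?_, ?_⟩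
  · rw [div_le_one cc]
    have k : |infDist m T - infDist m' T| ≤ dist m m' := by
      rw [abs_le]
      have a := infDist_le_infDist_add_dist (x := m) (y := m') (s := T)
      have b := infDist_le_infDist_add_dist (x := m') (y := m) (s := T)
      rw [dist_comm m' m] at b
      constructor <;> linarith
    have := cos_anti (abs_nonneg _) hd k
    rw [Real.cos_abs, Real.cos_sub] at this
    linarith
  · field_simp
    ring

theorem alpha_step {T : Set M} {ρ R s R' s' a : ℝ} {m m' : M} (hρ0 : 0 ≤ ρ)
    (hρ : ρ < Real.pi / 2)
    (p : Pt ρ R s (infDist m T)) (p' : Pt ρ R' s' (infDist m' T)) (hd : dist m m' ≤ Real.pi)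
    (hcos : cos a ≤ R * R' * cos (dist m m') + s * s') :
    cos ρ ^ 2 * (1 - cos (alp ρ R s (infDist m T) - alp ρ R' s' (infDist m' T))) ≤ 1 - cos a := by
  obtain ⟨X, hX, e⟩ := X_le_one hd p.h1 p'.h1
  rw [e] at hcos
  have hpi := Real.pi_pos
  have st := p.step p' hρ0 hρ hX hcos le_rfl
  obtain ⟨m1, m2⟩ := p.alp_mem hρ0 hρ
  obtain ⟨m1', m2'⟩ := p'.alp_mem hρ0 hρ
  have cα := Real.cos_pos_of_mem_Ioo ⟨by linarith, m2⟩
  have cα' := Real.cos_pos_of_mem_Ioo ⟨by linarith, m2'⟩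
  have cη : 0 ≤ cos (min (infDist m T) ρ) := Real.cos_nonneg_of_mem_Icc
    ⟨by linarith [le_min p.h0 hρ0], by linarith [min_le_right (infDist m T) ρ]⟩
  have cη' : 0 ≤ cos (min (infDist m' T) ρ) := Real.cos_nonneg_of_mem_Icc
    ⟨by linarith [le_min p'.h0 hρ0], by linarith [min_le_right (infDist m' T) ρ]⟩
  have : cos (min (infDist m T) ρ) * cos (min (infDist m' T) ρ) * X +
      sin (min (infDist m T) ρ) * sin (min (infDist m' T) ρ) ≤ 1 := by
    have := Real.cos_le_one (min (infDist m T) ρ - min (infDist m' T) ρ)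
    rw [Real.cos_sub] at this
    have h2 := mul_le_mul_of_nonneg_left hX (mul_nonneg cη cη')
    linarith
  have := mul_nonneg (mul_pos cα cα').le (sub_nonneg.mpr this)
  linarith

theorem abs_le_of_cos {c b d a : ℝ} (hc : 0 < c) (hb0 : 0 ≤ b) (hb : b ≤ Real.pi)
    (hd : |d| ≤ Real.pi)
    (h : c ^ 2 * (1 - cos d) ≤ 1 - cos a) (h' : 1 - cos a ≤ c ^ 2 * (1 - cos b)) : |d| ≤ b := by
  by_contra hlt
  push Not at hlt
  have := Real.cos_lt_cos_of_nonneg_of_le_pi hb0 hd hlt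
  rw [Real.cos_abs] at this
  have := mul_lt_mul_of_pos_left this (pow_pos hc 2)
  linarith

structure Ladder (T : Set M) (ρ a ℓ : ℝ) (n : ℕ) (x y : ℕ → M) (g : ℕ → ℝ → M) : Prop where
  geo : ∀ i ≤ n, IsUnitGeodesicOn (g i) 0 (dist (x i) (y i))
  g0 : ∀ i ≤ n, g i 0 = x i
  g1 : ∀ i ≤ n, g i (dist (x i) (y i)) = y i
  hx : ∀ i ≤ n, infDist (x i) T ≤ ρ
  hy : ∀ i ≤ n, infDist (y i) T ≤ ρ
  hl : ∀ i ≤ n, dist (x i) (y i) ≤ ℓ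
  sx : ∀ i < n, dist (x i) (x (i + 1)) ≤ a
  sy : ∀ i < n, dist (y i) (y (i + 1)) ≤ a
  a0 : 0 ≤ a
  ha : ℓ + a < Real.pi

theorem Ladder.key {T : Set M} (hT : GoodT T) {ρ a ℓ : ℝ} {n : ℕ} {x y : ℕ → M} {g : ℕ → ℝ → M}
    (hL : Ladder T ρ a ℓ n x y g) (hρ0 : 0 ≤ ρ) (hρ : ρ < Real.pi / 2) 
    {β h₀ : ℝ} (hβ0 : 0 ≤ β) (hβ : n * β < Real.pi / 2) (hβπ : β ≤ Real.pi)
    (hβa : 1 - cos a ≤ cos ρ ^ 2 * (1 - cos β)) (hh0 : 0 ≤ h₀) (hh1 : h₀ < Real.pi / 2)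
    (hh : cos h₀ ≤ cos ρ * cos (n * β)) (hsm : 1 - cos a < cos (ℓ / 2) ^ 2 * (1 - sin h₀))
    {i : ℕ} (hi : i + 1 ≤ n)
    (ih1 : ∀ t ∈ Icc 0 (dist (x i) (y i)), infDist (g i t) T < Real.pi / 2)
    (ih2 : ∀ κ t R, 0 ≤ κ → κ ≤ 1 → ZRel (1 - κ) κ (dist (x i) (y i)) t R →
        alp ρ R (sc κ (dist (x i) (y i))) (infDist (g i t) T) ≤ i * β)
    {κ t R t' R' : ℝ} (k0 : 0 ≤ κ) (k1 : κ ≤ 1) (hz : ZRel (1 - κ) κ (dist (x i) (y i)) t R)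
    (hz' : ZRel (1 - κ) κ (dist (x (i+1)) (y (i+1))) t' R') :
    Pt ρ R (sc κ (dist (x i) (y i))) (infDist (g i t) T) ∧
      cos a ≤ R * R' * cos (dist (g i t) (g (i+1) t')) +
        sc κ (dist (x i) (y i)) * sc κ (dist (x (i+1)) (y (i+1))) ∧
      infDist (g i t) T + dist (g i t) (g (i+1) t') < Real.pi / 2 ∧
      dist (g i t) (g (i+1) t') ≤ Real.pi := by
  have hpi := Real.pi_pos
  have cρ : 0 < cos ρ := Real.cos_pos_of_mem_Ioo ⟨by linarith, hρ⟩
  have hlpi : ∀ i ≤ n, dist (x i) (y i) < Real.pi := fun i hi => by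
    linarith [hL.hl i hi, hL.ha, hL.a0]
  have hi' : i ≤ n := by omega
  have d0 : 0 ≤ dist (x i) (y i) := dist_nonneg
  have d0' : 0 ≤ dist (x (i+1)) (y (i+1)) := dist_nonneg
  have lp := hlpi i hi'
  have lp' := hlpi (i+1) hi
  have pt := rung_pt hT hρ (hL.geo i hi') (hL.g0 i hi') (hL.g1 i hi') (hL.hx i hi')
    (hL.hy i hi') lp ih1 k0 k1 hz
  have st := ladder_step hT.cat (hL.geo i hi') (hL.g0 i hi') (hL.g1 i hi') (hL.geo _ hi)
    (hL.g0 _ hi) (hL.g1 _ hi) (hL.sx i (by omega)) (hL.sy i (by omega))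
    (by linarith [hL.hl i hi', hL.ha]) (by linarith [hL.hl _ hi, hL.ha]) k0 k1 hz hz'
  have al1 := ih2 κ t R k0 k1 hz
  obtain ⟨c1, c2⟩ := zrel_R_ge d0 (hL.hl i hi') (by linarith [hL.ha, hL.a0]) hz
  obtain ⟨c1', _⟩ := zrel_R_ge d0' (hL.hl _ hi) (by linarith [hL.ha, hL.a0]) hz'
  have r1 := hz.sq_sc k0 k1
  have r2 := hz'.sq_sc k0 k1
  set s := sc κ (dist (x i) (y i))
  set s' := sc κ (dist (x (i+1)) (y (i+1)))
  set Z := dist (g i t) (g (i+1) t')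
  obtain ⟨m1, m2⟩ := pt.alp_mem hρ0 hρ
  obtain ⟨q, q1, q2, _, q4, _⟩ := pt.rel hρ0 hρ
  set α := alp ρ R s (infDist (g i t) T)
  have cα := Real.cos_pos_of_mem_Ioo ⟨by linarith, m2⟩
  have hin : α ≤ n * β := al1.trans (mul_le_mul_of_nonneg_right (by exact_mod_cast hi') hβ0)
  have b1 : cos (n * β) ≤ cos α := cos_anti m1 (by linarith) hin
  have b2 : cos (max (infDist (g i t) T) ρ) ≤ cos (infDist (g i t) T) :=
    cos_anti infDist_nonneg (by linarith [max_lt pt.h1 hρ]) (le_max_left _ _)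
  have cM : 0 ≤ cos (max (infDist (g i t) T) ρ) := Real.cos_nonneg_of_mem_Icc
    ⟨by linarith [le_max_right (infDist (g i t) T) ρ], (max_lt pt.h1 hρ).le⟩
  have b3 : cos ρ * cos α ≤ cos (max (infDist (g i t) T) ρ) := by
    have e1 := mul_le_mul_of_nonneg_right q1 cα.le
    have e2 := mul_le_mul_of_nonneg_right pt.R1 cM
    linarith
  have b4 : cos h₀ ≤ cos (infDist (g i t) T) := by
    have := mul_le_mul_of_nonneg_left b1 cρ.le
    linarith
  have b5 : infDist (g i t) T ≤ h₀ := by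
    by_contra hlt
    push Not at hlt
    have := Real.cos_lt_cos_of_nonneg_of_le_pi hh0 (by linarith [pt.h1]) hlt
    linarith
  -- Z small
  have z1 : R * R' + s * s' ≤ 1 := by
    have := sq_nonneg (R - R')
    have := sq_nonneg (s - s')
    linarith
  have z2 : cos (ℓ/2) ^ 2 * (1 - cos Z) ≤ 1 - cos a := by
    have e1 : cos (ℓ/2) ^ 2 ≤ R * R' := by
      rw [sq]; exact mul_le_mul c1 c1' c2.le (by linarith)
    have := mul_le_mul_of_nonneg_right e1 (by linarith [Real.cos_le_one Z] : 0 ≤ 1 - cos Z)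
    linarith
  have z3 : sin h₀ < cos Z := by
    have : cos (ℓ/2) ^ 2 * (1 - cos Z) < cos (ℓ/2) ^ 2 * (1 - sin h₀) := lt_of_le_of_lt z2 hsm
    have := lt_of_mul_lt_mul_left this (sq_nonneg _)
    linarith
  have tri : Z ≤ Real.pi := by
    have a1 : dist (g i t) (x i) ≤ Real.pi := by
      have := (geod_dists (hL.geo i hi') ⟨hz.t0, hz.tD⟩).1
      rw [hL.g0 i hi', dist_comm] at this
      rw [this]; linarith [hz.tD]
    by_contra hlt
    push Not at hlt
    -- Z between π and 2π impossible via quadrilateral inequality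
    have d1 := (geod_dists (hL.geo i hi') ⟨hz.t0, hz.tD⟩)
    have d2 := (geod_dists (hL.geo _ hi) ⟨hz'.t0, hz'.tD⟩)
    rw [hL.g0 i hi', hL.g1 i hi'] at d1
    rw [hL.g0 _ hi, hL.g1 _ hi] at d2
    have t1 := dist_triangle4 (g i t) (x i) (x (i+1)) (g (i+1) t')
    have t2 := dist_triangle4 (g i t) (y i) (y (i+1)) (g (i+1) t')
    rw [dist_comm (g i t) (x i), d1.1, d2.1] at t1
    rw [d1.2, dist_comm (y (i+1)), d2.2] at t2
    have := hL.sx i (by omega)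
    have := hL.sy i (by omega)
    have := hL.hl i hi'
    have := hL.hl _ hi
    have := hL.ha
    have := hL.a0
    change Z ≤ _ at t1
    change Z ≤ _ at t2
    linarith
  have z4 : Z < Real.pi / 2 - h₀ := by
    by_contra hge
    push Not at hge
    have := cos_anti (by linarith : 0 ≤ Real.pi / 2 - h₀) tri hge
    rw [Real.cos_pi_div_two_sub] at this
    linarith
  exact ⟨pt, st, by linarith, tri⟩

theorem Ladder.half {T : Set M} (hT : GoodT T) {ρ a ℓ : ℝ} {n : ℕ} {x y : ℕ → M} {g : ℕ → ℝ → M}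
    (hL : Ladder T ρ a ℓ n x y g) (hρ0 : 0 ≤ ρ) (hρ : ρ < Real.pi / 2) (hxy : x 0 = y 0)
    {β h₀ : ℝ} (hβ0 : 0 ≤ β) (hβ : n * β < Real.pi / 2) (hβπ : β ≤ Real.pi)
    (hβa : 1 - cos a ≤ cos ρ ^ 2 * (1 - cos β)) (hh0 : 0 ≤ h₀) (hh1 : h₀ < Real.pi / 2)
    (hh : cos h₀ ≤ cos ρ * cos (n * β)) (hsm : 1 - cos a < cos (ℓ / 2) ^ 2 * (1 - sin h₀)) :
    ∀ i ≤ n, (∀ t ∈ Icc 0 (dist (x i) (y i)), infDist (g i t) T < Real.pi / 2) ∧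
      ∀ κ t R, 0 ≤ κ → κ ≤ 1 → ZRel (1 - κ) κ (dist (x i) (y i)) t R →
        alp ρ R (sc κ (dist (x i) (y i))) (infDist (g i t) T) ≤ i * β := by
  have hpi := Real.pi_pos
  have cρ : 0 < cos ρ := Real.cos_pos_of_mem_Ioo ⟨by linarith, hρ⟩
  have hlpi : ∀ i ≤ n, dist (x i) (y i) < Real.pi := fun i hi => by
    linarith [hL.hl i hi, hL.ha, hL.a0]
  intro i
  induction i with
  | zero =>
    intro hi
    have hd : dist (x 0) (y 0) = 0 := by rw [hxy, dist_self]
    refine ⟨?_, ?_⟩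
    · intro t ht
      rw [hd] at ht
      have : t = 0 := le_antisymm ht.2 ht.1
      rw [this, hL.g0 0 hi]
      exact lt_of_le_of_lt (hL.hx 0 hi) hρ
    · intro κ t R _ _ _
      rw [hd]
      simp [alp, al, sc]
  | succ i ih =>
    intro hi
    have hi' : i ≤ n := by omega
    obtain ⟨ih1, ih2⟩ := ih hi'
    have d0 : 0 ≤ dist (x i) (y i) := dist_nonneg
    have d0' : 0 ≤ dist (x (i+1)) (y (i+1)) := dist_nonneg
    have lp := hlpi i hi'
    have lp' := hlpi (i+1) hi
    -- matching rungs
    have key : ∀ κ t' R', 0 ≤ κ → κ ≤ 1 → ZRel (1 - κ) κ (dist (x (i+1)) (y (i+1))) t' R' →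
        ∃ t R, ZRel (1 - κ) κ (dist (x i) (y i)) t R ∧
          Pt ρ R (sc κ (dist (x i) (y i))) (infDist (g i t) T) ∧
          cos a ≤ R * R' * cos (dist (g i t) (g (i+1) t')) +
            sc κ (dist (x i) (y i)) * sc κ (dist (x (i+1)) (y (i+1))) ∧
          infDist (g (i+1) t') T < Real.pi / 2 ∧ dist (g i t) (g (i+1) t') ≤ Real.pi := by
      intro κ t' R' k0 k1 hz'
      obtain ⟨t, R, hz⟩ := ZRel.exists (w₁ := 1 - κ) (w₂ := κ) (D := dist (x i) (y i))
        (by linarith) k0 (by linarith) d0 lp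
      obtain ⟨pt, st, hh, tri⟩ := hL.key hT hρ0 hρ hβ0 hβ hβπ hβa hh0 hh1 hh hsm hi ih1 ih2 k0 k1
        hz hz'
      have b := infDist_le_infDist_add_dist (x := g (i+1) t') (y := g i t) (s := T)
      rw [dist_comm] at b
      exact ⟨t, R, hz, pt, st, by linarith, tri⟩
    have good : ∀ t ∈ Icc 0 (dist (x (i+1)) (y (i+1))), infDist (g (i+1) t) T < Real.pi / 2 := by
      intro t' ht'
      obtain ⟨κ, R', k0, k1, hz'⟩ := zrel_of_t lp' ht'
      obtain ⟨_, _, _, _, _, h, _⟩ := key κ t' R' k0 k1 hz'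
      exact h
    refine ⟨good, ?_⟩
    intro κ t' R' k0 k1 hz'
    obtain ⟨t, R, hz, pt, st, h, hZ⟩ := key κ t' R' k0 k1 hz'
    have pt' := rung_pt hT hρ (hL.geo _ hi) (hL.g0 _ hi) (hL.g1 _ hi) (hL.hx _ hi)
        (hL.hy _ hi) lp' good k0 k1 hz'
    have as := alpha_step hρ0 hρ pt pt' hZ st
    obtain ⟨m1, m2⟩ := pt.alp_mem hρ0 hρ
    obtain ⟨m1', m2'⟩ := pt'.alp_mem hρ0 hρ
    have := abs_le_of_cos cρ hβ0 hβπ (by rw [abs_le]; constructor <;> linarith) as hβa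
    have := (abs_le.mp this).1
    have := ih2 κ t R k0 k1 hz
    push_cast
    linarith
end


section
variable {M : Type*} [MetricSpace M]

theorem Ladder.prefix {T : Set M} {ρ a ℓ : ℝ} {n k : ℕ} {x y : ℕ → M} {g : ℕ → ℝ → M}
    (hL : Ladder T ρ a ℓ n x y g) (hk : k ≤ n) : Ladder T ρ a ℓ k x y g :=
  ⟨fun i hi => hL.geo i (hi.trans hk), fun i hi => hL.g0 i (hi.trans hk),
    fun i hi => hL.g1 i (hi.trans hk), fun i hi => hL.hx i (hi.trans hk),
    fun i hi => hL.hy i (hi.trans hk), fun i hi => hL.hl i (hi.trans hk),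
    fun i hi => hL.sx i (by omega), fun i hi => hL.sy i (by omega), hL.a0, hL.ha⟩

theorem Ladder.rev {T : Set M} {ρ a ℓ : ℝ} {n : ℕ} {x y : ℕ → M} {g : ℕ → ℝ → M}
    (hL : Ladder T ρ a ℓ n x y g) :
    Ladder T ρ a ℓ n (fun i => x (n - i)) (fun i => y (n - i)) (fun i => g (n - i)) := by
  refine ⟨fun i hi => hL.geo _ (by omega), fun i hi => hL.g0 _ (by omega),
    fun i hi => hL.g1 _ (by omega), fun i hi => hL.hx _ (by omega),
    fun i hi => hL.hy _ (by omega), fun i hi => hL.hl _ (by omega),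
    fun i hi => ?_, fun i hi => ?_, hL.a0, hL.ha⟩
  · have e : n - i = (n - (i + 1)) + 1 := by omega
    simp only [e]
    rw [dist_comm]; exact hL.sx _ (by omega)
  · have e : n - i = (n - (i + 1)) + 1 := by omega
    simp only [e]
    rw [dist_comm]; exact hL.sy _ (by omega)

theorem zrel_half {l : ℝ} (h0 : 0 ≤ l) (h : l < Real.pi) :
    ZRel (1 - 1 / 2) (1 / 2) l (l / 2) (cos (l / 2)) := by
  have z := ZRel.mid h0 h
  have hpi := Real.pi_pos
  refine ⟨z.t0, z.tD, Real.cos_pos_of_mem_Ioo ⟨by linarith, by linarith⟩, ?_, ?_⟩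
  · linarith [z.hs]
  · linarith [z.hc]

theorem sc_half (l : ℝ) : sc (1 / 2) l = sin (l / 2) := by
  have : Real.sqrt (1 / 2 * (1 - 1 / 2)) = 1 / 2 := by
    rw [show (1 / 2 * (1 - 1 / 2) : ℝ) = (1 / 2) ^ 2 by norm_num]
    exact Real.sqrt_sq (by norm_num)
  unfold sc
  rw [this]; ring

theorem Ladder.mid {T : Set M} (hT : GoodT T) {ρ a ℓ : ℝ} {k : ℕ} {x y : ℕ → M} {g : ℕ → ℝ → M}
    (hL : Ladder T ρ a ℓ (2 * k) x y g) (hρ0 : 0 ≤ ρ) (hρ : ρ < Real.pi / 2) (hxy : x 0 = y 0)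
    (hxy' : x (2 * k) = y (2 * k))
    {β h₀ : ℝ} (hβ0 : 0 ≤ β) (hβ : k * β < Real.pi / 2) (hβπ : β ≤ Real.pi)
    (hβa : 1 - cos a ≤ cos ρ ^ 2 * (1 - cos β)) (hh0 : 0 ≤ h₀) (hh1 : h₀ < Real.pi / 2)
    (hh : cos h₀ ≤ cos ρ * cos (k * β)) (hsm : 1 - cos a < cos (ℓ / 2) ^ 2 * (1 - sin h₀)) :
    (∀ i ≤ 2 * k, Pt ρ (cos (dist (x i) (y i) / 2)) (sin (dist (x i) (y i) / 2))
      (infDist (g i (dist (x i) (y i) / 2)) T)) ∧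
    ∀ i < 2 * k,
      (cos a ≤ cos (dist (x i) (y i) / 2) * cos (dist (x (i+1)) (y (i+1)) / 2) *
          cos (dist (g i (dist (x i) (y i) / 2)) (g (i+1) (dist (x (i+1)) (y (i+1)) / 2))) +
        sin (dist (x i) (y i) / 2) * sin (dist (x (i+1)) (y (i+1)) / 2)) ∧
      infDist (g i (dist (x i) (y i) / 2)) T +
        infDist (g (i+1) (dist (x (i+1)) (y (i+1)) / 2)) T +
        dist (g i (dist (x i) (y i) / 2)) (g (i+1) (dist (x (i+1)) (y (i+1)) / 2)) < Real.pi := by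
  have hlpi : ∀ i ≤ 2 * k, dist (x i) (y i) < Real.pi := fun i hi => by
    linarith [hL.hl i hi, hL.ha, hL.a0]
  have L1 := hL.prefix (show k ≤ 2 * k by omega)
  have L2 := hL.rev.prefix (show k ≤ 2 * k by omega)
  have H1 := L1.half hT hρ0 hρ hxy hβ0 hβ hβπ hβa hh0 hh1 hh hsm
  have H2 := L2.half hT hρ0 hρ (by simpa using hxy') hβ0 hβ hβπ hβa hh0 hh1 hh hsm
  have zh : ∀ i ≤ 2 * k, ZRel (1 - 1 / 2) (1 / 2) (dist (x i) (y i)) (dist (x i) (y i) / 2)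
      (cos (dist (x i) (y i) / 2)) := fun i hi => zrel_half dist_nonneg (hlpi i hi)
  have good : ∀ i ≤ 2 * k, ∀ t ∈ Icc 0 (dist (x i) (y i)), infDist (g i t) T < Real.pi / 2 := by
    intro i hi
    by_cases hik : i ≤ k
    · exact (H1 i hik).1
    · have := (H2 (2 * k - i) (by omega)).1
      have e : 2 * k - (2 * k - i) = i := by omega
      simpa only [e] using this
  refine ⟨fun i hi => ?_, fun i hi => ?_⟩
  · have := rung_pt hT hρ (hL.geo i hi) (hL.g0 i hi) (hL.g1 i hi) (hL.hx i hi) (hL.hy i hi)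
      (hlpi i hi) (good i hi) (by norm_num) (by norm_num) (zh i hi)
    rwa [sc_half] at this
  · by_cases hik : i + 1 ≤ k
    · obtain ⟨_, st, hs, _⟩ := L1.key hT hρ0 hρ hβ0 hβ hβπ hβa hh0 hh1 hh hsm hik (H1 i (by omega)).1
        (H1 i (by omega)).2 (by norm_num) (by norm_num) (zh i (by omega)) (zh (i + 1) (by omega))
      rw [sc_half, sc_half] at st
      refine ⟨st, ?_⟩
      have b := infDist_le_infDist_add_dist (x := g (i+1) (dist (x (i+1)) (y (i+1)) / 2))
        (y := g i (dist (x i) (y i) / 2)) (s := T)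
      rw [dist_comm (g (i+1) _)] at b
      linarith
    · have hj : (2 * k - (i + 1)) + 1 ≤ k := by omega
      have e1 : 2 * k - (2 * k - (i + 1)) = i + 1 := by omega
      have e2 : 2 * k - (2 * k - (i + 1) + 1) = i := by omega
      obtain ⟨_, st, hs, _⟩ := L2.key hT hρ0 hρ hβ0 hβ hβπ hβa hh0 hh1 hh hsm hj
        (H2 (2 * k - (i + 1)) (by omega)).1 (H2 (2 * k - (i + 1)) (by omega)).2 (by norm_num) (by norm_num)
        (κ := 1 / 2) (t := dist (x (i+1)) (y (i+1)) / 2) (R := cos (dist (x (i+1)) (y (i+1)) / 2))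
        (t' := dist (x i) (y i) / 2) (R' := cos (dist (x i) (y i) / 2))
        (by simpa only [e1] using zh (i + 1) (by omega)) (by simpa only [e2] using zh i (by omega))
      simp only [e1, e2] at st hs
      rw [sc_half, sc_half] at st
      rw [dist_comm (g (i+1) _)] at st hs
      refine ⟨by linarith, ?_⟩
      have b := infDist_le_infDist_add_dist (y := g (i+1) (dist (x (i+1)) (y (i+1)) / 2))
        (x := g i (dist (x i) (y i) / 2)) (s := T)
      linarith
end


/-- point on the round sphere with given latitude and longitude -/
def sph (α φ : ℝ) : EuclideanSpace ℝ (Fin 3) := !₂[cos α * cos φ, cos α * sin φ, sin α]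

theorem sph_inner (α φ α' φ' : ℝ) : inner ℝ (sph α φ) (sph α' φ') =
    cos α * cos α' * cos (φ' - φ) + sin α * sin α' := by
  simp [sph, PiLp.inner_apply, Fin.sum_univ_three]
  rw [Real.cos_sub]; ring

theorem sph_norm (α φ : ℝ) : ‖sph α φ‖ = 1 := by
  have : ‖sph α φ‖ ^ 2 = 1 := by
    rw [← real_inner_self_eq_norm_sq, sph_inner]
    simp
    nlinarith [Real.sin_sq_add_cos_sq α]
  nlinarith [norm_nonneg (sph α φ)]

theorem sph_angle (α φ α' φ' : ℝ) : InnerProductGeometry.angle (sph α φ) (sph α' φ') =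
    arccos (cos α * cos α' * cos (φ' - φ) + sin α * sin α') := by
  rw [InnerProductGeometry.angle, sph_norm, sph_norm, sph_inner]; simp

theorem sph_chain {α Δ : ℕ → ℝ} {n : ℕ} {β : ℝ} (hβ0 : 0 ≤ β) (hβ : n * β ≤ Real.pi)
    (hst : ∀ i < n, cos β ≤ cos (α i) * cos (α (i+1)) * cos (Δ i) + sin (α i) * sin (α (i+1)))
    {i j : ℕ} (hij : i + j ≤ n) :
    cos (j * β) ≤ cos (α i) * cos (α (i + j)) *
      cos (∑ l ∈ Finset.range (i + j), Δ l - ∑ l ∈ Finset.range i, Δ l) +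
      sin (α i) * sin (α (i + j)) := by
  set φ : ℕ → ℝ := fun i => ∑ l ∈ Finset.range i, Δ l with hφ
  have main : ∀ j, i + j ≤ n →
      InnerProductGeometry.angle (sph (α i) (φ i)) (sph (α (i+j)) (φ (i+j))) ≤ j * β := by
    intro j
    induction j with
    | zero =>
      intro _
      simp only [Nat.add_zero]
      rw [InnerProductGeometry.angle_self]
      · simp
      · intro h
        have := sph_norm (α i) (φ i)
        rw [h] at this; simp at this
    | succ j ih =>
      intro hj
      have h1 := ih (by omega)
      have h2 := InnerProductGeometry.angle_le_angle_add_angle (sph (α i) (φ i))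
        (sph (α (i+j)) (φ (i+j))) (sph (α (i+(j+1))) (φ (i+(j+1))))
      have h3 : InnerProductGeometry.angle (sph (α (i+j)) (φ (i+j)))
          (sph (α (i+(j+1))) (φ (i+(j+1)))) ≤ β := by
        rw [sph_angle]
        have e : φ (i+(j+1)) - φ (i+j) = Δ (i+j) := by
          simp only [hφ]
          rw [← Nat.add_assoc, Finset.sum_range_succ]; ring
        rw [e]
        have := hst (i+j) (by omega)
        have hb : β ≤ Real.pi := by
          have : (1:ℝ) ≤ n := by exact_mod_cast (by omega : 1 ≤ n)
          nlinarith
        rw [← Real.arccos_cos hβ0 hb]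
        exact Real.arccos_le_arccos this
      push_cast
      linarith
  have := main j hij
  have hle : (j:ℝ) * β ≤ Real.pi :=
    (mul_le_mul_of_nonneg_right (by exact_mod_cast (by omega : j ≤ n)) hβ0).trans hβ
  have h2 := cos_anti (InnerProductGeometry.angle_nonneg _ _) hle this
  rw [InnerProductGeometry.cos_angle, sph_norm, sph_norm, sph_inner] at h2
  simpa using h2

/-- the two-sided estimate -/
theorem sph_two {d1 d2 φ Φ α e : ℝ} (h1 : 0 ≤ d1) (h2 : 0 ≤ d2) (hS : d1 + d2 ≤ Real.pi)
    (k1 : cos d1 ≤ cos α * cos φ) (k2 : cos d2 ≤ cos α * cos (Φ - φ)) (he : 0 ≤ e)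
    (hΦ : cos Φ ≤ cos (d1 + d2) + e) : (sin α * sin (d1 + d2)) ^ 2 ≤ 2 * e := by
  have s1 : 0 ≤ sin d1 := Real.sin_nonneg_of_nonneg_of_le_pi h1 (by linarith)
  have s2 : 0 ≤ sin d2 := Real.sin_nonneg_of_nonneg_of_le_pi h2 (by linarith)
  have sS : 0 ≤ sin (d1 + d2) := Real.sin_nonneg_of_nonneg_of_le_pi (by linarith) hS
  have u1 := Real.sin_le_one d1
  have u2 := Real.sin_le_one d2
  have i1 := Real.sin_sq_add_cos_sq d1
  have i2 := Real.sin_sq_add_cos_sq d2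
  have iα := Real.sin_sq_add_cos_sq α
  have iφ := Real.sin_sq_add_cos_sq φ
  have iψ := Real.sin_sq_add_cos_sq (Φ - φ)
  have a1 : sin (d1 + d2) ≤ cos α * (sin d2 * cos φ + sin d1 * cos (Φ - φ)) := by
    have e1 := mul_le_mul_of_nonneg_left k1 s2
    have e2 := mul_le_mul_of_nonneg_left k2 s1
    rw [Real.sin_add]; linarith
  have a2 : sin (d1 + d2) ^ 2 ≤ (cos α * (sin d2 * cos φ + sin d1 * cos (Φ - φ))) ^ 2 :=
    pow_le_pow_left₀ sS a1 2
  have a3 : (sin d2 * cos φ + sin d1 * cos (Φ - φ)) ^ 2 ≤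
      sin d2 ^ 2 + sin d1 ^ 2 + 2 * sin d1 * sin d2 * cos Φ := by
    have e3 : cos Φ = cos φ * cos (Φ - φ) - sin φ * sin (Φ - φ) := by
      rw [← Real.cos_add]; congr 1; ring
    rw [e3]
    have := sq_nonneg (sin d2 * sin φ - sin d1 * sin (Φ - φ))
    nlinarith
  have a4 : sin d2 ^ 2 + sin d1 ^ 2 + 2 * sin d1 * sin d2 * cos (d1 + d2) =
      sin (d1 + d2) ^ 2 := by
    rw [Real.cos_add, Real.sin_add]
    linear_combination (-(sin d2 ^ 2)) * i1 - sin d1 ^ 2 * i2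
  have a5 : sin d2 ^ 2 + sin d1 ^ 2 + 2 * sin d1 * sin d2 * cos Φ ≤ sin (d1 + d2) ^ 2 + 2 * e := by
    have p0 := mul_nonneg s1 s2
    have p1 : sin d1 * sin d2 ≤ 1 := mul_le_one₀ u1 s2 u2
    have p2 := mul_le_mul_of_nonneg_left hΦ p0
    have p3 := mul_le_mul_of_nonneg_right p1 he
    linarith
  have a6 : sin (d1 + d2) ^ 2 ≤ cos α ^ 2 * (sin (d1 + d2) ^ 2 + 2 * e) := by
    rw [mul_pow] at a2
    have := mul_le_mul_of_nonneg_left (a3.trans a5) (sq_nonneg (cos α))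
    linarith
  have a7 : cos α ^ 2 = 1 - sin α ^ 2 := by linarith
  rw [a7] at a6
  rw [mul_pow]
  nlinarith [mul_nonneg (sq_nonneg (sin α)) he]

/-- total longitude is less than `π` -/
theorem half_lt {α φ : ℕ → ℝ} {k : ℕ} {β : ℝ} (hβ0 : 0 ≤ β) (hβ : k * β < Real.pi / 2)
    (h0 : φ 0 = 0) (hα : ∀ j ≤ k, 0 < cos (α j)) (hφ : ∀ j ≤ k, 0 ≤ φ j)
    (hc : ∀ j ≤ k, cos (j * β) ≤ cos (α j) * cos (φ j))
    (hd : ∀ j < k, φ (j+1) - φ j < Real.pi) : ∀ j ≤ k, φ j < Real.pi / 2 := by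
  have hpi := Real.pi_pos
  intro j
  induction j with
  | zero => intro _; rw [h0]; linarith
  | succ j ih =>
    intro hj
    have h1 := ih (by omega)
    have h2 := hd j (by omega)
    by_contra hge
    push Not at hge
    have h3 : cos (φ (j+1)) ≤ 0 := Real.cos_nonpos_of_pi_div_two_le_of_le hge (by linarith)
    have h4 := hc (j+1) hj
    have h5 : 0 < cos (((j+1 : ℕ):ℝ) * β) := by
      apply Real.cos_pos_of_mem_Ioo
      have : ((j+1:ℕ):ℝ) * β ≤ k * β := mul_le_mul_of_nonneg_right (by exact_mod_cast hj) hβ0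
      constructor
      · have : 0 ≤ ((j+1:ℕ):ℝ) * β := by positivity
        linarith
      · linarith
    have h6 := hα (j+1) hj
    have := mul_nonpos_of_nonneg_of_nonpos h6.le h3
    linarith


section
variable {M : Type*} [MetricSpace M]

theorem IsRet.dist_le {T : Set M} {ρ : ℝ} (hρ : 0 ≤ ρ) {m p : M} (h : IsRet T ρ m p) :
    dist p m ≤ infDist m T := by
  obtain ⟨e, he, hd, g, hg, h0, h1, rfl⟩ := h
  have n := infDist_nonneg (x := m) (s := T)
  have hm : min (infDist m T) ρ ∈ Icc 0 (dist e m) := ⟨le_min n hρ, by rw [hd]; exact min_le_left _ _⟩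
  have := (geod_dists hg hm).2
  rw [h1] at this
  rw [this, hd]
  linarith [hm.1]

theorem cosscale_step {c C A β Δ b a : ℝ} (hc : 0 < c) (hC : 0 ≤ C)
    (h1 : c ^ 2 * (1 - A) + C * (1 - b) ≤ 1 - a) (h2 : 1 - a ≤ c ^ 2 * (1 - β))
    (h3 : c ^ 2 * (1 - Δ) ≤ 1 - b) : β ≤ A - C + C * Δ := by
  have := mul_le_mul_of_nonneg_left h3 hC
  have h4 : c ^ 2 * ((1 - A) + C * (1 - Δ)) ≤ c ^ 2 * (1 - β) := by linarith
  have := le_of_mul_le_mul_left h4 (pow_pos hc 2)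
  linarith

theorem Ladder.core {T : Set M} (hT : GoodT T) {ρ a ℓ : ℝ} {k : ℕ} {x y : ℕ → M} {g : ℕ → ℝ → M}
    (hL : Ladder T ρ a ℓ (2 * k) x y g) (hρ0 : 0 ≤ ρ) (hρ : ρ < Real.pi / 2) (hxy : x 0 = y 0)
    (hxy' : x (2 * k) = y (2 * k))
    {β h₀ : ℝ} (hβ0 : 0 ≤ β) (hβ : k * β < Real.pi / 2) (hβπ : β ≤ Real.pi)
    (hβa : 1 - cos a ≤ cos ρ ^ 2 * (1 - cos β)) (hh0 : 0 ≤ h₀) (hh1 : h₀ < Real.pi / 2)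
    (hh : cos h₀ ≤ cos ρ * cos (k * β)) (hsm : 1 - cos a < cos (ℓ / 2) ^ 2 * (1 - sin h₀))
    {b : ℝ} (hb0 : 0 ≤ b) (hb : b < Real.pi * cos ρ)
    (hsm2 : 1 - cos a ≤ cos (k * β) ^ 2 * (1 - cos b)) :
    ∃ p : ℕ → M, p 0 = x 0 ∧ p (2 * k) = x (2 * k) ∧ (∀ i ≤ 2 * k, infDist (p i) T ≤ ρ) ∧
      (∀ i < 2 * k, dist (p i) (p (i+1)) ≤ b) ∧
      (∑ i ∈ Finset.range (2 * k), dist (p i) (p (i+1)) / cos ρ) < Real.pi ∧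
      ∀ e, 0 ≤ e →
        cos (∑ i ∈ Finset.range (2 * k), dist (p i) (p (i+1)) / cos ρ) ≤ cos (2 * k * β) + e →
        ∀ j ≤ 2 * k, (sin (dist (x j) (y j) / 2) * sin (2 * k * β)) ^ 2 ≤ 2 * e := by
  have hpi := Real.pi_pos
  have cρ : 0 < cos ρ := Real.cos_pos_of_mem_Ioo ⟨by linarith, hρ⟩
  have cρ1 := Real.cos_le_one ρ
  obtain ⟨pt, st⟩ := hL.mid hT hρ0 hρ hxy hxy' hβ0 hβ hβπ hβa hh0 hh1 hh hsm
  set d : ℕ → ℝ := fun i => dist (x i) (y i) with hd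
  set m : ℕ → M := fun i => g i (d i / 2) with hm
  change ∀ i ≤ 2 * k, Pt ρ (cos (d i / 2)) (sin (d i / 2)) (infDist (m i) T) at pt
  change ∀ i < 2 * k, cos a ≤ cos (d i / 2) * cos (d (i+1) / 2) * cos (dist (m i) (m (i+1))) +
    sin (d i / 2) * sin (d (i+1) / 2) ∧
    infDist (m i) T + infDist (m (i+1)) T + dist (m i) (m (i+1)) < Real.pi at st
  have ex : ∀ i, ∃ p, i ≤ 2 * k → IsRet T ρ (m i) p := by
    intro i
    by_cases hi : i ≤ 2 * k
    · obtain ⟨p, hp⟩ := IsRet.exists hT ρ (pt i hi).h1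
      exact ⟨p, fun _ => hp⟩
    · exact ⟨m i, fun h => absurd h hi⟩
  choose p hp using ex
  set α : ℕ → ℝ := fun i => alp ρ (cos (d i / 2)) (sin (d i / 2)) (infDist (m i) T) with hα
  have αm : ∀ i ≤ 2 * k, 0 ≤ α i ∧ α i < Real.pi / 2 := fun i hi => (pt i hi).alp_mem hρ0 hρ
  have cα : ∀ i ≤ 2 * k, 0 < cos (α i) := fun i hi =>
    Real.cos_pos_of_mem_Ioo ⟨by linarith [(αm i hi).1], (αm i hi).2⟩
  have d_0 : d 0 = 0 := by simp only [hd]; rw [hxy, dist_self]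
  have d_n : d (2 * k) = 0 := by simp only [hd]; rw [hxy', dist_self]
  have α_0 : α 0 = 0 := by simp only [hα, d_0]; simp [alp, al]
  have α_n : α (2 * k) = 0 := by simp only [hα, d_n]; simp [alp, al]
  have end_p : ∀ i ≤ 2 * k, d i = 0 → p i = x i := by
    intro i hi h
    have e : m i = x i := by simp only [hm]; rw [h, zero_div, hL.g0 i hi]
    rw [← e]
    exact (hp i hi).eq (by rw [e]; exact hL.hx i hi)
  set Δ : ℕ → ℝ := fun i => dist (p i) (p (i+1)) / cos ρ with hΔ
  have Δ0 : ∀ i, 0 ≤ Δ i := fun i => div_nonneg dist_nonneg cρ.le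
  have main : ∀ i < 2 * k, dist (p i) (p (i+1)) ≤ Real.pi ∧
      cos ρ ^ 2 * (1 - cos (α i - α (i+1))) +
      cos (α i) * cos (α (i+1)) * (1 - cos (dist (p i) (p (i+1)))) ≤ 1 - cos a := by
    intro i hi
    obtain ⟨s1, s2⟩ := st i hi
    have pi1 := pt i (by omega)
    have pi2 := pt (i+1) (by omega)
    have r1 := hp i (by omega)
    have r2 := hp (i+1) (by omega)
    have dpi : dist (m i) (m (i+1)) ≤ Real.pi := by linarith [pi1.h0, pi2.h0]
    refine ⟨?_, ?_⟩
    · have := dist_triangle4 (p i) (m i) (m (i+1)) (p (i+1))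
      have := r1.dist_le hρ0
      have := r2.dist_le hρ0
      rw [dist_comm (m (i+1)) (p (i+1))] at *
      linarith
    · obtain ⟨X, hX, eX⟩ := X_le_one dpi pi1.h1 pi2.h1
      have rs := ret_step hT hρ0 r1 r2 pi1.h1 pi2.h1 s2 eX
      rw [eX] at s1
      exact pi1.step pi2 hρ0 hρ hX s1 rs
  have hst : ∀ i < 2 * k, cos β ≤ cos (α i) * cos (α (i+1)) * cos (Δ i) +
      sin (α i) * sin (α (i+1)) := by
    intro i hi
    obtain ⟨s1, s2⟩ := main i hi
    have cs := cos_scale cρ cρ1 (dist_nonneg (x := p i) (y := p (i+1))) s1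
    have := cosscale_step cρ (mul_pos (cα i (by omega)) (cα (i+1) (by omega))).le s2 hβa cs
    rw [Real.cos_sub] at this
    change cos β ≤ _ + _ * cos (Δ i) at this
    linarith
  have hnβ : ((2 * k : ℕ) : ℝ) * β ≤ Real.pi := by push_cast; linarith
  set φ : ℕ → ℝ := fun i => ∑ l ∈ Finset.range i, Δ l with hφ
  have φ0 : φ 0 = 0 := by simp [hφ]
  have c1 : ∀ j ≤ 2 * k, cos (j * β) ≤ cos (α j) * cos (φ j) := by
    intro j hj
    have := sph_chain hβ0 hnβ hst (i := 0) (j := j) (by omega)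
    rw [α_0] at this
    simpa using this
  have c2 : ∀ j ≤ 2 * k, cos (((2 * k - j : ℕ):ℝ) * β) ≤ cos (α j) * cos (φ (2 * k) - φ j) := by
    intro j hj
    have := sph_chain hβ0 hnβ hst (i := j) (j := 2 * k - j) (by omega)
    have e : j + (2 * k - j) = 2 * k := by omega
    rw [e, α_n] at this
    simpa using this
  have ckβ : 0 < cos (k * β) := Real.cos_pos_of_mem_Ioo
    ⟨by have : 0 ≤ k * β := by positivity
        linarith, hβ⟩
  have cge : ∀ j ≤ 2 * k, cos (k * β) ≤ cos (α j) := by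
    intro j hj
    have aux : ∀ (i : ℕ) (u : ℝ), i ≤ k → cos (i * β) ≤ cos (α j) * cos u →
        cos (k * β) ≤ cos (α j) := by
      intro i u hi h
      have h1 : (i:ℝ) * β ≤ k * β := mul_le_mul_of_nonneg_right (by exact_mod_cast hi) hβ0
      have h2 := cos_anti (by positivity) (by linarith) h1
      have h3 := mul_le_mul_of_nonneg_left (Real.cos_le_one u) (cα j hj).le
      linarith
    by_cases hjk : j ≤ k
    · exact aux j _ hjk (c1 j hj)
    · exact aux (2 * k - j) _ (by omega) (c2 j hj)
  have small : ∀ i < 2 * k, dist (p i) (p (i+1)) ≤ b := by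
    intro i hi
    obtain ⟨s1, s2⟩ := main i hi
    have b1 : cos (k * β) ^ 2 ≤ cos (α i) * cos (α (i+1)) := by
      rw [sq]
      exact mul_le_mul (cge i (by omega)) (cge (i+1) (by omega)) ckβ.le (cα i (by omega)).le
    have b2 : 0 ≤ 1 - cos (dist (p i) (p (i+1))) := by linarith [Real.cos_le_one (dist (p i) (p (i+1)))]
    have b3 := mul_le_mul_of_nonneg_right b1 b2
    have b4 : 0 ≤ cos ρ ^ 2 * (1 - cos (α i - α (i+1))) :=
      mul_nonneg (sq_nonneg _) (by linarith [Real.cos_le_one (α i - α (i+1))])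
    have b5 : cos (k * β) ^ 2 * (1 - cos (dist (p i) (p (i+1)))) ≤ 1 - cos a := by linarith
    have hb' : b ≤ Real.pi := by nlinarith
    have := abs_le_of_cos ckβ hb0 hb' (by rw [abs_of_nonneg dist_nonneg]; exact s1) b5 hsm2
    rwa [abs_of_nonneg dist_nonneg] at this
  have Δpi : ∀ i < 2 * k, Δ i < Real.pi := by
    intro i hi
    have := small i hi
    simp only [hΔ]
    rw [div_lt_iff₀ cρ]; linarith
  have φs : ∀ i, φ (i+1) - φ i = Δ i := by
    intro i; simp only [hφ]; rw [Finset.sum_range_succ]; ring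
  have φn : ∀ i, 0 ≤ φ i := fun i => Finset.sum_nonneg fun l _ => Δ0 l
  have φm : Monotone φ := monotone_nat_of_le_succ fun i => by linarith [φs i, Δ0 i]
  have H1 := half_lt (α := α) (φ := φ) hβ0 hβ φ0 (fun j hj => cα j (by omega))
    (fun j hj => φn j) (fun j hj => c1 j (by omega))
    (fun j hj => by rw [φs]; exact Δpi j (by omega)) k le_rfl
  have H2 := half_lt (α := fun j => α (2 * k - j)) (φ := fun j => φ (2 * k) - φ (2 * k - j)) hβ0 hβ
    (by simp) (fun j hj => cα _ (by omega))
    (fun j hj => by linarith [φm (show 2 * k - j ≤ 2 * k by omega)])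
    (fun j hj => by
      have := c2 (2 * k - j) (by omega)
      have e : 2 * k - (2 * k - j) = j := by omega
      rwa [e] at this)
    (fun j hj => by
      have e : 2 * k - j = (2 * k - (j + 1)) + 1 := by omega
      have := φs (2 * k - (j + 1))
      have := Δpi (2 * k - (j + 1)) (by omega)
      rw [e]; linarith) k le_rfl
  have e2k : 2 * k - k = k := by omega
  simp only [e2k] at H2
  refine ⟨p, end_p 0 (by omega) d_0, end_p _ le_rfl d_n, fun i hi => (hp i hi).le hρ0, small,
    by change φ (2 * k) < _; linarith, ?_⟩
  intro e he hΦ j hj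
  change cos (φ (2 * k)) ≤ _ at hΦ
  have eS : 2 * k * β = j * β + ((2 * k - j : ℕ):ℝ) * β := by
    rw [← add_mul, ← Nat.cast_add]
    have : j + (2 * k - j) = 2 * k := by omega
    rw [this]; push_cast; ring
  have two := sph_two (e := e) (by positivity : 0 ≤ (j:ℝ) * β)
    (by positivity : 0 ≤ ((2 * k - j : ℕ):ℝ) * β) (by rw [← eS]; push_cast at hnβ; exact hnβ)
    (c1 j hj) (c2 j hj) he (by rw [← eS]; exact hΦ)
  rw [← eS] at two
  refine le_trans ?_ two
  obtain ⟨q, q1, q2, q3, _, q5, _⟩ := (pt j hj).rel hρ0 hρ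
  have sα : 0 ≤ sin (α j) := Real.sin_nonneg_of_nonneg_of_le_pi (αm j hj).1 (by linarith [(αm j hj).2])
  have hq : q ≤ 1 := by
    have := sq_nonneg (cos (d j / 2) * sin (max (infDist (m j) T) ρ))
    nlinarith
  have : sin (d j / 2) ≤ sin (α j) := by
    rw [← q5]
    calc q * sin (α j) ≤ 1 * sin (α j) := mul_le_mul_of_nonneg_right hq sα
      _ = _ := one_mul _
  rw [mul_pow, mul_pow]
  exact mul_le_mul_of_nonneg_right (pow_le_pow_left₀ (pt j hj).s0 this 2) (sq_nonneg _)
end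


section
variable {M : Type*} [MetricSpace M]

theorem intr_ge (S : Set M) (x y : M) : edist x y ≤ setIntrinsicEDist S x y := by
  unfold setIntrinsicEDist
  refine le_iInf₂ fun γ hγ => ?_
  obtain ⟨_, _, h0, h1⟩ := hγ
  rw [← h0, ← h1]
  exact eVariationOn.edist_le γ (by simp) (by simp)

theorem intr_le_of_lip {S : Set M} {x y : M} {γ : ℝ → M} {C : ℝ≥0}
    (hL : LipschitzOnWith C γ (Icc 0 1)) (hS : MapsTo γ (Icc 0 1) S) (h0 : γ 0 = x) (h1 : γ 1 = y) :
    setIntrinsicEDist S x y ≤ C := by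
  unfold setIntrinsicEDist
  refine (iInf₂_le γ ⟨hL.continuousOn, hS, h0, h1⟩).trans ?_
  have e1 := hL.comp_eVariationOn_le (mapsTo_id (Icc (0:ℝ) 1))
  have e2 : eVariationOn (id : ℝ → ℝ) (Icc 0 1) ≤ 1 := by
    have := ((monotone_id.monotoneOn (Icc (0:ℝ) 1)).eVariationOn_eq (a := 0) (b := 1)
      (by simp) (by simp)).le
    rw [inter_self] at this
    simpa only [id, sub_zero, ENNReal.ofReal_one] using this
  calc eVariationOn γ (Icc 0 1) = eVariationOn (γ ∘ id) (Icc 0 1) := rfl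
    _ ≤ C * eVariationOn (id : ℝ → ℝ) (Icc 0 1) := e1
    _ ≤ C * 1 := by gcongr
    _ = C := mul_one _

theorem ret_lip_alg {K h h' X P ρ D : ℝ} (h0 : 0 ≤ h) (h0' : 0 ≤ h') (h1 : h < Real.pi / 2)
    (h1' : h' < Real.pi / 2) (hρ0 : 0 ≤ ρ) (hρ : ρ < Real.pi / 2)
    (hK : 1 ≤ K) (hX : X ≤ 1) (k1 : cos (min h ρ) ≤ K * cos h) (k2 : cos (min h' ρ) ≤ K * cos h')
    (hD : cos D = cos h * cos h' * X + sin h * sin h')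
    (hP : cos (min h ρ) * cos (min h' ρ) * X + sin (min h ρ) * sin (min h' ρ) ≤ P) :
    1 - P ≤ K ^ 2 * (1 - cos D) := by
  have hpi := Real.pi_pos
  have ch : 0 < cos h := Real.cos_pos_of_mem_Ioo ⟨by linarith, h1⟩
  have cη' : 0 ≤ cos (min h' ρ) := Real.cos_nonneg_of_mem_Icc
    ⟨by linarith [le_min h0' hρ0], by linarith [min_le_right h' ρ]⟩
  have e1 : cos (min h ρ) * cos (min h' ρ) ≤ (K * cos h) * (K * cos h') :=
    mul_le_mul k1 k2 cη' (by positivity)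
  have e2 := mul_le_mul_of_nonneg_right e1 (by linarith : 0 ≤ 1 - X)
  have e3 : cos (h - h') ≤ cos (min h ρ - min h' ρ) := by
    rw [← Real.cos_abs (h - h'), ← Real.cos_abs (min h ρ - min h' ρ)]
    apply cos_anti (abs_nonneg _)
    · rw [abs_le]; constructor <;> linarith
    · have := abs_min_sub_min_le_max h ρ h' ρ
      simpa using this
  have e4 : 1 - cos (h - h') ≤ K ^ 2 * (1 - cos (h - h')) := by
    have : 0 ≤ 1 - cos (h - h') := by linarith [Real.cos_le_one (h - h')]
    have hK2 : 1 ≤ K ^ 2 := one_le_pow₀ hK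
    have := mul_le_mul_of_nonneg_right hK2 this
    linarith
  rw [Real.cos_sub] at e3 e4
  rw [Real.cos_sub] at e3
  rw [hD]
  linarith

theorem exists_scale {ρ η : ℝ} (hρ0 : 0 ≤ ρ) (hρ : ρ < Real.pi / 2) (hη : 0 < η) :
    ∃ l > 0, l ≤ 1 ∧ cos ρ ≤ (1 + η) * cos (ρ + l) := by
  have hpi := Real.pi_pos
  have cρ : 0 < cos ρ := Real.cos_pos_of_mem_Ioo ⟨by linarith, hρ⟩
  have hc : Continuous fun l : ℝ => (1 + η) * cos (ρ + l) := by fun_prop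
  have : ∀ᶠ l in 𝓝 (0:ℝ), cos ρ < (1 + η) * cos (ρ + l) := by
    apply hc.continuousAt.eventually_const_lt
    simp; nlinarith
  have h2 : ∀ᶠ l in 𝓝[>] (0:ℝ), cos ρ < (1 + η) * cos (ρ + l) := nhdsWithin_le_nhds this
  have h3 : ∀ᶠ l in 𝓝[>] (0:ℝ), l < 1 := nhdsWithin_le_nhds (Iio_mem_nhds one_pos)
  obtain ⟨l, ⟨hl, h'⟩, h⟩ := ((h2.and h3).and self_mem_nhdsWithin).exists
  exact ⟨l, h, h'.le, hl.le⟩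

theorem intr_le {T : Set M} (hT : GoodT T) {ρ η : ℝ} (hρ0 : 0 ≤ ρ) (hρ : ρ < Real.pi / 2)
    (hη : 0 < η) : ∃ ℓ₀ > 0, ∀ x y : M, infDist x T ≤ ρ → infDist y T ≤ ρ → dist x y ≤ ℓ₀ →
      setIntrinsicEDist {x | infDist x T ≤ ρ} x y ≤ ENNReal.ofReal ((1 + η) * dist x y) := by
  have hpi := Real.pi_pos
  set η' := min (η / 3) 1 with hη'
  have p0 : 0 < η' := lt_min (by linarith) one_pos
  have p1 : η' ≤ 1 := min_le_right _ _
  have p2 : η' ≤ η / 3 := min_le_left _ _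
  obtain ⟨l₁, l1pos, l1le, hl1⟩ := exists_scale hρ0 hρ p0
  obtain ⟨a0, a0pos, ha1, ha⟩ := lemI (K := 1 + η') (η := η') (by linarith) p0
  set ℓ₀ := min (min l₁ a0) ((Real.pi / 2 - ρ) / 2) with hℓ
  have q1 : ℓ₀ ≤ l₁ := (min_le_left _ _).trans (min_le_left _ _)
  have q2 : ℓ₀ ≤ a0 := (min_le_left _ _).trans (min_le_right _ _)
  have q3 : ℓ₀ ≤ (Real.pi / 2 - ρ) / 2 := min_le_right _ _
  have q0 : 0 < ℓ₀ := lt_min (lt_min l1pos a0pos) (by linarith)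
  refine ⟨ℓ₀, q0, fun x y hx hy hxy => ?_⟩
  obtain ⟨g, hg, g0, g1⟩ := cat_geod hT.cat (x := x) (y := y) (by linarith)
  set l := dist x y with hl
  have l0 : 0 ≤ l := dist_nonneg
  have hts : ∀ t ∈ Icc 0 l, infDist (g t) T ≤ ρ + ℓ₀ := by
    intro t ht
    have b := infDist_le_infDist_add_dist (x := g t) (y := x) (s := T)
    have := (geod_dists hg ht).1
    rw [g0, dist_comm] at this
    rw [this] at b
    linarith [ht.2]
  have ex : ∀ t, ∃ p, t ∈ Icc 0 l → IsRet T ρ (g t) p := by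
    intro t
    by_cases ht : t ∈ Icc 0 l
    · obtain ⟨p, hp⟩ := IsRet.exists hT ρ (m := g t) (by linarith [hts t ht])
      exact ⟨p, fun _ => hp⟩
    · exact ⟨g t, fun h => absurd h ht⟩
  choose r hr using ex
  have cK : ∀ t ∈ Icc 0 l, cos (min (infDist (g t) T) ρ) ≤ (1 + η') * cos (infDist (g t) T) := by
    intro t ht
    have n := infDist_nonneg (x := g t) (s := T)
    have := hts t ht
    rcases le_total (infDist (g t) T) ρ with h | h
    · rw [min_eq_left h]
      have : 0 < cos (infDist (g t) T) := Real.cos_pos_of_mem_Ioo ⟨by linarith, by linarith⟩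
      nlinarith
    · rw [min_eq_right h]
      have c1 : cos (ρ + ℓ₀) ≤ cos (infDist (g t) T) := cos_anti n (by linarith) this
      have hlpi : ρ + l₁ ≤ Real.pi := by linarith [Real.two_le_pi]
      have c2 : cos (ρ + l₁) ≤ cos (ρ + ℓ₀) := cos_anti (by linarith) hlpi (by linarith)
      have : (1 + η') * cos (ρ + l₁) ≤ (1 + η') * cos (infDist (g t) T) :=
        mul_le_mul_of_nonneg_left (c2.trans c1) (by linarith)
      linarith
  have lip : ∀ t ∈ Icc 0 l, ∀ t' ∈ Icc 0 l, dist (r t) (r t') ≤ (1 + η) * |t - t'| := by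
    intro t ht t' ht'
    have n := infDist_nonneg (x := g t) (s := T)
    have n' := infDist_nonneg (x := g t') (s := T)
    have b := hts t ht
    have b' := hts t' ht'
    have hd := hg t ht t' ht'
    have habs : |t - t'| ≤ ℓ₀ := by
      rw [abs_le]; constructor <;> linarith [ht.1, ht.2, ht'.1, ht'.2]
    have hsum : infDist (g t) T + infDist (g t') T + dist (g t) (g t') < Real.pi := by
      rw [hd]; linarith
    have H1 : infDist (g t) T < Real.pi / 2 := by linarith
    have H2 : infDist (g t') T < Real.pi / 2 := by linarith
    obtain ⟨X, hX, eX⟩ := X_le_one (T := T) (m := g t) (m' := g t') (by linarith) H1 H2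
    have rs := ret_step hT hρ0 (hr t ht) (hr t' ht') H1 H2 hsum eX
    have al := ret_lip_alg n n' H1 H2 hρ0 hρ (by linarith : (1:ℝ) ≤ 1 + η') hX (cK t ht) (cK t' ht')
      eX rs
    rw [hd] at al
    have li := ha |t - t'| (abs_nonneg _) (by linarith)
    have pp : dist (r t) (r t') ≤ Real.pi := by
      have := dist_triangle4 (r t) (g t) (g t') (r t')
      have := (hr t ht).dist_le hρ0
      have := (hr t' ht').dist_le hρ0
      rw [dist_comm (g t') (r t')] at *
      linarith
    have hB : dist (r t) (r t') ≤ (1 + η') * (1 + η') * |t - t'| := by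
      by_contra hlt
      push Not at hlt
      have := Real.cos_lt_cos_of_nonneg_of_le_pi (by positivity) pp hlt
      linarith
    refine hB.trans (mul_le_mul_of_nonneg_right ?_ (abs_nonneg _))
    nlinarith
  have C0 : 0 ≤ (1 + η) * l := by positivity
  have mem : ∀ u ∈ Icc (0:ℝ) 1, u * l ∈ Icc 0 l := fun u hu =>
    ⟨mul_nonneg hu.1 l0, by nlinarith [hu.2]⟩
  have := intr_le_of_lip (S := {x | infDist x T ≤ ρ}) (x := x) (y := y) (γ := fun u => r (u * l))
    (C := ⟨(1 + η) * l, C0⟩) ?_ ?_ ?_ ?_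
  · rw [ENNReal.ofReal, Real.toNNReal_of_nonneg C0]; exact this
  · refine LipschitzOnWith.of_dist_le_mul fun u hu v hv => ?_
    have := lip _ (mem u hu) _ (mem v hv)
    rw [← sub_mul, abs_mul, abs_of_nonneg l0] at this
    rw [Real.dist_eq]
    change _ ≤ (1 + η) * l * |u - v|
    linarith
  · intro u hu
    exact (hr _ (mem u hu)).le hρ0
  · have m0 : (0:ℝ) ∈ Icc 0 l := ⟨le_rfl, l0⟩
    simp only [zero_mul]
    rw [(hr 0 m0).eq (by rw [g0]; exact hx), g0]
  · have m0 : l ∈ Icc 0 l := ⟨l0, le_rfl⟩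
    simp only [one_mul]
    rw [(hr l m0).eq (by rw [g1]; exact hy), g1]
end


theorem one_sub_cos_lt {a v : ℝ} (h0 : 0 ≤ a) (h1 : a ≤ 1) (hv : 0 < v) (h : a ≤ v) :
    1 - cos a < v := by
  have := Real.one_sub_sq_div_two_le_cos (x := a)
  nlinarith

section
variable {M : Type*} [MetricSpace M]

theorem Ladder.core2 {T : Set M} (hT : GoodT T) {ρ s₁ η b : ℝ} (hρ0 : 0 ≤ ρ) (hρ : ρ < Real.pi / 2)
    (hs0 : 0 < s₁) (hs1 : s₁ < Real.pi) (hη : 0 < η) (hb0 : 0 < b) (hb : b < Real.pi * cos ρ) :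
    ∃ a₁ > 0, ∀ (a : ℝ) (k : ℕ) (x y : ℕ → M) (g : ℕ → ℝ → M),
      Ladder T ρ a s₁ (2 * k) x y g → a ≤ a₁ → 2 * k * ((1 + η) * a / cos ρ) ≤ s₁ →
      x 0 = y 0 → x (2 * k) = y (2 * k) →
    ∃ p : ℕ → M, p 0 = x 0 ∧ p (2 * k) = x (2 * k) ∧ (∀ i ≤ 2 * k, infDist (p i) T ≤ ρ) ∧
      (∀ i < 2 * k, dist (p i) (p (i+1)) ≤ b) ∧
      (∑ i ∈ Finset.range (2 * k), dist (p i) (p (i+1)) / cos ρ) < Real.pi ∧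
      ∀ e, 0 ≤ e →
        cos (∑ i ∈ Finset.range (2 * k), dist (p i) (p (i+1)) / cos ρ) ≤
          cos (2 * k * ((1 + η) * a / cos ρ)) + e →
        ∀ j ≤ 2 * k, (sin (dist (x j) (y j) / 2) * sin (2 * k * ((1 + η) * a / cos ρ))) ^ 2 ≤
          2 * e := by
  have hpi := Real.pi_pos
  have cρ : 0 < cos ρ := Real.cos_pos_of_mem_Ioo ⟨by linarith, hρ⟩
  have cρ1 := Real.cos_le_one ρ
  have cs : 0 < cos (s₁ / 2) := Real.cos_pos_of_mem_Ioo ⟨by linarith, by linarith⟩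
  have cs1 := Real.cos_le_one (s₁ / 2)
  obtain ⟨a0, a0pos, ha1, ha⟩ := lemI (K := 1 / cos ρ) (η := η) (by positivity) hη
  set h₀ := arccos (cos ρ * cos (s₁ / 2)) with hh₀
  have hpos : 0 < cos ρ * cos (s₁ / 2) := mul_pos cρ cs
  have hh0 : 0 ≤ h₀ := Real.arccos_nonneg _
  have hh1 : h₀ < Real.pi / 2 := Real.arccos_lt_pi_div_two.mpr hpos
  have ch0 : cos h₀ = cos ρ * cos (s₁ / 2) :=
    Real.cos_arccos (by linarith) (mul_le_one₀ cρ1 cs.le cs1)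
  have sh0 : 0 < 1 - sin h₀ := by
    have i := Real.sin_sq_add_cos_sq h₀
    rw [ch0] at i
    nlinarith [sq_pos_of_pos hpos, Real.sin_le_one h₀]
  have hbpi : b ≤ Real.pi := by nlinarith
  have cb : 0 < 1 - cos b := by
    have := Real.cos_lt_cos_of_nonneg_of_le_pi le_rfl hbpi hb0
    rw [Real.cos_zero] at this; linarith
  have v1 : 0 < cos (s₁ / 2) ^ 2 * (1 - sin h₀) := by positivity
  have v2 : 0 < cos (s₁ / 2) ^ 2 * (1 - cos b) := by positivity
  refine ⟨min (min a0 1) (min (cos (s₁ / 2) ^ 2 * (1 - sin h₀)) (cos (s₁ / 2) ^ 2 * (1 - cos b))),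
    lt_min (lt_min a0pos one_pos) (lt_min v1 v2), ?_⟩
  intro a k x y g hL haa hS hxy hxy'
  have A0 := hL.a0
  have A1 : a ≤ a0 := haa.trans ((min_le_left _ _).trans (min_le_left _ _))
  have A2 : a ≤ 1 := haa.trans ((min_le_left _ _).trans (min_le_right _ _))
  have A3 := haa.trans ((min_le_right _ _).trans (min_le_left _ _))
  have A4 := haa.trans ((min_le_right _ _).trans (min_le_right _ _))
  have eβ : (1 + η) * (1 / cos ρ) * a = (1 + η) * a / cos ρ := by ring
  have hb1 := ha a A0 A1
  rw [eβ] at hb1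
  have hβ1 : (1 + η) * a / cos ρ ≤ 1 := by
    rw [← eβ]
    refine le_trans ?_ ha1
    gcongr
  have hβ0 : 0 ≤ (1 + η) * a / cos ρ := by positivity
  set β := (1 + η) * a / cos ρ
  have hkβ : k * β ≤ s₁ / 2 := by linarith
  have hck : cos (s₁ / 2) ≤ cos (k * β) := cos_anti (by positivity) (by linarith) hkβ
  refine hL.core hT hρ0 hρ hxy hxy' hβ0 (by linarith) (by linarith [Real.two_le_pi]) ?_ hh0 hh1 ?_
    (one_sub_cos_lt A0 A2 v1 A3) hb0.le hb ?_
  · have : cos ρ ^ 2 * ((1 / cos ρ) ^ 2 * (1 - cos a)) ≤ cos ρ ^ 2 * (1 - cos β) :=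
      mul_le_mul_of_nonneg_left hb1 (sq_nonneg _)
    have e : cos ρ ^ 2 * ((1 / cos ρ) ^ 2 * (1 - cos a)) = 1 - cos a := by field_simp
    linarith
  · rw [ch0]; exact mul_le_mul_of_nonneg_left hck cρ.le
  · refine (one_sub_cos_lt A0 A2 v2 A4).le.trans ?_
    exact mul_le_mul_of_nonneg_right (pow_le_pow_left₀ cs.le hck 2) cb.le

theorem sin_ge_min {s0 s1 S : ℝ} (h0 : 0 ≤ s0) (h1 : s1 ≤ Real.pi) (hS : S ∈ Icc s0 s1) :
    min (sin s0) (sin s1) ≤ sin S := by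
  by_cases h : S ≤ Real.pi / 2
  · exact (min_le_left _ _).trans
      (Real.sin_le_sin_of_le_of_le_pi_div_two (by linarith [Real.pi_pos]) h hS.1)
  · push Not at h
    refine (min_le_right _ _).trans ?_
    rw [← Real.sin_pi_sub s1, ← Real.sin_pi_sub S]
    exact Real.sin_le_sin_of_le_of_le_pi_div_two (by linarith [Real.pi_pos]) (by linarith) (by linarith [hS.2])

theorem cos_lip {A B : ℝ} (h : A ≤ B) : cos A ≤ cos B + (B - A) := by
  have e1 : cos A - cos B = 2 * sin ((A + B) / 2) * sin ((B - A) / 2) := by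
    rw [Real.cos_sub_cos]
    have a2 : (A - B) / 2 = -((B - A) / 2) := by ring
    rw [a2, Real.sin_neg]; ring
  have h1 := Real.abs_sin_le_one ((A + B) / 2)
  have h2 : |sin ((B - A) / 2)| ≤ |(B - A) / 2| := Real.abs_sin_le_abs
  rw [abs_of_nonneg (a := (B - A) / 2) (by linarith)] at h2
  have h3 : sin ((A + B) / 2) * sin ((B - A) / 2) ≤ 1 * ((B - A) / 2) :=
    (le_abs_self _).trans (by rw [abs_mul]; exact mul_le_mul h1 h2 (abs_nonneg _) zero_le_one)
  linarith

theorem const_speed_dist {N : Type*} [MetricSpace N] {γ : ℝ → N} {L : ℝ≥0}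
    (h : HasConstantSpeedOnWith γ (Icc 0 1) L) {t t' : ℝ} (ht : t ∈ Icc (0:ℝ) 1)
    (ht' : t' ∈ Icc (0:ℝ) 1) : dist (γ t) (γ t') ≤ L * |t - t'| := by
  wlog hle : t ≤ t' with H
  · rw [dist_comm, abs_sub_comm]; exact H h ht' ht (by linarith)
  have h1 := h ht ht'
  have h2 := eVariationOn.edist_le γ (s := Icc 0 1 ∩ Icc t t') (x := t) (y := t')
    ⟨ht, le_rfl, hle⟩ ⟨ht', hle, le_rfl⟩
  rw [h1, edist_dist, ENNReal.ofReal_le_ofReal_iff] at h2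
  · rw [abs_sub_comm, abs_of_nonneg (by linarith)]; exact h2
  · have : 0 ≤ t' - t := by linarith
    positivity
end


section
variable {M N : Type*} [MetricSpace M] [MetricSpace N]

theorem curves_close {T : Set M} (hT : GoodT T) {ρ s₀ s₁ η b a₁ ℓ₁ : ℝ} (hρ0 : 0 ≤ ρ)
    (hρ : ρ < Real.pi / 2) (hs0 : 0 < s₀) (hs1 : s₁ < Real.pi) (hη : 0 < η)
    {ι : N → M} (hinj : Function.Injective ι)
    (hrange : range ι = {x : M | infDist x T ≤ ρ})
    (hN : ∀ x y : N, dist (ι x) (ι y) ≤ dist x y)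
    (hℓ₁ : ∀ x y : N, dist (ι x) (ι y) ≤ ℓ₁ → dist x y ≤ 2 * dist (ι x) (ι y))
    (hb : ∀ x y : N, dist (ι x) (ι y) ≤ b → dist x y ≤ (1 + η) * dist (ι x) (ι y))
    (H : ∀ (a : ℝ) (k : ℕ) (x y : ℕ → M) (g : ℕ → ℝ → M),
      Ladder T ρ a s₁ (2 * k) x y g → a ≤ a₁ → 2 * k * ((1 + η) * a / cos ρ) ≤ s₁ →
      x 0 = y 0 → x (2 * k) = y (2 * k) →
    ∃ p : ℕ → M, p 0 = x 0 ∧ p (2 * k) = x (2 * k) ∧ (∀ i ≤ 2 * k, infDist (p i) T ≤ ρ) ∧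
      (∀ i < 2 * k, dist (p i) (p (i+1)) ≤ b) ∧
      (∑ i ∈ Finset.range (2 * k), dist (p i) (p (i+1)) / cos ρ) < Real.pi ∧
      ∀ e, 0 ≤ e →
        cos (∑ i ∈ Finset.range (2 * k), dist (p i) (p (i+1)) / cos ρ) ≤
          cos (2 * k * ((1 + η) * a / cos ρ)) + e →
        ∀ j ≤ 2 * k, (sin (dist (x j) (y j) / 2) * sin (2 * k * ((1 + η) * a / cos ρ))) ^ 2 ≤
          2 * e)
    {p q : N} {γ₁ γ₂ : ℝ → N} {L₁ L₂ : ℝ≥0} {Λ e μ σ : ℝ} {k : ℕ} (hk : 0 < k)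
    (h₁ : HasConstantSpeedOnWith γ₁ (Icc 0 1) L₁) (h10 : γ₁ 0 = p) (h11 : γ₁ 1 = q)
    (h₂ : HasConstantSpeedOnWith γ₂ (Icc 0 1) L₂) (h20 : γ₂ 0 = p) (h21 : γ₂ 1 = q)
    (hL1 : L₁ ≤ Λ) (hL2 : L₂ ≤ Λ) (ha : Λ / (2 * k) ≤ a₁) (hπ : s₁ + Λ / (2 * k) < Real.pi)
    (hS : (1 + η) * Λ / cos ρ ≤ s₁) (hD : s₀ ≤ dist p q)
    (he : (1 + η) * Λ / cos ρ - dist p q / ((1 + η) * cos ρ) ≤ e)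
    (hμ : 0 < μ) (hμ1 : μ ≤ ℓ₁) (hσ : 0 < σ) (hσ0 : σ ≤ sin s₀) (hσ1 : σ ≤ sin s₁)
    (he2 : 2 * e ≤ (μ * σ / Real.pi) ^ 2) {t : ℝ} (ht : t ∈ Icc (0:ℝ) 1) :
    dist (γ₁ t) (γ₂ t) ≤ 2 * μ + 2 * (Λ / (2 * k)) := by
  have hpi := Real.pi_pos
  have cρ : 0 < cos ρ := Real.cos_pos_of_mem_Ioo ⟨by linarith, hρ⟩
  have cρ1 := Real.cos_le_one ρ
  have kp : (0:ℝ) < 2 * k := by positivity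
  have I0 : (0:ℝ) ∈ Icc (0:ℝ) 1 := ⟨le_rfl, zero_le_one⟩
  have I1 : (1:ℝ) ∈ Icc (0:ℝ) 1 := ⟨zero_le_one, le_rfl⟩
  have hDΛ : dist p q ≤ Λ := by
    have := const_speed_dist h₁ I0 I1
    rw [h10, h11] at this
    simp at this
    linarith
  have Λ0 : 0 < Λ := by linarith
  have hΛS : Λ ≤ (1 + η) * Λ / cos ρ := by
    rw [le_div_iff₀ cρ]; nlinarith
  have sΛ : Λ ≤ s₁ := hΛS.trans hS
  have hmid : ∀ t ∈ Icc (0:ℝ) 1, dist (γ₁ t) (γ₂ t) ≤ Λ := by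
    intro t ht
    have e1 := const_speed_dist h₁ ht I0
    have e2 := const_speed_dist h₂ I0 ht
    have e3 := const_speed_dist h₁ ht I1
    have e4 := const_speed_dist h₂ I1 ht
    have f1 := dist_triangle (γ₁ t) (γ₁ 0) (γ₂ t)
    have f2 := dist_triangle (γ₁ t) (γ₁ 1) (γ₂ t)
    rw [abs_of_nonneg (by linarith [ht.1])] at e1
    rw [abs_sub_comm, abs_of_nonneg (by linarith [ht.1])] at e2
    rw [abs_sub_comm, abs_of_nonneg (by linarith [ht.2])] at e3
    rw [abs_of_nonneg (by linarith [ht.2])] at e4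
    have g1 : dist (γ₁ 0) (γ₂ t) = dist (γ₂ 0) (γ₂ t) := by rw [h10, h20]
    have g2 : dist (γ₁ 1) (γ₂ t) = dist (γ₂ 1) (γ₂ t) := by rw [h11, h21]
    linarith
  have hmem : ∀ i ≤ 2 * k, (i : ℝ) / (2 * k) ∈ Icc (0:ℝ) 1 := by
    intro i hi
    refine ⟨by positivity, ?_⟩
    rw [div_le_one kp]; exact_mod_cast hi
  have hin : ∀ z : N, infDist (ι z) T ≤ ρ := fun z => by
    have : ι z ∈ range ι := mem_range_self z
    rwa [hrange] at this
  set X : ℕ → N := fun i => γ₁ (i / (2 * k)) with hX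
  set Y : ℕ → N := fun i => γ₂ (i / (2 * k)) with hY
  have hXY : ∀ i ≤ 2 * k, dist (X i) (Y i) ≤ Λ := fun i hi => hmid _ (hmem i hi)
  have hgeo : ∀ i, ∃ g : ℝ → M, i ≤ 2 * k → (IsUnitGeodesicOn g 0 (dist (ι (X i)) (ι (Y i))) ∧
      g 0 = ι (X i) ∧ g (dist (ι (X i)) (ι (Y i))) = ι (Y i)) := by
    intro i
    by_cases hi : i ≤ 2 * k
    · obtain ⟨g, hg⟩ := cat_geod hT.cat (x := ι (X i)) (y := ι (Y i))
        (by linarith [hN (X i) (Y i), hXY i hi])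
      exact ⟨g, fun _ => hg⟩
    · exact ⟨fun _ => ι (X i), fun h => absurd h hi⟩
  choose g hg using hgeo
  have hstep : ∀ (γ : ℝ → N) (L : ℝ≥0), HasConstantSpeedOnWith γ (Icc 0 1) L → (L : ℝ) ≤ Λ →
      ∀ i < 2 * k, dist (γ (i / (2 * k))) (γ ((i + 1 : ℕ) / (2 * k))) ≤ Λ / (2 * k) := by
    intro γ L h hL i hi
    have := const_speed_dist h (hmem i hi.le) (hmem (i+1) hi)
    have e : |(i:ℝ) / (2 * k) - ((i + 1 : ℕ) : ℝ) / (2 * k)| = 1 / (2 * k) := by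
      rw [abs_sub_comm, ← sub_div]
      push_cast
      rw [add_sub_cancel_left]
      exact abs_of_pos (by positivity)
    rw [e] at this
    refine this.trans ?_
    rw [mul_one_div]
    gcongr
  have hLad : Ladder T ρ (Λ / (2 * k)) s₁ (2 * k) (fun i => ι (X i)) (fun i => ι (Y i)) g :=
    { geo := fun i hi => (hg i hi).1
      g0 := fun i hi => (hg i hi).2.1
      g1 := fun i hi => (hg i hi).2.2
      hx := fun i hi => hin _
      hy := fun i hi => hin _
      hl := fun i hi => (hN _ _).trans ((hXY i hi).trans sΛ)
      sx := fun i hi => (hN _ _).trans (hstep γ₁ L₁ h₁ hL1 i hi)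
      sy := fun i hi => (hN _ _).trans (hstep γ₂ L₂ h₂ hL2 i hi)
      a0 := by positivity
      ha := hπ }
  have eS : 2 * (k:ℝ) * ((1 + η) * (Λ / (2 * k)) / cos ρ) = (1 + η) * Λ / cos ρ := by
    field_simp
  have X0 : X 0 = p := by simp [hX, h10]
  have Y0 : Y 0 = p := by simp [hY, h20]
  have e2k : ((2 * k : ℕ) : ℝ) / (2 * k) = 1 := by
    push_cast; exact div_self kp.ne'
  have X1 : X (2 * k) = q := by simp only [hX]; rw [e2k, h11]
  have Y1 : Y (2 * k) = q := by simp only [hY]; rw [e2k, h21]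
  obtain ⟨P, P0, P1, Pin, Pb, Pπ, Pe⟩ := H _ k _ _ g hLad ha (by rw [eS]; exact hS)
    (by simp only [X0, Y0]) (by simp only [X1, Y1])
  simp only [eS, X0, X1] at P0 P1 Pe
  set S := (1 + η) * Λ / cos ρ with hSdef
  have hlift : ∀ i, ∃ z : N, i ≤ 2 * k → ι z = P i := by
    intro i
    by_cases hi : i ≤ 2 * k
    · have : P i ∈ range ι := by rw [hrange]; exact Pin i hi
      obtain ⟨z, hz⟩ := this
      exact ⟨z, fun _ => hz⟩
    · exact ⟨p, fun h => absurd h hi⟩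
  choose Z hZ using hlift
  have Z0 : Z 0 = p := hinj ((hZ 0 (by omega)).trans P0)
  have Z1 : Z (2 * k) = q := hinj ((hZ _ le_rfl).trans P1)
  have hlen : dist p q ≤ (1 + η) * cos ρ *
      ∑ i ∈ Finset.range (2 * k), dist (P i) (P (i+1)) / cos ρ := by
    rw [← Z0, ← Z1]
    refine (dist_le_range_sum_dist Z (2 * k)).trans ?_
    rw [Finset.mul_sum]
    refine Finset.sum_le_sum fun i hi => ?_
    have hi' := Finset.mem_range.mp hi
    have := hb (Z i) (Z (i+1))
    rw [hZ i hi'.le, hZ (i+1) hi'] at this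
    refine (this (Pb i hi')).trans (le_of_eq ?_)
    field_simp
  set Φ := ∑ i ∈ Finset.range (2 * k), dist (P i) (P (i+1)) / cos ρ with hΦ
  have c1 : 0 < (1 + η) * cos ρ := by positivity
  have hΦ0 : dist p q / ((1 + η) * cos ρ) ≤ Φ := by
    rw [div_le_iff₀ c1]; linarith
  have hΦ1 : dist p q / ((1 + η) * cos ρ) ≤ S := by
    rw [hSdef, div_le_div_iff₀ c1 cρ]
    have : dist p q * cos ρ ≤ Λ * cos ρ := mul_le_mul_of_nonneg_right hDΛ cρ.le
    have h2 : 1 ≤ (1 + η) * (1 + η) := by nlinarith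
    have h3 : 0 ≤ Λ * cos ρ := by positivity
    nlinarith
  have hcos : cos Φ ≤ cos S + e := by
    have i1 := cos_anti (x := dist p q / ((1 + η) * cos ρ)) (by positivity) Pπ.le hΦ0
    have i2 := cos_lip hΦ1
    linarith
  have hfin := Pe e (by linarith) hcos
  have hsin : σ ≤ sin S := (le_min hσ0 hσ1).trans
    (sin_ge_min hs0.le hs1.le ⟨by linarith, hS⟩)
  have hclose : ∀ j ≤ 2 * k, dist (X j) (Y j) ≤ 2 * μ := by
    intro j hj
    have f := (hfin j hj).trans he2
    have dM : dist (ι (X j)) (ι (Y j)) ≤ s₁ := hLad.hl j hj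
    set d := dist (ι (X j)) (ι (Y j)) with hd
    have d0 : 0 ≤ d := dist_nonneg
    have sd0 : 0 ≤ sin (d / 2) := Real.sin_nonneg_of_nonneg_of_le_pi (by linarith) (by linarith)
    have f2 : sin (d / 2) * sin S ≤ μ * σ / Real.pi := by
      refine le_of_sq_le_sq f (by positivity)
    have f3 : sin (d / 2) * σ ≤ μ / Real.pi * σ := by
      have := mul_le_mul_of_nonneg_left hsin sd0
      calc _ ≤ μ * σ / Real.pi := this.trans f2
        _ = _ := by ring
    have f4 : sin (d / 2) ≤ μ / Real.pi := le_of_mul_le_mul_right f3 hσ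
    have f5 := Real.mul_le_sin (x := d / 2) (by linarith) (by linarith)
    have f6 : d / Real.pi ≤ μ / Real.pi := by
      calc d / Real.pi = 2 / Real.pi * (d / 2) := by ring
        _ ≤ _ := f5.trans f4
    have f7 : d ≤ μ := (div_le_div_iff_of_pos_right hpi).mp f6
    have := hℓ₁ (X j) (Y j) (f7.trans hμ1)
    linarith
  -- general parameter
  set j := ⌊t * (2 * k)⌋₊ with hj
  have tk : 0 ≤ t * (2 * k) := mul_nonneg ht.1 kp.le
  have j1 : (j : ℝ) ≤ t * (2 * k) := Nat.floor_le tk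
  have j2 : t * (2 * k) < j + 1 := Nat.lt_floor_add_one _
  have j3 : j ≤ 2 * k := by
    have : (j : ℝ) ≤ ((2 * k : ℕ) : ℝ) := by
      push_cast
      refine j1.trans ?_
      nlinarith [ht.2]
    exact_mod_cast this
  have habs : |t - (j:ℝ) / (2 * k)| ≤ 1 / (2 * k) := by
    have q1 : (j:ℝ) / (2 * k) ≤ t := by rw [div_le_iff₀ kp]; exact j1
    have q2 : t ≤ ((j:ℝ) + 1) / (2 * k) := by rw [le_div_iff₀ kp]; exact j2.le
    rw [add_div] at q2
    rw [abs_of_nonneg (by linarith)]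
    linarith
  have hb2 : ∀ (γ : ℝ → N) (L : ℝ≥0), HasConstantSpeedOnWith γ (Icc 0 1) L → (L : ℝ) ≤ Λ →
      dist (γ t) (γ (j / (2 * k))) ≤ Λ / (2 * k) := by
    intro γ L h hL
    refine (const_speed_dist h ht (hmem j j3)).trans ?_
    calc (L:ℝ) * _ ≤ Λ * (1 / (2 * k)) := mul_le_mul hL habs (abs_nonneg _) Λ0.le
      _ = _ := by ring
  have k1 := hb2 γ₁ L₁ h₁ hL1
  have k2 := hb2 γ₂ L₂ h₂ hL2
  have k3 := hclose j j3
  have k4 := dist_triangle4 (γ₁ t) (X j) (Y j) (γ₂ t)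
  rw [dist_comm (Y j)] at k4
  linarith

end


section
variable {M N : Type*} [MetricSpace M] [MetricSpace N]

set_option maxHeartbeats 1000000 in
theorem tube_injProp {T : Set M} (hT : GoodT T) {ρ r : ℝ} (hρ0 : 0 ≤ ρ)
    (hρ : ρ < Real.pi / 2) {ι : N → M} (hinj : Function.Injective ι)
    (hrange : range ι = {x : M | infDist x T ≤ ρ})
    (hmetric : ∀ x y : N,
      edist x y = setIntrinsicEDist {x : M | infDist x T ≤ ρ} (ι x) (ι y))
    (hr0 : 0 < r) (hr : r < Real.pi * cos ρ) (p : N) : InjPropAt p r := by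
  have hpi := Real.pi_pos
  have cρ : 0 < cos ρ := Real.cos_pos_of_mem_Ioo ⟨by linarith, hρ⟩
  have cρ1 := Real.cos_le_one ρ
  have hin : ∀ z : N, infDist (ι z) T ≤ ρ := fun z => by
    have : ι z ∈ range ι := mem_range_self z
    rwa [hrange] at this
  have hN : ∀ x y : N, dist (ι x) (ι y) ≤ dist x y := by
    intro x y
    have := intr_ge {x : M | infDist x T ≤ ρ} (ι x) (ι y)
    rw [← hmetric, edist_dist, edist_dist, ENNReal.ofReal_le_ofReal_iff dist_nonneg] at this
    exact this
  have hloc : ∀ η : ℝ, 0 < η → ∃ ℓ > 0, ∀ x y : N, dist (ι x) (ι y) ≤ ℓ →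
      dist x y ≤ (1 + η) * dist (ι x) (ι y) := by
    intro η hη
    obtain ⟨ℓ, h0, h⟩ := intr_le hT hρ0 hρ hη
    refine ⟨ℓ, h0, fun x y hxy => ?_⟩
    have := h _ _ (hin x) (hin y) hxy
    rw [← hmetric, edist_dist, ENNReal.ofReal_le_ofReal_iff (by positivity)] at this
    exact this
  intro ε hε
  have hrc : r / cos ρ < Real.pi := by rw [div_lt_iff₀ cρ]; exact hr
  have hrc0 : 0 < r / cos ρ := by positivity
  obtain ⟨s₁, hs1⟩ : ∃ s₁, s₁ = (r / cos ρ + Real.pi) / 2 := ⟨_, rfl⟩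
  have s1π : s₁ < Real.pi := by linarith
  have s1r : r / cos ρ < s₁ := by linarith
  have s10 : 0 < s₁ := by linarith
  obtain ⟨ω, hω⟩ : ∃ ω, ω = cos ρ * s₁ - r := ⟨_, rfl⟩
  have ω0 : 0 < ω := by
    rw [div_lt_iff₀ cρ] at s1r; linarith
  obtain ⟨ℓ₁, ℓ10, hℓ₁⟩ := hloc 1 one_pos
  obtain ⟨μ, hμ⟩ : ∃ μ, μ = min ℓ₁ (ε / 8) := ⟨_, rfl⟩
  have μ0 : 0 < μ := by rw [hμ]; exact lt_min ℓ10 (by linarith)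
  have μ1 : μ ≤ ℓ₁ := by rw [hμ]; exact min_le_left _ _
  have μ2 : μ ≤ ε / 8 := by rw [hμ]; exact min_le_right _ _
  obtain ⟨s₀, hs0⟩ : ∃ s₀, s₀ = min (ε / 4) (s₁ / 2) := ⟨_, rfl⟩
  have s00 : 0 < s₀ := by rw [hs0]; exact lt_min (by linarith) (by linarith)
  have s01 : s₀ ≤ ε / 4 := by rw [hs0]; exact min_le_left _ _
  have s02 : s₀ ≤ s₁ / 2 := by rw [hs0]; exact min_le_right _ _
  obtain ⟨σ, hσ⟩ : ∃ σ, σ = min (sin s₀) (sin s₁) := ⟨_, rfl⟩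
  have σ0 : 0 < σ := by
    rw [hσ]
    exact lt_min (Real.sin_pos_of_pos_of_lt_pi s00 (by linarith))
      (Real.sin_pos_of_pos_of_lt_pi s10 s1π)
  have σ1 : σ ≤ sin s₀ := by rw [hσ]; exact min_le_left _ _
  have σ2 : σ ≤ sin s₁ := by rw [hσ]; exact min_le_right _ _
  obtain ⟨e, he⟩ : ∃ e, e = (μ * σ / Real.pi) ^ 2 / 2 := ⟨_, rfl⟩
  have e0 : 0 < e := by rw [he]; positivity
  obtain ⟨η, hη⟩ : ∃ η, η = min 1 (min (ω / (2 * r)) (cos ρ * e / (4 * r))) := ⟨_, rfl⟩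
  have η0 : 0 < η := by rw [hη]; refine lt_min one_pos (lt_min ?_ ?_) <;> positivity
  have η1 : η ≤ 1 := by rw [hη]; exact min_le_left _ _
  have η2 : η * r ≤ ω / 2 := by
    have : η ≤ ω / (2 * r) := by rw [hη]; exact (min_le_right _ _).trans (min_le_left _ _)
    rw [le_div_iff₀ (by positivity)] at this
    linarith
  have η3 : η * r ≤ cos ρ * e / 4 := by
    have : η ≤ cos ρ * e / (4 * r) := by rw [hη]; exact (min_le_right _ _).trans (min_le_right _ _)
    rw [le_div_iff₀ (by positivity)] at this
    linarith
  obtain ⟨δ, hδ⟩ : ∃ δ, δ = min (ε / 4) (min (ω / 4) (cos ρ * e / 4)) := ⟨_, rfl⟩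
  have δ0 : 0 < δ := by rw [hδ]; refine lt_min ?_ (lt_min ?_ ?_) <;> positivity
  have δ1 : δ ≤ ε / 4 := by rw [hδ]; exact min_le_left _ _
  have δ2 : δ ≤ ω / 4 := by rw [hδ]; exact (min_le_right _ _).trans (min_le_left _ _)
  have δ3 : δ ≤ cos ρ * e / 4 := by rw [hδ]; exact (min_le_right _ _).trans (min_le_right _ _)
  obtain ⟨ℓ₀, ℓ00, hℓ₀⟩ := hloc η η0
  obtain ⟨b, hb⟩ : ∃ b, b = min ℓ₀ (cos ρ) := ⟨_, rfl⟩
  have b0 : 0 < b := by rw [hb]; exact lt_min ℓ00 cρ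
  have b1 : b ≤ ℓ₀ := by rw [hb]; exact min_le_left _ _
  have b2 : b < Real.pi * cos ρ := by
    have : b ≤ cos ρ := by rw [hb]; exact min_le_right _ _
    nlinarith [Real.two_le_pi]
  obtain ⟨a₁, a10, H⟩ := Ladder.core2 hT hρ0 hρ s10 s1π η0 b0 b2
  obtain ⟨a₂, ha2⟩ : ∃ a, a = min a₁ (min (ε / 8) ((Real.pi - s₁) / 2)) := ⟨_, rfl⟩
  have a20 : 0 < a₂ := by
    rw [ha2]; exact lt_min a10 (lt_min (by linarith) (by linarith))
  have a21 : a₂ ≤ a₁ := by rw [ha2]; exact min_le_left _ _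
  have a22 : a₂ ≤ ε / 8 := by rw [ha2]; exact (min_le_right _ _).trans (min_le_left _ _)
  have a23 : a₂ ≤ (Real.pi - s₁) / 2 := by
    rw [ha2]; exact (min_le_right _ _).trans (min_le_right _ _)
  obtain ⟨k, hk⟩ := exists_nat_gt ((r + δ) / a₂)
  have kp : (0:ℝ) < k := lt_trans (by positivity) hk
  have hk2 : (r + δ) / (2 * k) ≤ a₂ := by
    rw [div_lt_iff₀ a20] at hk
    rw [div_le_iff₀ (by positivity)]
    nlinarith
  refine ⟨δ, δ0, ?_⟩
  intro q hq γ₁ γ₂ L₁ L₂ h₁ h10 h11 hL1 h₂ h20 h21 hL2 t ht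
  have l1 := (abs_lt.mp hL1).2
  have l2 := (abs_lt.mp hL2).2
  have D0 : 0 ≤ dist p q := dist_nonneg
  by_cases hD : dist p q < ε / 4
  · have I0 : (0:ℝ) ∈ Icc (0:ℝ) 1 := ⟨le_rfl, zero_le_one⟩
    have e1 := const_speed_dist h₁ ht I0
    have e2 := const_speed_dist h₂ I0 ht
    rw [abs_of_nonneg (by linarith [ht.1])] at e1
    rw [abs_sub_comm, abs_of_nonneg (by linarith [ht.1])] at e2
    have f1 := dist_triangle (γ₁ t) (γ₁ 0) (γ₂ t)
    have g1 : dist (γ₁ 0) (γ₂ t) = dist (γ₂ 0) (γ₂ t) := by rw [h10, h20]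
    have m1 : (L₁:ℝ) * (t - 0) ≤ L₁ := mul_le_of_le_one_right L₁.2 (by linarith [ht.2])
    have m2 : (L₂:ℝ) * (t - 0) ≤ L₂ := mul_le_of_le_one_right L₂.2 (by linarith [ht.2])
    linarith
  · push Not at hD
    have hΛk : (dist p q + δ) / (2 * k) ≤ a₂ := by
      refine le_trans ?_ hk2
      gcongr
    have hηD : η * dist p q ≤ η * r := mul_le_mul_of_nonneg_left hq.le η0.le
    have hηδ : η * δ ≤ δ := mul_le_of_le_one_left δ0.le η1
    have key := curves_close (N := N) hT (s₀ := s₀) hρ0 hρ s00 s1π η0 hinj hrange hN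
      (ℓ₁ := ℓ₁) (fun x y h => by have := hℓ₁ x y h; linarith)
      (b := b) (fun x y h => hℓ₀ x y (h.trans b1)) H (p := p) (q := q)
      (Λ := dist p q + δ) (e := e) (μ := μ) (σ := σ) (k := k) (by exact_mod_cast kp)
      h₁ h10 h11 h₂ h20 h21 (by linarith) (by linarith) (hΛk.trans a21) (by linarith)
      (by rw [div_le_iff₀ cρ]; linarith [hηD, hηδ, η2, δ2]) (by linarith)
      (by
        have c1 : 0 < (1 + η) * cos ρ := by positivity
        have e1 : dist p q * (1 - η) / cos ρ ≤ dist p q / ((1 + η) * cos ρ) := by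
          rw [div_le_div_iff₀ cρ c1]
          have : (1 - η) * (1 + η) ≤ 1 := by nlinarith
          have h3 : 0 ≤ dist p q * cos ρ := by positivity
          nlinarith
        have e2 : (1 + η) * (dist p q + δ) / cos ρ - dist p q * (1 - η) / cos ρ ≤ e := by
          rw [← sub_div, div_le_iff₀ cρ]
          linarith [hηD, hηδ, η3, δ3]
        linarith)
      μ0 μ1 σ0 σ1 σ2 (by rw [he]; linarith) ht
    linarith

end


section
variable {M N : Type*} [MetricSpace M] [MetricSpace N]

theorem closure_convex (hM : CatK 1 M) {T : Set M} (hT : PiTotallyConvex T) :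
    PiTotallyConvex (closure T) := by
  intro g L hL0 hLπ hg hx hy t ht
  have hpi := Real.pi_pos
  rcases hL0.eq_or_lt with h | hL
  · have : t = 0 := le_antisymm (by rw [h]; exact ht.2) ht.1
    rw [this]; exact hx
  obtain ⟨x, hxT, hxl⟩ := mem_closure_iff_seq_limit.mp hx
  obtain ⟨y, hyT, hyl⟩ := mem_closure_iff_seq_limit.mp hy
  obtain ⟨d1, d2⟩ := geod_dists hg ht
  have dL : dist (g 0) (g L) = L := (geod_dists hg ⟨hL0, le_rfl⟩).1
  set w := g t with hw
  set ℓ : ℕ → ℝ := fun n => dist (x n) (y n) with hℓ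
  have hℓl : Tendsto ℓ atTop (𝓝 L) := by
    have := hxl.dist hyl; rwa [dL] at this
  have hxw : Tendsto (fun n => dist w (x n)) atTop (𝓝 t) := by
    have := (tendsto_const_nhds (x := w)).dist hxl
    rwa [dist_comm w, d1] at this
  have hyw : Tendsto (fun n => dist w (y n)) atTop (𝓝 (L - t)) := by
    have := (tendsto_const_nhds (x := w)).dist hyl
    rwa [d2] at this
  set τ : ℕ → ℝ := fun n => t * ℓ n / L with hτ
  have hτl : Tendsto τ atTop (𝓝 t) := by
    have := (hℓl.const_mul t).div_const L
    rwa [mul_div_assoc, div_self hL.ne', mul_one] at this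
  have hτm : ∀ n, τ n ∈ Icc 0 (ℓ n) := by
    intro n
    have : 0 ≤ ℓ n := dist_nonneg
    refine ⟨div_nonneg (mul_nonneg ht.1 this) hL0, ?_⟩
    rw [hτ]; simp only
    rw [div_le_iff₀ hL]
    nlinarith [ht.2]
  have ev1 : ∀ᶠ n in atTop, ℓ n < Real.pi := hℓl.eventually_lt_const hLπ
  have ev0 : ∀ᶠ n in atTop, 0 < ℓ n := hℓl.eventually_const_lt hL
  have hgeo : ∀ n, ∃ h : ℝ → M, ℓ n < Real.pi → (IsUnitGeodesicOn h 0 (dist (x n) (y n)) ∧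
      h 0 = x n ∧ h (dist (x n) (y n)) = y n) := by
    intro n
    by_cases hn : ℓ n < Real.pi
    · obtain ⟨h, hh⟩ := cat_geod hM hn
      exact ⟨h, fun _ => hh⟩
    · exact ⟨fun _ => x n, fun h => absurd h hn⟩
  choose h hh using hgeo
  have evper : ∀ᶠ n in atTop, dist w (x n) + ℓ n + dist w (y n) < 2 * Real.pi := by
    have := (hxw.add hℓl).add hyw
    exact this.eventually_lt_const (by linarith)
  have hlow : Tendsto (fun n => (sin (ℓ n - τ n) * cos (dist w (x n)) +
      sin (τ n) * cos (dist w (y n))) / sin (ℓ n)) atTop (𝓝 1) := by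
    have sL : sin L ≠ 0 := (Real.sin_pos_of_pos_of_lt_pi hL hLπ).ne'
    have e : (1:ℝ) = (sin (L - t) * cos t + sin t * cos (L - t)) / sin L := by
      rw [eq_div_iff sL, one_mul, mul_comm (sin t), ← Real.sin_add]; congr 1; ring
    rw [e]
    refine Tendsto.div (Tendsto.add (Tendsto.mul ?_ ?_) (Tendsto.mul ?_ ?_)) ?_ sL
    · exact (Real.continuous_sin.tendsto _).comp (hℓl.sub hτl)
    · exact (Real.continuous_cos.tendsto _).comp hxw
    · exact (Real.continuous_sin.tendsto _).comp hτl
    · exact (Real.continuous_cos.tendsto _).comp hyw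
    · exact (Real.continuous_sin.tendsto _).comp hℓl
  have hcos : Tendsto (fun n => cos (dist w (h n (τ n)))) atTop (𝓝 1) := by
    refine tendsto_of_tendsto_of_tendsto_of_le_of_le' hlow tendsto_const_nhds ?_
      (Eventually.of_forall fun n => Real.cos_le_one _)
    filter_upwards [ev0, ev1, evper] with n n0 n1 n2
    obtain ⟨a1, a2, a3⟩ := hh n n1
    have sn : 0 < sin (ℓ n) := Real.sin_pos_of_pos_of_lt_pi n0 n1
    rw [div_le_iff₀ sn, mul_comm _ (sin (ℓ n))]
    refine cat_weight hM a1 a2 a3 (w₁ := sin (ℓ n - τ n)) (w₂ := sin (τ n)) (t := τ n)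
      (R := sin (ℓ n)) ⟨(hτm n).1, (hτm n).2, sn, mul_comm _ _, ?_⟩ ?_
    · rw [Real.sin_sub]; ring
    · rw [dist_comm (y n) w]; exact n2
  have hbd : ∀ᶠ n in atTop, dist w (h n (τ n)) ≤ Real.pi := by
    filter_upwards [ev1, evper] with n n1 n2
    obtain ⟨a1, a2, a3⟩ := hh n n1
    obtain ⟨f1, f2⟩ := geod_dists a1 (hτm n)
    rw [a2] at f1
    rw [a3] at f2
    have t1 := dist_triangle w (x n) (h n (τ n))
    have t2 := dist_triangle w (y n) (h n (τ n))
    rw [dist_comm (y n) (h n (τ n))] at t2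
    have : ℓ n = dist (x n) (y n) := rfl
    linarith
  have hd0 : Tendsto (fun n => dist (h n (τ n)) w) atTop (𝓝 0) := by
    have := (Real.continuous_arccos.tendsto _).comp hcos
    rw [Real.arccos_one] at this
    refine this.congr' ?_
    filter_upwards [hbd] with n hn
    simp only [Function.comp]
    rw [Real.arccos_cos dist_nonneg hn, dist_comm]
  refine mem_closure_of_tendsto (tendsto_iff_dist_tendsto_zero.mpr hd0) ?_
  filter_upwards [ev1] with n n1
  obtain ⟨a1, a2, a3⟩ := hh n n1
  exact hT (h n) (dist (x n) (y n)) dist_nonneg n1 a1 (by rw [a2]; exact hxT n)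
    (by rw [a3]; exact hyT n) _ (hτm n)

theorem tube_good {T : Set M} (hT : GoodT T) {ρ : ℝ} (hρ0 : 0 ≤ ρ)
    (hρ : ρ < Real.pi / 2) {ι : N → M} (hinj : Function.Injective ι)
    (hrange : range ι = {x : M | infDist x T ≤ ρ})
    (hmetric : ∀ x y : N,
      edist x y = setIntrinsicEDist {x : M | infDist x T ≤ ρ} (ι x) (ι y)) :
    ENNReal.ofReal (Real.pi * cos ρ) ≤ injRad N := by
  refine le_iInf fun p => ?_
  refine le_of_forall_lt fun c hc => ?_
  have cρ : 0 < cos ρ := Real.cos_pos_of_mem_Ioo ⟨by linarith, hρ⟩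
  have hA : 0 < Real.pi * cos ρ := mul_pos Real.pi_pos cρ
  have hc' : c.toReal < Real.pi * cos ρ :=
    (ENNReal.lt_ofReal_iff_toReal_lt (ne_top_of_lt hc)).mp hc
  have c0 : 0 ≤ c.toReal := ENNReal.toReal_nonneg
  have hr0 : 0 < (c.toReal + Real.pi * cos ρ) / 2 := by linarith
  have hr1 : (c.toReal + Real.pi * cos ρ) / 2 < Real.pi * cos ρ := by linarith
  have key := tube_injProp hT hρ0 hρ hinj hrange hmetric hr0 hr1 p
  have : c < ENNReal.ofReal ((c.toReal + Real.pi * cos ρ) / 2) :=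
    (ENNReal.lt_ofReal_iff_toReal_lt (ne_top_of_lt hc)).mpr (by linarith)
  refine this.trans_le ?_
  exact le_iSup₂ (f := fun (ρ : ℝ) (_ : InjPropAt p ρ) => ENNReal.ofReal ρ) _ key

end

end Helpers

/-- **Example 1.5 (injectivity radius bound).**  Let `T` be a `π`-totally-convex set in a
CAT(1) space `M` and let `N` be the set of points at distance `≤ ρ` from `T`, `ρ < π/2`,
equipped with its induced intrinsic (length) metric (formalized by a bijection
`ι : N → {x | d(x,T) ≤ ρ}` under which the distance of `N` is the induced intrinsic
distance).  Then `N` has injectivity radius at least `π cos ρ`. -/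
theorem tube_injectivity_radius {M N : Type*} [MetricSpace M] [MetricSpace N]
    (hM : CatK 1 M) (T : Set M) (hT : PiTotallyConvex T) (ρ : ℝ) (hρ : ρ < Real.pi / 2)
    (ι : N → M) (hinj : Function.Injective ι)
    (hrange : Set.range ι = {x : M | Metric.infDist x T ≤ ρ})
    (hmetric : ∀ x y : N,
      edist x y = setIntrinsicEDist {x : M | Metric.infDist x T ≤ ρ} (ι x) (ι y)) :
    ENNReal.ofReal (Real.pi * Real.cos ρ) ≤ injRad N := by
  rcases isEmpty_or_nonempty N with hE | ⟨⟨p⟩⟩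
  · unfold injRad
    rw [iInf_of_empty]; exact le_top
  have hρ0 : 0 ≤ ρ := by
    have : ι p ∈ Set.range ι := Set.mem_range_self p
    rw [hrange] at this
    exact Metric.infDist_nonneg.trans this
  rcases T.eq_empty_or_nonempty with hTe | hTn
  · have e : {x : M | Metric.infDist x T ≤ ρ} = {x : M | Metric.infDist x Set.univ ≤ ρ} := by
      ext x
      simp [hTe, Metric.infDist_empty, Metric.infDist_zero_of_mem (Set.mem_univ x)]
    rw [e] at hrange hmetric
    exact tube_good ⟨hM, isClosed_univ, ⟨ι p, Set.mem_univ _⟩, fun _ _ _ _ _ _ _ _ _ =>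
      Set.mem_univ _⟩ hρ0 hρ hinj hrange hmetric
  · have e : {x : M | Metric.infDist x T ≤ ρ} = {x : M | Metric.infDist x (closure T) ≤ ρ} := by
      ext x
      simp [Metric.infDist_closure]
    rw [e] at hrange hmetric
    exact tube_good ⟨hM, isClosed_closure, hTn.closure, closure_convex hM hT⟩ hρ0 hρ hinj
      hrange hmetric

end
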